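/- Let (R,m) be a Noetherian local ring and M a finitely generated R-module with r = dim_R M ≥ 2. Let U = U_{M̂}(0) be the unmixed component of (0) in the m-adic completion M̂. Then the following are equivalent: (1) the set Λ(M) = {e_1(Q,M) : Q a parameter ideal for M} has exactly one element; (2) dim_{R̂} U ≤ r−2 and M̂/U is a Buchsbaum R̂-module. When this is the case, e_1(Q,M) = −Σ_{i=1}^{r−1} C(r−2, i−1) · h^i(M̂/U) for every parameter ideal Q for M, where h^i denotes the length of the i-th local cohomology module with support in the maximal ideal. -/

import Mathlib

open IsLocalRing

section Defs

variable (R : Type) [CommRing R]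

/-- The length of a module, as the Krull dimension of its lattice of submodules. -/
noncomputable def mLength (M : Type) [AddCommGroup M] [Module R M] : WithBot ℕ∞ :=
  Order.krullDim (Submodule R M)

/-- The (Krull) dimension of a module. -/
noncomputable def mDim (M : Type) [AddCommGroup M] [Module R M] : WithBot ℕ∞ :=
  ringKrullDim (R ⧸ Submodule.annihilator (⊤ : Submodule R M))

/-- `f` is eventually given by the Hilbert-type polynomial of degree `t` with
coefficients `s 0, …, s t` (written in the binomial basis with alternating signs). -/
def IsHilbPolyAt (f : ℕ → WithBot ℕ∞) (t : ℕ) (s : ℕ → ℤ) : Prop :=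
  ∃ N : ℕ, ∀ n ≥ N, ∃ l : ℕ, f n = (l : ℕ∞) ∧
    (l : ℤ) = ∑ i ∈ Finset.range (t + 1), (-1 : ℤ) ^ i * s i * ((n + t - i).choose (t - i) : ℤ)

/-- `s 0, …, s t` are the Hilbert coefficients `e_i(I, M)`, i.e.
`λ(M/I^{n+1}M) = ∑ (-1)^i e_i(I,M) C(n+t-i, t-i)` for `n ≫ 0`. -/
def HasHilbCoeffs (I : Ideal R) (M : Type) [AddCommGroup M] [Module R M]
    (t : ℕ) (s : ℕ → ℤ) : Prop :=
  IsHilbPolyAt (fun n => mLength R (M ⧸ (I ^ (n + 1) • (⊤ : Submodule R M)))) t s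

/-- The unmixed component `U_M(0)` of `M`: the largest submodule of dimension `< dim M`. -/
noncomputable def unmixedComp (M : Type) [AddCommGroup M] [Module R M] : Submodule R M :=
  sSup {N : Submodule R M | mDim R ↥N < mDim R M}

/-- `x` is a d-sequence on `M`. -/
def IsDSeq {r : ℕ} (x : Fin r → R) (M : Type) [AddCommGroup M] [Module R M] : Prop :=
  ∀ i j : Fin r, i ≤ j →
    Submodule.comap (LinearMap.lsmul R M (x i * x j))
        (Ideal.span (x '' {k | k < i}) • (⊤ : Submodule R M))
      = Submodule.comap (LinearMap.lsmul R M (x j))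
        (Ideal.span (x '' {k | k < i}) • (⊤ : Submodule R M))

/-- `x` is a standard (d⁺-) system: all power sequences in any order are d-sequences. -/
def IsStandardSeq {r : ℕ} (x : Fin r → R) (M : Type) [AddCommGroup M] [Module R M] : Prop :=
  ∀ n : Fin r → ℕ, (∀ k, 1 ≤ n k) → ∀ σ : Equiv.Perm (Fin r),
    IsDSeq R (fun k => x (σ k) ^ n (σ k)) M

/-- The integral closure of an ideal, as a set. -/
def intClos (Q : Ideal R) : Set R :=
  {x : R | ∃ n : ℕ, 0 < n ∧ ∃ a : ℕ → R, (∀ i, 1 ≤ i → i ≤ n → a i ∈ Q ^ i) ∧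
    x ^ n + ∑ i ∈ Finset.Icc 1 n, a i * x ^ (n - i) = 0}

variable [IsLocalRing R]

/-- `h ∈ I` is superficial for `M` with respect to `I`. -/
def IsSuperficial (I : Ideal R) (M : Type) [AddCommGroup M] [Module R M] (h : R) : Prop :=
  h ∈ I ∧ ∃ c N : ℕ, ∀ n ≥ N,
    Submodule.comap (LinearMap.lsmul R M h) (I ^ (n + 1) • (⊤ : Submodule R M))
        ⊓ (I ^ c • (⊤ : Submodule R M))
      = I ^ n • (⊤ : Submodule R M)

/-- `Q` is a parameter ideal for `M` (`r` the dimension of `M`):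
generated by `r` elements of the maximal ideal with `M/QM` of finite length. -/
def IsParamIdeal (Q : Ideal R) (M : Type) [AddCommGroup M] [Module R M] (r : ℕ) : Prop :=
  Q ≤ maximalIdeal R ∧ (∃ x : Fin r → R, Q = Ideal.span (Set.range x)) ∧
    IsFiniteLength R (M ⧸ Q • (⊤ : Submodule R M))

/-- Local cohomology `H^i_𝔪(M)` with support in the maximal ideal. -/
noncomputable def LC (i : ℕ) (M : Type) [AddCommGroup M] [Module R M] : ModuleCat R :=
  (localCohomology (maximalIdeal R) i).obj (ModuleCat.of R M)

/-- `M` is Cohen–Macaulay: there is a regular sequence on `M` in the maximal ideal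
whose length equals `dim M`. -/
def IsCM (M : Type) [AddCommGroup M] [Module R M] : Prop :=
  ∃ rs : List R, (∀ x ∈ rs, x ∈ maximalIdeal R) ∧ RingTheory.Sequence.IsRegular M rs ∧
    (rs.length : WithBot ℕ∞) = mDim R M

/-- `M` is unmixed: `dim R̂/p = dim M` for every associated prime `p` of the completion `M̂`. -/
def IsUnmixed (M : Type) [AddCommGroup M] [Module R M] : Prop :=
  ∀ p ∈ associatedPrimes (AdicCompletion (maximalIdeal R) R)
      (AdicCompletion (maximalIdeal R) M),
    ringKrullDim ((AdicCompletion (maximalIdeal R) R) ⧸ p) = mDim R M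

/-- `M` is generalized Cohen–Macaulay: `H^i_𝔪(M)` has finite length for `i < r = dim M`. -/
def IsGenCM (M : Type) [AddCommGroup M] [Module R M] (r : ℕ) : Prop :=
  ∀ i < r, IsFiniteLength R ↥(LC R i M)

/-- The set `Λ(M)` of first Hilbert coefficients of parameter ideals for `M`. -/
def Lambda (M : Type) [AddCommGroup M] [Module R M] (r : ℕ) : Set ℤ :=
  {a : ℤ | ∃ (Q : Ideal R) (e : ℕ → ℤ),
    IsParamIdeal R Q M r ∧ HasHilbCoeffs R Q M r e ∧ e 1 = a}

/-- A standard parameter ideal: one generated by a standard system of parameters. -/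
def IsStandardParamIdeal (Q : Ideal R) (M : Type) [AddCommGroup M] [Module R M]
    (r : ℕ) : Prop :=
  IsParamIdeal R Q M r ∧ ∃ x : Fin r → R, Q = Ideal.span (Set.range x) ∧
    IsStandardSeq R x M

/-- `M` is Buchsbaum: every parameter ideal for `M` is standard. -/
def IsBuchsbaum (M : Type) [AddCommGroup M] [Module R M] (r : ℕ) : Prop :=
  ∀ Q : Ideal R, IsParamIdeal R Q M r → IsStandardParamIdeal R Q M r

/-- `M` is a Vasconcelos module. -/
def IsVasconcelos (M : Type) [AddCommGroup M] [Module R M] : Prop :=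
  mDim R M ≤ 0 ∨ (0 < mDim R M ∧ ∃ (r : ℕ) (Q : Ideal R) (e : ℕ → ℤ),
    mDim R M = (r : ℕ∞) ∧ IsParamIdeal R Q M r ∧ HasHilbCoeffs R Q M r e ∧ e 1 = 0)

/-- A Gorenstein local ring: Noetherian, Cohen–Macaulay, with an irreducible parameter ideal. -/
def IsGorensteinLocalRing : Prop :=
  IsNoetherianRing R ∧ IsCM R R ∧ ∃ (r : ℕ) (Q : Ideal R),
    mDim R R = (r : ℕ∞) ∧ IsParamIdeal R Q R r ∧
    ∀ I J : Ideal R, Q = I ⊓ J → Q = I ∨ Q = J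

/-- `E` is an injective envelope of the residue field `R/𝔪`. -/
def IsInjEnvResidue (E : Type) [AddCommGroup E] [Module R E] : Prop :=
  Module.Injective R E ∧ ∃ ι : (R ⧸ maximalIdeal R) →ₗ[R] E, Function.Injective ι ∧
    ∀ N : Submodule R E, N ⊓ LinearMap.range ι = ⊥ → N = ⊥

end Defs

/-- A (not necessarily local) Cohen–Macaulay ring: Noetherian,
with all localizations at primes Cohen–Macaulay. -/
def IsCMRing (S : Type) [CommRing S] : Prop :=
  IsNoetherianRing S ∧ ∀ (p : Ideal S) [p.IsPrime],
    IsCM (Localization.AtPrime p) (Localization.AtPrime p)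

/-- A (not necessarily local) Gorenstein ring. -/
def IsGorensteinRing (S : Type) [CommRing S] : Prop :=
  IsNoetherianRing S ∧ ∀ (p : Ideal S) [p.IsPrime],
    IsGorensteinLocalRing (Localization.AtPrime p)

/-- `HDegRel R I E M v` : `v` is the homological degree `hdeg_I(M)` computed
with Matlis duals taken relative to `E`. -/
inductive HDegRel (R : Type) [CommRing R] [IsLocalRing R] (I : Ideal R)
    (E : Type) [AddCommGroup E] [Module R E] : ModuleCat R → ℕ → Prop where
  | base : ∀ (M : ModuleCat R) (l : ℕ), mDim R M ≤ 0 → mLength R M = (l : ℕ∞) →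
      HDegRel R I E M l
  | step : ∀ (M : ModuleCat R) (r : ℕ), mDim R M = (r : ℕ∞) → 0 < r →
      ∀ (e : ℕ → ℤ) (e0 : ℕ), HasHilbCoeffs R I M r e → e 0 = (e0 : ℤ) →
      ∀ v : ℕ → ℕ,
        (∀ j < r, HDegRel R I E (ModuleCat.of R ((LC R j M) →ₗ[R] E)) (v j)) →
      HDegRel R I E M (e0 + ∑ j ∈ Finset.range r, (r - 1).choose j * v j)

set_option linter.unusedSectionVars false

section LocalCohomologyBasics

open CategoryTheory CategoryTheory.Limits Opposite

section HomologyRel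

universe u
variable {A : Type u} [CommRing A] {c : ComplexShape ℕ}

/-- The relation that `h` is the class of the cocycle `z` in the homology of a complex of objects of
the opposite of a category of modules. -/
def HRel (K : HomologicalComplex (ModuleCat.{u} A)ᵒᵖ c) (n : ℕ)
    (z : (K.X n).unop) (h : (K.homology n).unop) : Prop :=
  ∃ w : (K.opcycles n).unop, (K.pOpcycles n).unop.hom w = z ∧ (K.homologyι n).unop.hom w = h

variable {K L : HomologicalComplex (ModuleCat.{u} A)ᵒᵖ c} {n : ℕ}

theorem HRel.add {z z' : (K.X n).unop} {h h' : (K.homology n).unop} (H : HRel K n z h)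
    (H' : HRel K n z' h') : HRel K n (z + z') (h + h') := by
  obtain ⟨w, rfl, rfl⟩ := H
  obtain ⟨w', rfl, rfl⟩ := H'
  exact ⟨w + w', by simp, by simp⟩

theorem HRel.smul (a : A) {z : (K.X n).unop} {h : (K.homology n).unop} (H : HRel K n z h) :
    HRel K n (a • z) (a • h) := by
  obtain ⟨w, rfl, rfl⟩ := H
  exact ⟨a • w, by simp, by simp⟩

theorem HRel.map (φ : K ⟶ L) {z : (L.X n).unop} {h : (L.homology n).unop} (H : HRel L n z h) :
    HRel K n ((φ.f n).unop.hom z) ((HomologicalComplex.homologyMap φ n).unop.hom h) := by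
  obtain ⟨w, rfl, rfl⟩ := H
  refine ⟨(HomologicalComplex.opcyclesMap φ n).unop.hom w, ?_, ?_⟩
  · have := HomologicalComplex.p_opcyclesMap φ n
    have := congrArg (fun f => f.unop.hom w) this
    exact this
  · have := HomologicalComplex.homologyι_naturality φ n
    have := congrArg (fun f => f.unop.hom w) this
    exact this.symm

theorem HRel.exists_rep (h : (K.homology n).unop) : ∃ z, HRel K n z h := by
  have : Epi (K.homologyι n).unop := inferInstance
  obtain ⟨w, rfl⟩ := (ModuleCat.epi_iff_surjective _).1 this h
  exact ⟨_, w, rfl, rfl⟩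

theorem HRel.d_eq_zero (j : ℕ) {z : (K.X n).unop} {h : (K.homology n).unop} (H : HRel K n z h) :
    (K.d j n).unop.hom z = 0 := by
  obtain ⟨w, rfl, rfl⟩ := H
  have := K.d_pOpcycles j n
  have := congrArg (fun f => f.unop.hom w) this
  exact this

theorem HRel.exists_class (j : ℕ) (hj : c.prev n = j) (z : (K.X n).unop)
    (hz : (K.d j n).unop.hom z = 0) : ∃ h, HRel K n z h := by
  have h0 : (ShortComplex.mk _ _ (K.d_pOpcycles j n)).Exact :=
    ShortComplex.exact_of_g_is_cokernel _ (K.opcyclesIsCokernel j n hj)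
  have h1 := h0.unop
  rw [ShortComplex.moduleCat_exact_iff] at h1
  obtain ⟨w, hw⟩ := h1 z hz
  exact ⟨_, w, hw, rfl⟩

theorem HRel.eq_zero_of_boundary (j : ℕ) (y : (K.X j).unop) {h : (K.homology n).unop}
    (H : HRel K n ((K.d n j).unop.hom y) h) : h = 0 := by
  obtain ⟨w, hw, rfl⟩ := H
  have hm : Mono (K.pOpcycles n).unop := inferInstance
  have : w = (K.fromOpcycles n j).unop.hom y := by
    apply (ModuleCat.mono_iff_injective _).1 hm
    erw [hw]
    have := K.p_fromOpcycles n j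
    have := congrArg (fun f => f.unop.hom y) this
    exact this.symm
  rw [this]
  have := K.homologyι_comp_fromOpcycles n j
  have := congrArg (fun f => f.unop.hom y) this
  exact this

theorem HRel.exists_boundary (j : ℕ) (hj : c.next n = j) {z : (K.X n).unop}
    (H : HRel K n z 0) : ∃ y, (K.d n j).unop.hom y = z := by
  obtain ⟨w, rfl, hw⟩ := H
  have h0 : (ShortComplex.mk _ _ (K.homologyι_comp_fromOpcycles n j)).Exact :=
    ShortComplex.exact_of_f_is_kernel _ (K.homologyIsKernel n j hj)
  have h1 := h0.unop
  rw [ShortComplex.moduleCat_exact_iff] at h1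
  obtain ⟨y, hy⟩ := h1 w hw
  refine ⟨y, ?_⟩
  have := K.p_fromOpcycles n j
  have := congrArg (fun f => f.unop.hom y) this
  rw [← hy]
  exact this.symm

end HomologyRel

section LCRel

variable {A : Type} [CommRing A] (J : Ideal A)

/-- The module `A / J ^ n`. -/
abbrev powQ (n : ℕ) : ModuleCat.{0} A :=
  (localCohomology.ringModIdeals (localCohomology.idealPowersDiagram J)).obj (op n)

/-- The chosen projective resolution of `A / J ^ n`. -/
noncomputable abbrev powRes (n : ℕ) : ProjectiveResolution (powQ J n) := projectiveResolution _

/-- The opposite of the complex of homomorphisms from the resolution of `A / J ^ n` to `Y`. -/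
noncomputable abbrev homCplx (n : ℕ) (Y : ModuleCat.{0} A) :
    HomologicalComplex (ModuleCat.{0} A)ᵒᵖ (ComplexShape.down ℕ) :=
  (((linearYoneda A (ModuleCat.{0} A)).obj Y).rightOp.mapHomologicalComplex _).obj
    (powRes J n).complex

/-- The canonical map from `Ext^i(A / J ^ n, Y)` to local cohomology. -/
noncomputable abbrev extToLC (i n : ℕ) (Y : ModuleCat.{0} A) :
    ((Ext A (ModuleCat.{0} A) i).obj (op (powQ J n))).obj Y ⟶ (localCohomology J i).obj Y :=
  (colimit.ι (localCohomology.diagram (localCohomology.idealPowersDiagram J) i)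
    (op (op n))).app Y

/-- The comparison between the cohomology of `homCplx` and `Ext`. -/
noncomputable abbrev homToExt (i n : ℕ) (Y : ModuleCat.{0} A) :
    unop ((homCplx J n Y).homology i) ⟶
      ((Ext A (ModuleCat.{0} A) i).obj (op (powQ J n))).obj Y :=
  ((powRes J n).isoLeftDerivedObj
    ((linearYoneda A (ModuleCat.{0} A)).obj Y).rightOp i).unop.hom

/-- The relation that `h` is the local cohomology class of the cocycle `z` on the resolution of
`A / J ^ n`. -/
def LCRel (i n : ℕ) {Y : ModuleCat.{0} A} (z : (powRes J n).complex.X i ⟶ Y)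
    (h : (localCohomology J i).obj Y) : Prop :=
  ∃ c : ((homCplx J n Y).homology i).unop, HRel (homCplx J n Y) i z c ∧
    (extToLC J i n Y).hom ((homToExt J i n Y).hom c) = h

variable {J} {i n : ℕ} {Y Y' : ModuleCat.{0} A}

theorem LCRel.add {z z' : (powRes J n).complex.X i ⟶ Y} {h h' : (localCohomology J i).obj Y}
    (H : LCRel J i n z h) (H' : LCRel J i n z' h') : LCRel J i n (z + z') (h + h') := by
  obtain ⟨c, hc, rfl⟩ := H
  obtain ⟨c', hc', rfl⟩ := H'
  exact ⟨c + c', hc.add hc', by simp⟩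

theorem LCRel.smul (a : A) {z : (powRes J n).complex.X i ⟶ Y} {h : (localCohomology J i).obj Y}
    (H : LCRel J i n z h) : LCRel J i n (a • z) (a • h) := by
  obtain ⟨c, hc, rfl⟩ := H
  exact ⟨a • c, hc.smul a, by simp⟩

theorem LCRel.d_eq_zero (j : ℕ) {z : (powRes J n).complex.X i ⟶ Y}
    {h : (localCohomology J i).obj Y}
    (H : LCRel J i n z h) : (powRes J n).complex.d j i ≫ z = 0 := by
  obtain ⟨c, hc, rfl⟩ := H
  exact hc.d_eq_zero j

theorem LCRel.exists_class (z : (powRes J n).complex.X i ⟶ Y)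
    (hz : (powRes J n).complex.d (i + 1) i ≫ z = 0) : ∃ h, LCRel J i n z h := by
  obtain ⟨c, hc⟩ := HRel.exists_class (K := homCplx J n Y) (i + 1) (by simp) z hz
  exact ⟨_, c, hc, rfl⟩

theorem LCRel.eq_zero_of_boundary (j : ℕ) (y : (powRes J n).complex.X j ⟶ Y)
    {h : (localCohomology J i).obj Y}
    (H : LCRel J i n ((powRes J n).complex.d i j ≫ y) h) : h = 0 := by
  obtain ⟨c, hc, rfl⟩ := H
  have := HRel.eq_zero_of_boundary (K := homCplx J n Y) j y hc
  rw [this]; simp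

theorem LCRel.eq_zero {h : (localCohomology J i).obj Y}
    (H : LCRel J i n (0 : (powRes J n).complex.X i ⟶ Y) h) : h = 0 :=
  LCRel.eq_zero_of_boundary 0 0 (by simpa using H)

/-- Local cohomology is computed as a colimit of `Ext` modules. -/
noncomputable def lcIsColimit (J : Ideal A) (i : ℕ) (Y : ModuleCat.{0} A) :
    IsColimit (((evaluation _ _).obj Y).mapCocone
      (colimit.cocone (localCohomology.diagram (localCohomology.idealPowersDiagram J) i))) :=
  isColimitOfPreserves _ (colimit.isColimit _)

theorem LCRel.exists_rep (h : (localCohomology J i).obj Y) :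
    ∃ (n : ℕ) (z : (powRes J n).complex.X i ⟶ Y), LCRel J i n z h := by
  obtain ⟨n, e, he⟩ := Concrete.isColimit_exists_rep _ (lcIsColimit J i Y) h
  obtain ⟨c, rfl⟩ := ((ModuleCat.epi_iff_surjective (homToExt J i n.unop.unop Y)).1
    (@IsIso.epi_of_iso _ _ _ _ _ (Iso.isIso_hom _))) e
  obtain ⟨z, hz⟩ := HRel.exists_rep c
  exact ⟨n.unop.unop, z, c, hz, he⟩

theorem LCRel.map (f : Y ⟶ Y') {z : (powRes J n).complex.X i ⟶ Y}
    {h : (localCohomology J i).obj Y}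
    (H : LCRel J i n z h) : LCRel J i n (z ≫ f) (((localCohomology J i).map f).hom h) := by
  obtain ⟨c, hc, rfl⟩ := H
  let α := NatTrans.rightOp ((linearYoneda A (ModuleCat.{0} A)).map f)
  let φ := (NatTrans.mapHomologicalComplex α (ComplexShape.down ℕ)).app (powRes J n).complex
  refine ⟨(HomologicalComplex.homologyMap φ i).unop.hom c, hc.map φ, ?_⟩
  have h1 := ProjectiveResolution.leftDerived_app_eq α (powRes J n) i
  have h2 : (NatTrans.leftDerived α i).app _ ≫
      ((powRes J n).isoLeftDerivedObj ((linearYoneda A (ModuleCat.{0} A)).obj Y).rightOp i).hom =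
      ((powRes J n).isoLeftDerivedObj ((linearYoneda A (ModuleCat.{0} A)).obj Y').rightOp i).hom ≫
       HomologicalComplex.homologyMap φ i := by
    rw [h1, Category.assoc, Category.assoc]
    erw [Iso.inv_hom_id, Category.comp_id]
    rfl
  have h3 := congrArg (fun f => f.unop.hom c) h2
  have h4 := (colimit.ι (localCohomology.diagram (localCohomology.idealPowersDiagram J) i)
    (op (op n))).naturality f
  have h5 := congrArg (fun f => f.hom ((homToExt J i n Y).hom c)) h4
  refine Eq.trans ?_ h5
  refine congrArg (extToLC J i n Y').hom ?_
  exact h3.symm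

/-- The projection `A / J ^ n' → A / J ^ n`. -/
abbrev powProj (J : Ideal A) {n n' : ℕ} (hn : n ≤ n') : powQ J n' ⟶ powQ J n :=
  (localCohomology.ringModIdeals (localCohomology.idealPowersDiagram J)).map (homOfLE hn).op

/-- A lift of the projection `A / J ^ n' → A / J ^ n` to projective resolutions. -/
noncomputable def powTrans (J : Ideal A) {n n' : ℕ} (hn : n ≤ n') :
    (powRes J n').complex ⟶ (powRes J n).complex :=
  ProjectiveResolution.lift (powProj J hn) _ _

theorem powTrans_comm {n n' : ℕ} (hn : n ≤ n') :
    (powTrans J hn).f 0 ≫ (powRes J n).π.f 0 = (powRes J n').π.f 0 ≫ powProj J hn := by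
  have := ProjectiveResolution.lift_commutes (powProj J hn) (powRes J n') (powRes J n)
  have := HomologicalComplex.congr_hom this 0
  rw [HomologicalComplex.comp_f, HomologicalComplex.comp_f, ChainComplex.single₀_map_f_zero] at this
  exact this

theorem homToExt_trans {n' : ℕ} (hn : n ≤ n') (c : ((homCplx J n Y).homology i).unop) :
    (homToExt J i n' Y).hom ((HomologicalComplex.homologyMap
      ((((linearYoneda A (ModuleCat.{0} A)).obj Y).rightOp.mapHomologicalComplex _).map
        (powTrans J hn)) i).unop.hom c) =
    (((localCohomology.diagram (localCohomology.idealPowersDiagram J) i).map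
      (homOfLE hn).op.op).app Y).hom ((homToExt J i n Y).hom c) := by
  have h := ProjectiveResolution.isoLeftDerivedObj_hom_naturality (powProj J hn) (powRes J n')
    (powRes J n) (powTrans J hn) (powTrans_comm hn)
    ((linearYoneda A (ModuleCat.{0} A)).obj Y).rightOp i
  exact (congrArg (fun f => f.unop.hom c) h).symm

theorem LCRel.trans {n' : ℕ} (hn : n ≤ n') {z : (powRes J n).complex.X i ⟶ Y}
    {h : (localCohomology J i).obj Y}
    (H : LCRel J i n z h) : LCRel J i n' ((powTrans J hn).f i ≫ z) h := by
  obtain ⟨c, hc, rfl⟩ := H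
  refine ⟨_, hc.map ((((linearYoneda A (ModuleCat.{0} A)).obj
    Y).rightOp.mapHomologicalComplex _).map (powTrans J hn)), ?_⟩
  rw [homToExt_trans]
  have := colimit.w (localCohomology.diagram (localCohomology.idealPowersDiagram J) i)
    (homOfLE hn).op.op
  exact congrArg (fun f => (f.app Y).hom ((homToExt J i n Y).hom c)) this

theorem LCRel.exists_boundary {z : (powRes J n).complex.X i ⟶ Y}
    (H : LCRel J i n z 0) : ∃ (n' : ℕ) (hn : n ≤ n') (j : ℕ)
      (y : (powRes J n').complex.X j ⟶ Y), (ComplexShape.down ℕ).next i = j ∧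
      (powTrans J hn).f i ≫ z = (powRes J n').complex.d i j ≫ y := by
  obtain ⟨c, hc, h0⟩ := H
  obtain ⟨n', f, g, hfg⟩ := Concrete.isColimit_exists_of_rep_eq _ (lcIsColimit J i Y)
    (i := op (op n)) (j := op (op n)) ((homToExt J i n Y).hom c) 0 (by
      erw [h0, map_zero]; rfl)
  obtain ⟨n', rfl⟩ : ∃ m : ℕ, n' = op (op m) := ⟨n'.unop.unop, rfl⟩
  have hn : n ≤ n' := leOfHom f.unop.unop
  have hf : f = (homOfLE hn).op.op := rfl
  have h1 := homToExt_trans hn c (Y := Y)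
  have h2 : (homToExt J i n' Y).hom ((HomologicalComplex.homologyMap
      ((((linearYoneda A (ModuleCat.{0} A)).obj Y).rightOp.mapHomologicalComplex _).map
        (powTrans J hn)) i).unop.hom c) = 0 := by
    rw [h1]
    refine Eq.trans hfg ?_
    exact map_zero _
  have h3 := (ModuleCat.mono_iff_injective (homToExt J i n' Y)).1
    (@IsIso.mono_of_iso _ _ _ _ _ (Iso.isIso_hom _)) (h2.trans (map_zero _).symm)
  have h4 := hc.map ((((linearYoneda A (ModuleCat.{0} A)).obj
    Y).rightOp.mapHomologicalComplex _).map (powTrans J hn))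
  erw [h3] at h4
  obtain ⟨y, hy⟩ := h4.exists_boundary _ rfl
  exact ⟨n', hn, _, y, rfl, hy.symm⟩

end LCRel

/-- A total, additive, homogeneous and single-valued relation is the graph of a linear map. -/
theorem exists_linearMap_of_rel {A X Y : Type*} [CommRing A] [AddCommGroup X] [AddCommGroup Y]
    [Module A X] [Module A Y] (D : X → Y → Prop) (total : ∀ x, ∃ y, D x y)
    (hadd : ∀ {x x' y y'}, D x y → D x' y' → D (x + x') (y + y'))
    (smul : ∀ (a : A) {x y}, D x y → D (a • x) (a • y))
    (zero : ∀ {y}, D 0 y → y = 0) : ∃ f : X →ₗ[A] Y, ∀ x y, D x y ↔ f x = y := by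
  have uniq : ∀ {x y y'}, D x y → D x y' → y = y' := by
    intro x y y' h h'
    have := hadd h (smul (-1) h')
    simp only [neg_smul, one_smul, add_neg_cancel] at this
    exact add_neg_eq_zero.1 (zero this)
  choose f hf using total
  exact ⟨{ toFun := f
           map_add' := fun x x' => uniq (hf _) (hadd (hf _) (hf _))
           map_smul' := fun a x => uniq (hf _) (smul a (hf _)) },
    fun x y => ⟨fun h => uniq (hf x) h, by rintro rfl; exact hf x⟩⟩

section LCFun

variable {A : Type} [CommRing A] (J : Ideal A)

/-- The `i`-th local cohomology of `N` with support in `J`. -/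
abbrev LH (i : ℕ) (N : Type) [AddCommGroup N] [Module A N] : Type :=
  (localCohomology J i).obj (ModuleCat.of A N)

variable {N N' N'' : Type} [AddCommGroup N] [Module A N] [AddCommGroup N'] [Module A N']
  [AddCommGroup N''] [Module A N'']

/-- The map induced on local cohomology by a linear map. -/
noncomputable def lhMap (i : ℕ) (f : N →ₗ[A] N') : LH J i N →ₗ[A] LH J i N' :=
  ((localCohomology J i).map (ModuleCat.ofHom f)).hom

theorem lhMap_id (i : ℕ) : lhMap J i (LinearMap.id : N →ₗ[A] N) = LinearMap.id := by
  unfold lhMap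
  rw [ModuleCat.ofHom_id, CategoryTheory.Functor.map_id]
  rfl

theorem lhMap_comp (i : ℕ) (f : N →ₗ[A] N') (g : N' →ₗ[A] N'') :
    lhMap J i (g ∘ₗ f) = lhMap J i g ∘ₗ lhMap J i f := by
  unfold lhMap
  rw [ModuleCat.ofHom_comp, CategoryTheory.Functor.map_comp]
  rfl

/-- A linear equivalence induces an equivalence on local cohomology. -/
noncomputable def lhEquiv (i : ℕ) (e : N ≃ₗ[A] N') : LH J i N ≃ₗ[A] LH J i N' :=
  LinearEquiv.ofLinearMap (lhMap J i e.toLinearMap) (lhMap J i e.symm.toLinearMap)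
    (by rw [← lhMap_comp]; simp [lhMap_id]) (by rw [← lhMap_comp]; simp [lhMap_id])

variable {J}

section
variable {i n : ℕ} {Y Y' Y'' : ModuleCat.{0} A}

theorem LCRel.sub {z z' : (powRes J n).complex.X i ⟶ Y} {h h' : (localCohomology J i).obj Y}
    (H : LCRel J i n z h) (H' : LCRel J i n z' h') : LCRel J i n (z - z') (h - h') := by
  have := H.add (H'.smul (-1))
  simpa [sub_eq_add_neg] using this

theorem LCRel.unique {z : (powRes J n).complex.X i ⟶ Y} {h h' : (localCohomology J i).obj Y}
    (H : LCRel J i n z h) (H' : LCRel J i n z h') : h = h' := by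
  have := H.sub H'
  rw [sub_self] at this
  exact sub_eq_zero.1 this.eq_zero

theorem LCRel.boundary (j : ℕ) (y : (powRes J n).complex.X j ⟶ Y) :
    LCRel J i n ((powRes J n).complex.d i j ≫ y) 0 := by
  obtain ⟨h, hh⟩ := LCRel.exists_class ((powRes J n).complex.d i j ≫ y) (by simp)
  have := hh.eq_zero_of_boundary
  rwa [this] at hh

theorem LCRel.exists_boundary_succ {z : (powRes J n).complex.X (i + 1) ⟶ Y}
    (H : LCRel J (i + 1) n z 0) : ∃ (n' : ℕ) (hn : n ≤ n')
      (y : (powRes J n').complex.X i ⟶ Y),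
      (powTrans J hn).f (i + 1) ≫ z = (powRes J n').complex.d (i + 1) i ≫ y := by
  obtain ⟨n', hn, j, y, hj, hy⟩ := H.exists_boundary
  rw [ChainComplex.next_nat_succ] at hj
  subst hj
  exact ⟨n', hn, y, hy⟩

theorem LCRel.exists_zero {z : (powRes J n).complex.X 0 ⟶ Y}
    (H : LCRel J 0 n z 0) : ∃ (n' : ℕ) (hn : n ≤ n'), (powTrans J hn).f 0 ≫ z = 0 := by
  obtain ⟨n', hn, j, y, hj, hy⟩ := H.exists_boundary
  rw [ChainComplex.next_nat_zero] at hj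
  subst hj
  refine ⟨n', hn, ?_⟩
  rw [hy, HomologicalComplex.shape _ _ _ (by simp), zero_comp]

instance (n i : ℕ) : Projective ((powRes J n).complex.X i) := inferInstance

end

theorem exists_lift_of_comp_eq_zero {X : ModuleCat.{0} A} {f : N' →ₗ[A] N} {g : N →ₗ[A] N''}
    (hf : Function.Injective f) (hfg : Function.Exact f g) (z : X ⟶ ModuleCat.of A N)
    (hz : z ≫ ModuleCat.ofHom g = 0) : ∃ z', z' ≫ ModuleCat.ofHom f = z := by
  have hr : ∀ x, z.hom x ∈ LinearMap.range f := fun x => (hfg _).1 (congrArg (fun f => f.hom x) hz)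
  refine ⟨ModuleCat.ofHom ((LinearEquiv.ofInjective f hf).symm.toLinearMap ∘ₗ
    z.hom.codRestrict (LinearMap.range f) hr), ?_⟩
  ext x
  simp only [ModuleCat.hom_comp, ModuleCat.hom_ofHom, LinearMap.comp_apply]
  exact congrArg Subtype.val
    ((LinearEquiv.ofInjective f hf).apply_symm_apply (z.hom.codRestrict (LinearMap.range f) hr x))

theorem lhMap_rel {i n : ℕ} (f : N →ₗ[A] N') {z : (powRes J n).complex.X i ⟶ ModuleCat.of A N}
    {h : LH J i N} (H : LCRel J i n z h) :
    LCRel J i n (z ≫ ModuleCat.ofHom f) (lhMap J i f h) :=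
  H.map _

theorem lhMap_smul (i : ℕ) (a : A) (f : N →ₗ[A] N') : lhMap J i (a • f) = a • lhMap J i f := by
  ext h
  obtain ⟨n, z, hz⟩ := LCRel.exists_rep h
  have h1 := lhMap_rel (a • f) hz
  have h2 := (lhMap_rel f hz).smul a
  have e : z ≫ ModuleCat.ofHom (a • f) = a • (z ≫ ModuleCat.ofHom f) := by
    ext x
    rfl
  rw [e] at h1
  exact h1.unique h2

section LES

variable {f : N' →ₗ[A] N} {g : N →ₗ[A] N''} (hf : Function.Injective f)
  (hg : Function.Surjective g) (hfg : Function.Exact f g)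

include hf hg hfg

theorem lhMap_exact (i : ℕ) : Function.Exact (lhMap J i f) (lhMap J i g) := by
  have hepi : Epi (ModuleCat.ofHom g) := (ModuleCat.epi_iff_surjective _).2 hg
  have hmono : Mono (ModuleCat.ofHom f) := (ModuleCat.mono_iff_injective _).2 hf
  have hfg0 : ModuleCat.ofHom f ≫ ModuleCat.ofHom g = 0 := by
    ext x; exact hfg.apply_apply_eq_zero x
  intro h
  constructor
  · intro h0
    obtain ⟨n, z, hz⟩ := LCRel.exists_rep h
    have h1 := lhMap_rel g hz
    rw [h0] at h1
    obtain ⟨n', hn, j, y, -, hy⟩ := h1.exists_boundary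
    let y' := Projective.factorThru y (ModuleCat.ofHom g)
    have hy' : y' ≫ ModuleCat.ofHom g = y := Projective.factorThru_comp _ _
    have h2 := (hz.trans hn).sub (LCRel.boundary j y')
    obtain ⟨w, hw⟩ := exists_lift_of_comp_eq_zero hf hfg
      ((powTrans J hn).f i ≫ z - (powRes J n').complex.d i j ≫ y') (by
        rw [Preadditive.sub_comp, Category.assoc, Category.assoc, hy', hy, sub_self])
    obtain ⟨h', hh'⟩ := LCRel.exists_class w (by
      rw [← cancel_mono (ModuleCat.ofHom f), Category.assoc, hw, h2.d_eq_zero, zero_comp])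
    refine ⟨h', ?_⟩
    have h3 := lhMap_rel f hh'
    rw [hw] at h3
    simpa using h3.unique h2
  · rintro ⟨h', rfl⟩
    obtain ⟨n, z, hz⟩ := LCRel.exists_rep h'
    have := lhMap_rel g (lhMap_rel f hz)
    rw [Category.assoc, hfg0, comp_zero] at this
    exact this.eq_zero

theorem exists_connecting (i : ℕ) : ∃ δ : LH J i N'' →ₗ[A] LH J (i + 1) N',
    Function.Exact (lhMap J i g) δ ∧ Function.Exact δ (lhMap J (i + 1) f) := by
  have hepi : Epi (ModuleCat.ofHom g) := (ModuleCat.epi_iff_surjective _).2 hg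
  have hmono : Mono (ModuleCat.ofHom f) := (ModuleCat.mono_iff_injective _).2 hf
  have hfg0 : ModuleCat.ofHom f ≫ ModuleCat.ofHom g = 0 := by
    ext x; exact hfg.apply_apply_eq_zero x
  let Dn : ℕ → LH J i N'' → LH J (i + 1) N' → Prop := fun n h'' h' =>
    ∃ (z : (powRes J n).complex.X i ⟶ ModuleCat.of A N)
      (z' : (powRes J n).complex.X (i + 1) ⟶ ModuleCat.of A N'),
      (powRes J n).complex.d (i + 1) i ≫ z = z' ≫ ModuleCat.ofHom f ∧
      LCRel J i n (z ≫ ModuleCat.ofHom g) h'' ∧ LCRel J (i + 1) n z' h'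
  have Dtrans : ∀ {n n' : ℕ} (hn : n ≤ n') {h'' h'}, Dn n h'' h' → Dn n' h'' h' := by
    rintro n n' hn h'' h' ⟨z, z', h1, h2, h3⟩
    refine ⟨(powTrans J hn).f i ≫ z, (powTrans J hn).f (i + 1) ≫ z', ?_, ?_, h3.trans hn⟩
    · rw [Category.assoc, ← h1, HomologicalComplex.Hom.comm_assoc]
    · rw [Category.assoc]; exact h2.trans hn
  obtain ⟨δ, hδ⟩ := exists_linearMap_of_rel (A := A) (fun h'' h' => ∃ n, Dn n h'' h')
    (by
      intro h''
      obtain ⟨n, u, hu⟩ := LCRel.exists_rep h''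
      let z := Projective.factorThru u (ModuleCat.ofHom g)
      have hz : z ≫ ModuleCat.ofHom g = u := Projective.factorThru_comp _ _
      obtain ⟨z', hz'⟩ := exists_lift_of_comp_eq_zero hf hfg
        ((powRes J n).complex.d (i + 1) i ≫ z) (by rw [Category.assoc, hz, hu.d_eq_zero])
      obtain ⟨h', hh'⟩ := LCRel.exists_class z' (by
        rw [← cancel_mono (ModuleCat.ofHom f), Category.assoc, hz']; simp)
      exact ⟨h', n, z, z', hz'.symm, by rwa [hz], hh'⟩)
    (by
      rintro x x' y y' ⟨n, H⟩ ⟨n', H'⟩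
      obtain ⟨z, z', h1, h2, h3⟩ := Dtrans (le_max_left n n') H
      obtain ⟨w, w', k1, k2, k3⟩ := Dtrans (le_max_right n n') H'
      refine ⟨_, z + w, z' + w', ?_, ?_, h3.add k3⟩
      · rw [Preadditive.comp_add, h1, k1, Preadditive.add_comp]
      · rw [Preadditive.add_comp]; exact h2.add k2)
    (by
      rintro a x y ⟨n, z, z', h1, h2, h3⟩
      refine ⟨n, a • z, a • z', ?_, ?_, h3.smul a⟩
      · rw [Linear.comp_smul, h1, Linear.smul_comp]
      · rw [Linear.smul_comp]; exact h2.smul a)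
    (by
      rintro h' ⟨n, z, z', h1, h2, h3⟩
      obtain ⟨n', hn, j, y, -, hy⟩ := h2.exists_boundary
      let y' := Projective.factorThru y (ModuleCat.ofHom g)
      have hy' : y' ≫ ModuleCat.ofHom g = y := Projective.factorThru_comp _ _
      obtain ⟨w, hw⟩ := exists_lift_of_comp_eq_zero hf hfg
        ((powTrans J hn).f i ≫ z - (powRes J n').complex.d i j ≫ y') (by
          rw [Preadditive.sub_comp, Category.assoc, Category.assoc, hy', hy, sub_self])
      refine LCRel.eq_zero_of_boundary i w (n := n') ?_
      have : (powRes J n').complex.d (i + 1) i ≫ w = (powTrans J hn).f (i + 1) ≫ z' := by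
        rw [← cancel_mono (ModuleCat.ofHom f), Category.assoc, hw, Category.assoc, ← h1]
        simp
      rw [this]
      exact h3.trans hn)
  refine ⟨δ, fun h'' => ⟨fun h0 => ?_, ?_⟩, fun h' => ⟨fun h0 => ?_, ?_⟩⟩
  · obtain ⟨n, z, z', h1, h2, h3⟩ := (hδ _ _).2 h0
    obtain ⟨n', hn, y', hy'⟩ := h3.exists_boundary_succ
    obtain ⟨h, hh⟩ := LCRel.exists_class
      ((powTrans J hn).f i ≫ z - y' ≫ ModuleCat.ofHom f) (by
        rw [Preadditive.comp_sub, ← Category.assoc _ y', ← hy', Category.assoc, ← h1]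
        simp)
    refine ⟨h, ?_⟩
    have h4 := lhMap_rel g hh
    rw [Preadditive.sub_comp, Category.assoc, Category.assoc, hfg0, comp_zero, sub_zero] at h4
    exact h4.unique (h2.trans hn)
  · rintro ⟨h, rfl⟩
    obtain ⟨n, z, hz⟩ := LCRel.exists_rep h
    refine (hδ _ _).1 ⟨n, z, 0, ?_, lhMap_rel g hz, ?_⟩
    · rw [hz.d_eq_zero, zero_comp]
    · simpa using LCRel.boundary (J := J) (n := n) (i := i + 1) 0
        (0 : _ ⟶ ModuleCat.of A N')
  · obtain ⟨n, z', hz'⟩ := LCRel.exists_rep h'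
    have h1 := lhMap_rel f hz'
    rw [h0] at h1
    obtain ⟨n', hn, y, hy⟩ := h1.exists_boundary_succ
    obtain ⟨h'', hh⟩ := LCRel.exists_class (y ≫ ModuleCat.ofHom g) (by
      rw [← Category.assoc, ← hy, Category.assoc, Category.assoc, hfg0, comp_zero, comp_zero])
    exact ⟨h'', (hδ _ _).1 ⟨n', y, (powTrans J hn).f (i + 1) ≫ z', by rw [← hy, Category.assoc],
      hh, hz'.trans hn⟩⟩
  · rintro ⟨h'', hh⟩
    obtain ⟨n, z, z', h1, h2, h3⟩ := (hδ _ _).2 hh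
    have := lhMap_rel f h3
    rw [← h1] at this
    exact this.eq_zero_of_boundary

end LES

end LCFun

section LCTorsion

variable {A : Type} [CommRing A] {J : Ideal A}

variable (J) in
/-- The augmentation of the resolution of `A / J ^ n`. -/
noncomputable def powPi (n : ℕ) : (powRes J n).complex.X 0 ⟶ powQ J n := (powRes J n).π.f 0

instance (n : ℕ) : Epi (powPi J n) := inferInstanceAs (Epi ((powRes J n).π.f 0))

theorem powTrans_powPi {n n' : ℕ} (hn : n ≤ n') :
    (powTrans J hn).f 0 ≫ powPi J n = powPi J n' ≫ powProj J hn := powTrans_comm hn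

theorem d_powPi (n : ℕ) : (powRes J n).complex.d 1 0 ≫ powPi J n = 0 :=
  (powRes J n).complex_d_comp_π_f_zero

theorem exists_powPi_comp {n : ℕ} {Y : ModuleCat.{0} A} (z : (powRes J n).complex.X 0 ⟶ Y)
    (hz : (powRes J n).complex.d 1 0 ≫ z = 0) : ∃ t : powQ J n ⟶ Y, powPi J n ≫ t = z := by
  have e := (powRes J n).exact₀
  have : Epi ((powRes J n).π.f 0) := inferInstance
  exact ⟨e.desc z hz, e.g_desc z hz⟩

variable (J) in
/-- The class of `1` in `A / J ^ n`. -/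
def powOne (n : ℕ) : powQ J n := Ideal.Quotient.mk (J ^ n) 1

theorem exists_smul_powOne {n : ℕ} (x : powQ J n) : ∃ b : A, x = b • powOne J n := by
  obtain ⟨b, rfl⟩ := Ideal.Quotient.mk_surjective x
  refine ⟨b, ?_⟩
  change Ideal.Quotient.mk (J ^ n) b = Ideal.Quotient.mk (J ^ n) (b * 1)
  rw [mul_one]

theorem smul_powOne {n : ℕ} {a : A} (ha : a ∈ J ^ n) : a • powOne J n = 0 := by
  change Ideal.Quotient.mk (J ^ n) (a * 1) = 0
  rw [mul_one]
  exact Ideal.Quotient.eq_zero_iff_mem.2 ha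

theorem powQ_smul_eq_zero {n : ℕ} {a : A} (ha : a ∈ J ^ n) : a • 𝟙 (powQ J n) = 0 := by
  ext x
  obtain ⟨b, rfl⟩ := Ideal.Quotient.mk_surjective x
  change Ideal.Quotient.mk (J ^ n) (a * b) = 0
  exact Ideal.Quotient.eq_zero_iff_mem.2 (Ideal.mul_mem_right _ _ ha)

theorem LCRel.smul_eq_zero {i n : ℕ} {Y : ModuleCat.{0} A} {a : A} (ha : a ∈ J ^ n)
    {z : (powRes J n).complex.X i ⟶ Y} {h : (localCohomology J i).obj Y}
    (H : LCRel J i n z h) : a • h = 0 := by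
  let P := powRes J n
  have hom : Homotopy (a • 𝟙 P.complex) 0 :=
    ProjectiveResolution.liftHomotopy (0 : powQ J n ⟶ powQ J n) (P := P) (Q := P)
    (a • 𝟙 P.complex) 0 (by
      have h0 : a • powPi J n = 0 := by
        rw [← Category.comp_id (powPi J n), ← Linear.comp_smul, powQ_smul_eq_zero ha, comp_zero]
      rw [Functor.map_zero, comp_zero, Linear.smul_comp, Category.id_comp]
      ext : 1
      exact h0) (by simp)
  have h1 := hom.comm i
  have h2 := H.smul a
  have h3 : a • z = (a • 𝟙 P.complex).f i ≫ z := by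
    rw [HomologicalComplex.smul_f_apply, HomologicalComplex.id_f, Linear.smul_comp,
      Category.id_comp]
  rw [h3, h1] at h2
  rw [HomologicalComplex.zero_f, add_zero, Preadditive.add_comp] at h2
  have h4 : prevD i hom.hom ≫ z = 0 := by
    unfold prevD
    simp only [AddMonoidHom.mk'_apply, Category.assoc]
    rw [H.d_eq_zero, comp_zero]
  rw [h4, add_zero] at h2
  unfold dNext at h2
  simp only [AddMonoidHom.mk'_apply, Category.assoc] at h2
  exact h2.eq_zero_of_boundary

/-- Every local cohomology class is killed by a power of the ideal. -/
theorem lh_torsion {i : ℕ} {N : Type} [AddCommGroup N] [Module A N] (h : LH J i N) :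
    ∃ n, ∀ a ∈ J ^ n, a • h = 0 := by
  obtain ⟨n, z, hz⟩ := LCRel.exists_rep h
  exact ⟨n, fun a ha => hz.smul_eq_zero ha⟩

theorem lh_injective_eq_zero {i : ℕ} {N : Type} [AddCommGroup N] [Module A N]
    (hN : Module.Injective A N) (h : LH J (i + 1) N) : h = 0 := by
  obtain ⟨n, z, hz⟩ := LCRel.exists_rep h
  have : Injective (ModuleCat.of A N) := Module.injective_object_of_injective_module A N
  have e := (powRes J n).exact_succ i
  obtain ⟨y, hy⟩ : ∃ y : (powRes J n).complex.X i ⟶ ModuleCat.of A N,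
      (powRes J n).complex.d (i + 1) i ≫ y = z :=
    ⟨e.descToInjective z (hz.d_eq_zero _), e.comp_descToInjective z (hz.d_eq_zero _)⟩
  rw [← hy] at hz
  exact hz.eq_zero_of_boundary

variable (J) in
/-- The `J`-power torsion submodule. -/
def ptors (N : Type) [AddCommGroup N] [Module A N] : Submodule A N where
  carrier := {y | ∃ n, ∀ a ∈ J ^ n, a • y = 0}
  zero_mem' := ⟨0, by simp⟩
  add_mem' := by
    rintro x y ⟨n, hn⟩ ⟨m, hm⟩
    refine ⟨max n m, fun a ha => ?_⟩
    rw [smul_add, hn a (Ideal.pow_le_pow_right (le_max_left _ _) ha),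
      hm a (Ideal.pow_le_pow_right (le_max_right _ _) ha), add_zero]
  smul_mem' := by
    rintro b x ⟨n, hn⟩
    exact ⟨n, fun a ha => by rw [smul_comm, hn a ha, smul_zero]⟩

theorem mem_ptors {N : Type} [AddCommGroup N] [Module A N] {y : N} :
    y ∈ ptors J N ↔ ∃ n, ∀ a ∈ J ^ n, a • y = 0 := Iff.rfl

variable (J) in
/-- The zeroth local cohomology is the torsion submodule. -/
theorem exists_theta : ∃ θ : ∀ (N : Type) [AddCommGroup N] [Module A N], LH J 0 N →ₗ[A] N,
    (∀ (N : Type) [AddCommGroup N] [Module A N], Function.Injective (θ N) ∧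
      LinearMap.range (θ N) = ptors J N) ∧
    ∀ (N N' : Type) [AddCommGroup N] [Module A N] [AddCommGroup N'] [Module A N']
      (f : N →ₗ[A] N') (h : LH J 0 N), θ N' (lhMap J 0 f h) = f (θ N h) := by
  let D : ∀ (N : Type) [AddCommGroup N] [Module A N], ℕ → LH J 0 N → N → Prop :=
    fun N _ _ n h y => ∃ (t : powQ J n ⟶ ModuleCat.of A N),
      LCRel J 0 n (powPi J n ≫ t) h ∧ t.hom (powOne J n) = y
  have tr : ∀ {N : Type} [AddCommGroup N] [Module A N] {n n' : ℕ} (hn : n ≤ n') {h y},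
      D N n h y → D N n' h y := by
    rintro N _ _ n n' hn h y ⟨t, h1, h2⟩
    refine ⟨powProj J hn ≫ t, ?_, ?_⟩
    · rw [← Category.assoc, ← powTrans_powPi, Category.assoc]
      exact h1.trans hn
    · rw [← h2]
      rfl
  have inj : ∀ {N : Type} [AddCommGroup N] [Module A N] {n : ℕ} {h y},
      D N n h y → y = 0 → h = 0 := by
    rintro N _ _ n h y ⟨t, h1, h2⟩ rfl
    have : t = 0 := by
      ext x
      obtain ⟨b, rfl⟩ := exists_smul_powOne x
      rw [map_smul, h2, smul_zero]
      rfl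
    rw [this, comp_zero] at h1
    exact h1.eq_zero
  have key : ∀ (N : Type) [AddCommGroup N] [Module A N], ∃ θ : LH J 0 N →ₗ[A] N,
      ∀ h y, (∃ n, D N n h y) ↔ θ h = y := by
    intro N _ _
    apply exists_linearMap_of_rel
    · intro h
      obtain ⟨n, z, hz⟩ := LCRel.exists_rep h
      obtain ⟨t, ht⟩ := exists_powPi_comp z (hz.d_eq_zero 1)
      exact ⟨_, n, t, by rwa [ht], rfl⟩
    · rintro x x' y y' ⟨n, H⟩ ⟨n', H'⟩
      obtain ⟨t, h1, h2⟩ := tr (le_max_left n n') H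
      obtain ⟨w, k1, k2⟩ := tr (le_max_right n n') H'
      refine ⟨_, t + w, ?_, ?_⟩
      · rw [Preadditive.comp_add]; exact h1.add k1
      · rw [← h2, ← k2]; rfl
    · rintro a x y ⟨n, t, h1, h2⟩
      refine ⟨n, a • t, ?_, ?_⟩
      · rw [Linear.comp_smul]; exact h1.smul a
      · rw [← h2]; rfl
    · rintro y ⟨n, t, h1, h2⟩
      obtain ⟨n', hn, h3⟩ := h1.exists_zero
      rw [← Category.assoc, powTrans_powPi, Category.assoc] at h3
      have h4 : powProj J hn ≫ t = 0 := by
        rw [← cancel_epi (powPi J n'), comp_zero]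
        exact h3
      rw [← h2]
      exact congrArg (fun f => f.hom (powOne J n')) h4
  choose θ hθ using key
  refine ⟨θ, fun N _ _ => ⟨?_, ?_⟩, ?_⟩
  · rw [injective_iff_map_eq_zero]
    intro h h0
    obtain ⟨n, hn⟩ := (hθ N _ _).2 h0
    exact inj hn rfl
  · ext y
    constructor
    · rintro ⟨h, rfl⟩
      obtain ⟨n, t, h1, h2⟩ := (hθ N h _).2 rfl
      refine ⟨n, fun a ha => ?_⟩
      rw [← h2, ← map_smul]
      rw [smul_powOne ha, map_zero]
    · rintro ⟨n, hn⟩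
      let t : powQ J n ⟶ ModuleCat.of A N := ModuleCat.ofHom
        (Submodule.liftQ (J ^ n) (LinearMap.toSpanSingleton A N y) (fun a ha => hn a ha))
      obtain ⟨h, hh⟩ := LCRel.exists_class (powPi J n ≫ t) (by
        rw [← Category.assoc, d_powPi, zero_comp])
      refine ⟨h, (hθ N h y).1 ⟨n, t, hh, ?_⟩⟩
      change (1 : A) • y = y
      rw [one_smul]
  · intro N N' _ _ _ _ f h
    obtain ⟨n, t, h1, h2⟩ := (hθ N h _).2 rfl
    refine (hθ N' _ _).1 ⟨n, t ≫ ModuleCat.ofHom f, ?_, ?_⟩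
    · rw [← Category.assoc]
      exact lhMap_rel f h1
    · rw [← h2]
      rfl

end LCTorsion

section LCNoeth

open Pointwise

variable {A : Type} [CommRing A] {J : Ideal A}

theorem lhMap_smul_id {N : Type} [AddCommGroup N] [Module A N] (i : ℕ) (a : A) (h : LH J i N) :
    lhMap J i (a • LinearMap.id : N →ₗ[A] N) h = a • h := by
  rw [lhMap_smul, lhMap_id]; rfl

theorem exists_pow_smul_eq_zero_of_fg {N : Type} [AddCommGroup N] [Module A N] {W : Submodule A N}
    (hW : W.FG) (h : W ≤ ptors J N) : ∃ k, ∀ a ∈ J ^ k, ∀ y ∈ W, a • y = 0 := by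
  induction W, hW using Submodule.fg_induction with
  | singleton y =>
    obtain ⟨k, hk⟩ := h (Submodule.mem_span_singleton_self y)
    refine ⟨k, fun a ha z hz => ?_⟩
    obtain ⟨b, rfl⟩ := Submodule.mem_span_singleton.1 hz
    rw [smul_comm, hk a ha, smul_zero]
  | sup W₁ W₂ _ _ h₁ h₂ =>
    obtain ⟨k, hk⟩ := h₁ (le_sup_left.trans h)
    obtain ⟨l, hl⟩ := h₂ (le_sup_right.trans h)
    refine ⟨max k l, fun a ha z hz => ?_⟩
    obtain ⟨y, hy, y', hy', rfl⟩ := Submodule.mem_sup.1 hz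
    rw [smul_add, hk a (Ideal.pow_le_pow_right (le_max_left _ _) ha) y hy,
      hl a (Ideal.pow_le_pow_right (le_max_right _ _) ha) y' hy', add_zero]

variable [IsNoetherianRing A]

theorem ptors_injective (E : Type) [AddCommGroup E] [Module A E] (hE : Module.Injective A E) :
    Module.Injective A (ptors J E) := by
  apply Module.Baer.injective
  intro I g
  let g0 : I →ₗ[A] E := (ptors J E).subtype ∘ₗ g
  obtain ⟨k, hk⟩ := exists_pow_smul_eq_zero_of_fg (J := J) (W := LinearMap.range g0)
    (by
      rw [LinearMap.range_eq_map]
      exact (IsNoetherian.noetherian (⊤ : Submodule A I)).map g0) (by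
    rintro _ ⟨x, rfl⟩
    exact (g x).2)
  obtain ⟨k0, hk0⟩ := Ideal.exists_pow_inf_eq_pow_smul J (I : Submodule A A)
  let n := k0 + k
  let φ : I →ₗ[A] A ⧸ J ^ n := (Submodule.mkQ (J ^ n)) ∘ₗ (Submodule.subtype I)
  have hker : LinearMap.ker φ ≤ LinearMap.ker g0 := by
    intro x hx
    have h1 : (x : A) ∈ J ^ n := (Submodule.Quotient.mk_eq_zero _).1 hx
    have h2 : (x : A) ∈ J ^ n • (⊤ : Submodule A A) ⊓ I := ⟨by simpa using h1, x.2⟩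
    rw [hk0 n (by omega)] at h2
    have h3 : (x : A) ∈ J ^ k • I := by
      rw [show n - k0 = k by omega] at h2
      exact Submodule.smul_mono le_rfl inf_le_right h2
    have h4 : x ∈ J ^ k • (⊤ : Submodule A I) := by
      have : J ^ k • I = (J ^ k • (⊤ : Submodule A I)).map (Submodule.subtype I) := by
        rw [Submodule.map_smul'']; simp
      rw [this] at h3
      obtain ⟨y, hy, hxy⟩ := h3
      rwa [← Subtype.ext (a1 := y) (a2 := x) hxy]
    refine Submodule.smul_induction_on (p := fun x => x ∈ LinearMap.ker g0) h4 ?_ ?_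
    · intro a ha y _
      rw [LinearMap.mem_ker, map_smul]
      exact hk a ha _ ⟨y, rfl⟩
    · intro y z hy hz
      exact add_mem hy hz
  obtain ⟨h, hh⟩ := hE.out ((LinearMap.range φ).subtype) (Subtype.val_injective)
    ((LinearMap.ker φ).liftQ g0 hker ∘ₗ φ.quotKerEquivRange.symm.toLinearMap)
  have hh' : ∀ x : I, h (φ x) = g0 x := by
    intro x
    have := hh ⟨φ x, x, rfl⟩
    simp only [Submodule.subtype_apply] at this
    rw [this]
    have e : φ.quotKerEquivRange (Submodule.Quotient.mk x) = ⟨φ x, x, rfl⟩ := rfl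
    rw [← e]
    simp
  refine ⟨LinearMap.codRestrict (ptors J E) (h ∘ₗ Submodule.mkQ (J ^ n)) (fun a => ?_), ?_⟩
  · refine ⟨n, fun b hb => ?_⟩
    rw [← map_smul]
    have : b • a ∈ J ^ n := Ideal.mul_mem_right _ _ hb
    simp only [LinearMap.comp_apply]
    rw [Submodule.mkQ_apply, (Submodule.Quotient.mk_eq_zero _).2 this, map_zero]
  · intro x hx
    apply Subtype.ext
    exact hh' ⟨x, hx⟩

/-- Higher local cohomology of a torsion module vanishes. -/
theorem lh_eq_zero_of_torsion (i : ℕ) : ∀ {W : Type} [AddCommGroup W] [Module A W]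
    (_ : ∀ y : W, y ∈ ptors J W) (h : LH J (i + 1) W), h = 0 := by
  obtain ⟨θ, hθ, hnat⟩ := exists_theta J
  induction i with
  | zero =>
    intro W _ _ hW h
    let E0 := Injective.under (ModuleCat.of A W)
    have hE0 : Module.Injective A E0 := by
      have : Injective (ModuleCat.of A E0) := inferInstanceAs (Injective (Injective.under _))
      exact Module.injective_module_of_injective_object A E0
    have hE := ptors_injective (J := J) E0 hE0
    have hinj : Function.Injective (Injective.ι (ModuleCat.of A W)).hom :=
      (ModuleCat.mono_iff_injective _).1 inferInstance
    let f : W →ₗ[A] ptors J E0 := LinearMap.codRestrict _ (Injective.ι (ModuleCat.of A W)).hom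
      (fun y => by
        obtain ⟨n, hn⟩ := hW y
        exact ⟨n, fun a ha => by rw [← map_smul, hn a ha, map_zero]⟩)
    have hf : Function.Injective f := fun x y hxy => hinj (congrArg Subtype.val hxy)
    obtain ⟨δ, h1, h2⟩ := exists_connecting (J := J) hf (LinearMap.range f).mkQ_surjective
      (LinearMap.exact_map_mkQ_range f) 0
    obtain ⟨c, rfl⟩ := (h2 h).1 (lh_injective_eq_zero hE _)
    refine (h1 c).2 ?_
    let y := θ _ c
    obtain ⟨e, he⟩ := (LinearMap.range f).mkQ_surjective y
    obtain ⟨u, hu⟩ : e ∈ LinearMap.range (θ (ptors J E0)) := by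
      rw [(hθ _).2]
      obtain ⟨n, hn⟩ := e.2
      exact ⟨n, fun a ha => Subtype.ext (hn a ha)⟩
    refine ⟨u, (hθ _).1 ?_⟩
    rw [hnat, hu, he]
  | succ i ih =>
    intro W _ _ hW h
    let E0 := Injective.under (ModuleCat.of A W)
    have hE0 : Module.Injective A E0 := by
      have : Injective (ModuleCat.of A E0) := inferInstanceAs (Injective (Injective.under _))
      exact Module.injective_module_of_injective_object A E0
    have hE := ptors_injective (J := J) E0 hE0
    have hinj : Function.Injective (Injective.ι (ModuleCat.of A W)).hom :=
      (ModuleCat.mono_iff_injective _).1 inferInstance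
    let f : W →ₗ[A] ptors J E0 := LinearMap.codRestrict _ (Injective.ι (ModuleCat.of A W)).hom
      (fun y => by
        obtain ⟨n, hn⟩ := hW y
        exact ⟨n, fun a ha => by rw [← map_smul, hn a ha, map_zero]⟩)
    have hf : Function.Injective f := fun x y hxy => hinj (congrArg Subtype.val hxy)
    obtain ⟨δ, h1, h2⟩ := exists_connecting (J := J) hf (LinearMap.range f).mkQ_surjective
      (LinearMap.exact_map_mkQ_range f) (i + 1)
    obtain ⟨c, rfl⟩ := (h2 h).1 (lh_injective_eq_zero hE _)
    rw [ih (W := ptors J E0 ⧸ LinearMap.range f) (by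
      intro y
      obtain ⟨e, rfl⟩ := (LinearMap.range f).mkQ_surjective y
      obtain ⟨n, hn⟩ := e.2
      refine ⟨n, fun a ha => ?_⟩
      rw [← map_smul, show a • e = 0 from Subtype.ext (hn a ha), map_zero]) c, map_zero]

variable {N : Type} [AddCommGroup N] [Module A N]

/-- Passing to the quotient by a torsion submodule is onto on local cohomology and bijective in
positive degrees. -/
theorem lhMap_surjective_of_torsion {N' : Type} [AddCommGroup N'] [Module A N'] (g : N →ₗ[A] N')
    (hg : Function.Surjective g) (hk : LinearMap.ker g ≤ ptors J N) (i : ℕ) :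
    Function.Surjective (lhMap J i g) := by
  obtain ⟨δ, h1, -⟩ := exists_connecting (J := J) (f := (LinearMap.ker g).subtype)
    Subtype.val_injective hg (LinearMap.exact_subtype_ker_map g) i
  intro c
  refine (h1 c).1 (lh_eq_zero_of_torsion i (fun y => ?_) _)
  obtain ⟨n, hn⟩ := hk y.2
  exact ⟨n, fun a ha => Subtype.ext (hn a ha)⟩

theorem lhMap_injective_of_torsion {N' : Type} [AddCommGroup N'] [Module A N'] (g : N →ₗ[A] N')
    (hg : Function.Surjective g) (hk : LinearMap.ker g ≤ ptors J N) (i : ℕ) :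
    Function.Injective (lhMap J (i + 1) g) := by
  have h1 := lhMap_exact (J := J) (f := (LinearMap.ker g).subtype)
    Subtype.val_injective hg (LinearMap.exact_subtype_ker_map g) (i + 1)
  rw [injective_iff_map_eq_zero]
  intro c hc
  obtain ⟨u, rfl⟩ := (h1 c).1 hc
  rw [lh_eq_zero_of_torsion i (fun y => ?_) u, map_zero]
  obtain ⟨n, hn⟩ := hk y.2
  exact ⟨n, fun a ha => Subtype.ext (hn a ha)⟩

/-- The long exact sequence for multiplication by an element with torsion kernel. -/
theorem exists_mul_les (x : A) (hx : ∀ y : N, x • y = 0 → y ∈ ptors J N) (i : ℕ) :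
    ∃ (p : LH J i N →ₗ[A] LH J i (QuotSMulTop x N))
      (δ : LH J i (QuotSMulTop x N) →ₗ[A] LH J (i + 1) N),
      (∀ h, p h = 0 ↔ ∃ h', x • h' = h) ∧ Function.Exact p δ ∧
      (∀ h, x • h = 0 ↔ ∃ c, δ c = h) := by
  let μ : N →ₗ[A] N := x • LinearMap.id
  let g : N →ₗ[A] LinearMap.range μ := μ.rangeRestrict
  have hg : Function.Surjective g := μ.surjective_rangeRestrict
  have hk : LinearMap.ker g ≤ ptors J N := by
    intro y hy
    exact hx y (congrArg Subtype.val hy)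
  have hr : LinearMap.range μ = x • (⊤ : Submodule A N) := by
    ext y
    simp [μ, Submodule.mem_smul_pointwise_iff_exists]
  have hex : Function.Exact (LinearMap.range μ).subtype
      (Submodule.mkQ (x • (⊤ : Submodule A N))) := by
    rw [LinearMap.exact_iff]
    simp [hr]
  have hcomp : (LinearMap.range μ).subtype ∘ₗ g = μ := rfl
  have hmul : ∀ (j : ℕ) (h : LH J j N),
      lhMap J j (LinearMap.range μ).subtype (lhMap J j g h) = x • h := by
    intro j h
    rw [← LinearMap.comp_apply, ← lhMap_comp, hcomp]
    exact lhMap_smul_id j x h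
  obtain ⟨δ, h1, h2⟩ := exists_connecting (J := J) (f := (LinearMap.range μ).subtype)
    Subtype.val_injective (Submodule.mkQ_surjective _) hex i
  have h0 := lhMap_exact (J := J) (f := (LinearMap.range μ).subtype)
    Subtype.val_injective (Submodule.mkQ_surjective _) hex i
  let e := LinearEquiv.ofBijective (lhMap J (i + 1) g)
    ⟨lhMap_injective_of_torsion g hg hk i, lhMap_surjective_of_torsion g hg hk _⟩
  refine ⟨lhMap J i (Submodule.mkQ (x • (⊤ : Submodule A N))), e.symm.toLinearMap ∘ₗ δ, ?_, ?_, ?_⟩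
  · intro h
    rw [h0 h]
    constructor
    · rintro ⟨c, rfl⟩
      obtain ⟨c, rfl⟩ := lhMap_surjective_of_torsion g hg hk _ c
      exact ⟨c, (hmul _ _).symm⟩
    · rintro ⟨c, rfl⟩
      exact ⟨_, hmul _ c⟩
  · intro c
    rw [← h1 c]
    simp
  · intro h
    rw [← hmul, h2]
    constructor
    · rintro ⟨c, hc⟩
      refine ⟨c, ?_⟩
      simp only [LinearMap.comp_apply, LinearEquiv.coe_coe]
      rw [hc]
      exact e.symm_apply_apply h
    · rintro ⟨c, rfl⟩
      exact ⟨c, (e.apply_symm_apply (δ c)).symm⟩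

end LCNoeth

end LocalCohomologyBasics

section DimBasics

open Order

variable {A : Type} [CommRing A]

/-- The closed set `V(I)` has dimension at most `d`. -/
def IDimLE (d : ℕ) (I : Ideal A) : Prop :=
  ∀ p : PrimeSpectrum A, I ≤ p.asIdeal → coheight p ≤ d

theorem IDimLE.mono {d : ℕ} {I I' : Ideal A} (h : IDimLE d I) (hI : I ≤ I') : IDimLE d I' :=
  fun p hp => h p (hI.trans hp)

theorem IDimLE.mono_dim {d d' : ℕ} {I : Ideal A} (h : IDimLE d I) (hd : d ≤ d') : IDimLE d' I :=
  fun p hp => (h p hp).trans (by exact_mod_cast hd)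

theorem IDimLE.inf {d : ℕ} {I I' : Ideal A} (h : IDimLE d I) (h' : IDimLE d I') :
    IDimLE d (I ⊓ I') := fun p hp => by
  rcases (Ideal.IsPrime.inf_le p.2).1 hp with H | H
  · exact h p H
  · exact h' p H

theorem iDimLE_top (d : ℕ) : IDimLE d (⊤ : Ideal A) :=
  fun p hp => absurd (top_le_iff.1 hp) p.2.ne_top

theorem iDimLE_iff_krullDim {d : ℕ} {I : Ideal A} :
    IDimLE d I ↔ krullDim (PrimeSpectrum.zeroLocus (I : Set A)) ≤ d := by
  constructor
  · intro h
    refine iSup_le fun p => ?_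
    have h1 : (p.map (Subtype.val) (fun a b hab => hab)).length ≤
        coheight (p.map (Subtype.val) (fun a b hab => hab)).head := length_le_coheight_head
    have h2 := h1.trans (h _ p.head.2)
    exact_mod_cast h2
  · intro h p hp
    have h1 : krullDim (Set.Ici p) ≤ krullDim (PrimeSpectrum.zeroLocus (I : Set A)) := by
      refine krullDim_le_of_strictMono
        (fun q => ⟨q.1, ?_⟩) (fun a b hab => hab)
      exact fun a ha => q.2 (hp ha)
    rw [← coheight_eq_krullDim_Ici] at h1
    exact_mod_cast h1.trans h

theorem iDimLE_iff_ringKrullDim {d : ℕ} {I : Ideal A} :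
    IDimLE d I ↔ ringKrullDim (A ⧸ I) ≤ d := by
  rw [ringKrullDim_quotient, iDimLE_iff_krullDim]

theorem exists_mem_notMem_of_finite (I : Ideal A) {S : Set (Ideal A)} (hS : S.Finite)
    (hp : ∀ p ∈ S, p.IsPrime ∧ ¬ I ≤ p) : ∃ x ∈ I, ∀ p ∈ S, x ∉ p := by
  by_contra! H
  have h1 : (I : Set A) ⊆ ⋃ i ∈ (↑hS.toFinset : Set (Ideal A)), (i : Set A) := by
    intro x hx
    obtain ⟨p, hp1, hp2⟩ := H x hx
    simp only [Set.Finite.coe_toFinset, Set.mem_iUnion]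
    exact ⟨p, hp1, hp2⟩
  rw [Ideal.subset_union_prime (f := fun i : Ideal A => i) ⊥ ⊥
    (fun i hi _ _ => (hp i (by simpa using hi)).1)] at h1
  obtain ⟨p, hp1, hp2⟩ := h1
  exact (hp p (by simpa using hp1)).2 hp2

section Local

variable [IsLocalRing A] [IsNoetherianRing A]

theorem IDimLE.of_sup_span {d : ℕ} {I : Ideal A} {x : A} (hx : x ∈ maximalIdeal A)
    (h : IDimLE d (I ⊔ Ideal.span {x})) : IDimLE (d + 1) I := by
  rw [iDimLE_iff_krullDim] at h ⊢
  have h1 := Module.supportDim_le_supportDim_quotSMulTop_succ (M := A ⧸ I) hx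
  have h2 : Module.support A (QuotSMulTop x (A ⧸ I)) =
      PrimeSpectrum.zeroLocus ((I ⊔ Ideal.span {x} : Ideal A) : Set A) := by
    rw [Module.support_quotSMulTop, Module.support_eq_zeroLocus, Ideal.annihilator_quotient,
      PrimeSpectrum.zeroLocus_sup, PrimeSpectrum.zeroLocus_span]
  have h3 : Module.support A (A ⧸ I) = PrimeSpectrum.zeroLocus (I : Set A) := by
    rw [Module.support_eq_zeroLocus, Ideal.annihilator_quotient]
  unfold Module.supportDim at h1
  rw [h2, h3] at h1
  refine h1.trans ?_
  push_cast
  gcongr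

theorem iDimLE_zero_iff {I : Ideal A} : IDimLE 0 I ↔ ∃ k, maximalIdeal A ^ k ≤ I := by
  constructor
  · intro h
    apply Ideal.exists_pow_le_of_le_radical_of_fg_radical
    · rw [Ideal.radical_eq_sInf]
      refine le_sInf fun p hp => ?_
      have h1 := h ⟨p, hp.2⟩ hp.1
      simp only [Nat.cast_zero, nonpos_iff_eq_zero, coheight_eq_zero] at h1
      have : (⟨p, hp.2⟩ : PrimeSpectrum A) ≤ closedPoint A :=
        IsLocalRing.le_maximalIdeal hp.2.ne_top
      exact h1 this
    · exact IsNoetherian.noetherian _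
  · rintro ⟨k, hk⟩ p hp
    have h1 : maximalIdeal A ≤ p.asIdeal := Ideal.IsPrime.le_of_pow_le (hk.trans hp)
    simp only [Nat.cast_zero, nonpos_iff_eq_zero, coheight_eq_zero]
    intro q hq
    exact (IsLocalRing.le_maximalIdeal q.2.ne_top).trans h1

theorem coheight_maximalIdeal : coheight (closedPoint A) = 0 := by
  rw [coheight_eq_zero]
  intro q hq
  exact IsLocalRing.le_maximalIdeal q.2.ne_top

end Local

section Mod

variable {N : Type} [AddCommGroup N] [Module A N]

theorem colon_le_of_smul_sup [IsNoetherianRing A] [IsNoetherian A N] {P W : Submodule A N}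
    {I p : Ideal A} (hp : p.IsPrime) (hI : I ≤ p) (h : P.colon (W : Set N) ≤ p) :
    (P ⊔ I • W).colon (W : Set N) ≤ p := by
  set X := W.map P.mkQ with hX
  have hs : (⟨p, hp⟩ : PrimeSpectrum A) ∈ Module.support A (↥X ⧸ (I • ⊤ : Submodule A X)) := by
    rw [Module.support_quotient, Module.support_eq_zeroLocus]
    refine ⟨?_, hI⟩
    have := Submodule.annihilator_map_mkQ_eq_colon (R := A) (N := P) (P := W)
    intro a ha
    exact h (this ▸ ha)
  refine le_trans ?_ (Module.annihilator_le_of_mem_support hs)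
  intro c hc
  rw [Module.mem_annihilator]
  intro z
  obtain ⟨⟨y, hy⟩, rfl⟩ := Submodule.mkQ_surjective _ z
  rw [← map_smul, Submodule.mkQ_apply, Submodule.Quotient.mk_eq_zero]
  obtain ⟨w, hw, rfl⟩ := hy
  have h1 := Submodule.mem_colon.1 hc w hw
  have h2 : c • P.mkQ w ∈ I • X := by
    rw [← map_smul, hX, ← Submodule.map_smul'']
    obtain ⟨a, ha, b, hb, hab⟩ := Submodule.mem_sup.1 h1
    refine ⟨b, hb, ?_⟩
    rw [← hab, map_add, show P.mkQ a = 0 from (Submodule.Quotient.mk_eq_zero P).2 ha, zero_add]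
  have h3 : (I • ⊤ : Submodule A X).map X.subtype = I • X := by
    rw [Submodule.map_smul'', Submodule.map_top, Submodule.range_subtype]
  rw [← h3] at h2
  obtain ⟨u, hu, hu2⟩ := h2
  have h4 : u = c • (⟨P.mkQ w, Submodule.mem_map_of_mem hw⟩ : X) := Subtype.ext hu2
  exact h4 ▸ hu

end Mod

end DimBasics

section Low

open Order

variable {A : Type} [CommRing A] {N : Type} [AddCommGroup N] [Module A N]

theorem bot_colon_mk (P : Submodule A N) (a : N) :
    (⊥ : Submodule A (N ⧸ P)).colon {(Submodule.Quotient.mk a : N ⧸ P)} = P.colon {a} := by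
  ext c
  rw [Submodule.mem_colon_singleton, Submodule.mem_colon_singleton, Submodule.mem_bot,
    ← Submodule.Quotient.mk_smul, Submodule.Quotient.mk_eq_zero]

/-- The primes of the form `(P : a)`. -/
def assP (P : Submodule A N) : Set (Ideal A) := {p | p.IsPrime ∧ ∃ a : N, p = P.colon {a}}

theorem assP_eq [IsNoetherianRing A] (P : Submodule A N) :
    assP P = associatedPrimes A (N ⧸ P) := by
  ext p
  rw [AssociatedPrimes.mem_iff, isAssociatedPrime_iff]
  constructor
  · rintro ⟨hp, a, ha⟩
    exact ⟨hp, Submodule.Quotient.mk a, by rw [bot_colon_mk, ha]⟩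
  · rintro ⟨hp, a, ha⟩
    obtain ⟨b, rfl⟩ := Submodule.Quotient.mk_surjective _ a
    exact ⟨hp, b, by rw [ha, bot_colon_mk]⟩

theorem assP_finite [IsNoetherianRing A] [Module.Finite A N] (P : Submodule A N) :
    (assP P).Finite := by
  rw [assP_eq]
  exact associatedPrimes.finite A _

theorem exists_mem_assP [IsNoetherianRing A] {P : Submodule A N} {a : N} (ha : a ∉ P) :
    ∃ p ∈ assP P, P.colon {a} ≤ p := by
  obtain ⟨p, hp, hp2⟩ := exists_le_isAssociatedPrime_of_isNoetherianRing A
    (Submodule.Quotient.mk a : N ⧸ P) (fun h => ha ((Submodule.Quotient.mk_eq_zero P).1 h))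
  exact ⟨p, by rw [assP_eq]; exact hp, by rwa [bot_colon_mk] at hp2⟩

theorem mem_assP_of_minimal [IsNoetherianRing A] [Module.Finite A N] {P : Submodule A N}
    {p : Ideal A} (hp : p ∈ (P.colon (Set.univ : Set N)).minimalPrimes) : p ∈ assP P := by
  rw [assP_eq]
  apply Module.associatedPrimes.minimalPrimes_annihilator_subset_associatedPrimes
  rwa [Submodule.annihilator_quotient]

/-- The largest submodule over `P` whose quotient by `P` has dimension at most `d`. -/
def low (d : ℕ) (P : Submodule A N) : Submodule A N where
  carrier := {a | IDimLE d (P.colon {a})}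
  zero_mem' := by
    show IDimLE d _
    rw [Submodule.colon_singleton_zero]
    exact iDimLE_top d
  add_mem' := by
    intro a b ha hb
    refine (ha.inf hb).mono ?_
    intro c hc
    rw [Submodule.mem_colon_singleton, smul_add]
    exact P.add_mem (Submodule.mem_colon_singleton.1 hc.1) (Submodule.mem_colon_singleton.1 hc.2)
  smul_mem' := by
    intro c a ha
    refine IDimLE.mono ha ?_
    intro e he
    rw [Submodule.mem_colon_singleton, smul_comm]
    exact P.smul_mem _ (Submodule.mem_colon_singleton.1 he)

theorem mem_low {d : ℕ} {P : Submodule A N} {a : N} : a ∈ low d P ↔ IDimLE d (P.colon {a}) :=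
  Iff.rfl

theorem le_low (d : ℕ) (P : Submodule A N) : P ≤ low d P := fun a ha => by
  rw [mem_low, (Submodule.colon_eq_top_iff_subset {a}).2 (by simpa using ha)]
  exact iDimLE_top d

theorem low_mono {d : ℕ} {P P' : Submodule A N} (h : P ≤ P') : low d P ≤ low d P' :=
  fun _ ha => IDimLE.mono ha (Submodule.colon_mono h subset_rfl)

theorem low_mono_dim {d d' : ℕ} (h : d ≤ d') (P : Submodule A N) : low d P ≤ low d' P :=
  fun _ ha => IDimLE.mono_dim ha h

theorem low_low (d : ℕ) (P : Submodule A N) : low d (low d P) = low d P := by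
  refine le_antisymm (fun a ha => ?_) (le_low _ _)
  intro p hp
  by_cases h : (low d P).colon {a} ≤ p.asIdeal
  · exact ha p h
  · obtain ⟨b, hb, hbp⟩ := SetLike.not_le_iff_exists.1 h
    refine Submodule.mem_colon_singleton.1 hb p fun c hc => ?_
    have h1 : c * b ∈ p.asIdeal := hp <| by
      rw [Submodule.mem_colon_singleton, mul_smul]
      exact Submodule.mem_colon_singleton.1 hc
    exact (p.2.mem_or_mem h1).resolve_right hbp

theorem low_le_of_le {d : ℕ} {P P' : Submodule A N} (h : P' ≤ low d P) : low d P' ≤ low d P :=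
  (low_mono h).trans (low_low d P).le

theorem low_low_of_le {d d' : ℕ} (h : d ≤ d') (P : Submodule A N) : low d' (low d P) = low d' P :=
  le_antisymm (low_le_of_le (low_mono_dim h P)) (low_mono (le_low d P))

theorem iDimLE_colon_of_le_low {P W : Submodule A N} (hW : W.FG) {d : ℕ} (h : W ≤ low d P) :
    IDimLE d (P.colon (W : Set N)) := by
  classical
  obtain ⟨s, rfl⟩ := hW
  rw [Submodule.colon_span]
  induction s using Finset.induction_on with
  | empty => simpa using iDimLE_top d
  | insert a s _ ih =>
    rw [Finset.coe_insert, Set.insert_eq, Submodule.colon_union]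
    rw [Finset.coe_insert, Submodule.span_insert, sup_le_iff] at h
    exact IDimLE.inf (h.1 (Submodule.mem_span_singleton_self a)) (ih h.2)

theorem le_low_iff [IsNoetherian A N] {P W : Submodule A N} {d : ℕ} :
    W ≤ low d P ↔ IDimLE d (P.colon (W : Set N)) :=
  ⟨iDimLE_colon_of_le_low (IsNoetherian.noetherian W),
    fun h a ha => IDimLE.mono h (Submodule.colon_mono le_rfl (by simpa using ha))⟩

theorem not_coheight_le_of_mem_assP_low {d : ℕ} {P : Submodule A N} {p : Ideal A}
    (hp : p ∈ assP (low d P)) : ¬ coheight (⟨p, hp.1⟩ : PrimeSpectrum A) ≤ d := by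
  obtain ⟨hp1, a, rfl⟩ := hp
  intro h
  have h1 : a ∈ low d (low d P) := by
    intro q hq
    exact (coheight_anti (show (⟨_, hp1⟩ : PrimeSpectrum A) ≤ q from hq)).trans h
  rw [low_low] at h1
  exact hp1.ne_top ((Submodule.colon_eq_top_iff_subset _).2 (by simpa using h1))

/-- `(P : x)` as a submodule. -/
def sdiv (P : Submodule A N) (x : A) : Submodule A N := P.comap (LinearMap.lsmul A N x)

@[simp] theorem mem_sdiv {P : Submodule A N} {x : A} {a : N} : a ∈ sdiv P x ↔ x • a ∈ P := Iff.rfl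

theorem le_sdiv (P : Submodule A N) (x : A) : P ≤ sdiv P x := fun _ ha => P.smul_mem _ ha

theorem sdiv_mono {P P' : Submodule A N} (h : P ≤ P') (x : A) : sdiv P x ≤ sdiv P' x :=
  fun _ ha => h ha

/-- `P + xN`. -/
def adj (P : Submodule A N) (x : A) : Submodule A N := P ⊔ Ideal.span {x} • ⊤

theorem mem_adj {P : Submodule A N} {x : A} {a : N} :
    a ∈ adj P x ↔ ∃ b, a - x • b ∈ P := by
  rw [adj, Submodule.mem_sup]
  constructor
  · rintro ⟨y, hy, z, hz, rfl⟩
    rw [Submodule.ideal_span_singleton_smul, Submodule.mem_smul_pointwise_iff_exists] at hz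
    obtain ⟨b, -, rfl⟩ := hz
    exact ⟨b, by simpa using hy⟩
  · rintro ⟨b, hb⟩
    refine ⟨_, hb, x • b, ?_, by abel⟩
    exact Submodule.smul_mem_smul (Ideal.mem_span_singleton_self x) trivial

theorem le_adj (P : Submodule A N) (x : A) : P ≤ adj P x := le_sup_left

theorem smul_mem_adj (P : Submodule A N) (x : A) (b : N) : x • b ∈ adj P x :=
  mem_adj.2 ⟨b, by simp⟩

theorem adj_mono {P P' : Submodule A N} (h : P ≤ P') (x : A) : adj P x ≤ adj P' x :=
  sup_le_sup_right h _

theorem adj_le_adj_of_dvd (P : Submodule A N) {x y : A} (h : x ∣ y) : adj P y ≤ adj P x := by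
  obtain ⟨c, rfl⟩ := h
  intro a ha
  obtain ⟨b, hb⟩ := mem_adj.1 ha
  exact mem_adj.2 ⟨c • b, by rwa [smul_smul]⟩

end Low

section LowLocal

open Order

variable {A : Type} [CommRing A] [IsLocalRing A] [IsNoetherianRing A]
  {N : Type} [AddCommGroup N] [Module A N] [Module.Finite A N]

local notation "𝔪" => maximalIdeal A

/-- The saturation `P : 𝔪^∞`. -/
abbrev sat (P : Submodule A N) : Submodule A N := low 0 P

theorem mem_sat {P : Submodule A N} {a : N} : a ∈ sat P ↔ ∃ k, ∀ c ∈ 𝔪 ^ k, c • a ∈ P := by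
  rw [mem_low, iDimLE_zero_iff]
  simp only [SetLike.le_def, Submodule.mem_colon_singleton]

theorem exists_pow_le_colon {P W : Submodule A N} (h : W ≤ sat P) :
    ∃ k, ∀ c ∈ 𝔪 ^ k, ∀ a ∈ W, c • a ∈ P := by
  rw [le_low_iff, iDimLE_zero_iff] at h
  obtain ⟨k, hk⟩ := h
  exact ⟨k, fun c hc a ha => Submodule.mem_colon.1 (hk hc) a ha⟩

theorem le_sat_of_pow {P W : Submodule A N} {k : ℕ} (h : ∀ c ∈ 𝔪 ^ k, ∀ a ∈ W, c • a ∈ P) :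
    W ≤ sat P := fun a ha => mem_sat.2 ⟨k, fun c hc => h c hc a ha⟩

theorem eq_of_forall_mem_sup_pow {P : Submodule A N} {a : N}
    (h : ∀ n : ℕ, a ∈ P ⊔ 𝔪 ^ n • (⊤ : Submodule A N)) : a ∈ P := by
  rw [← Submodule.Quotient.mk_eq_zero P, ← Submodule.mem_bot (R := A),
    ← Ideal.iInf_pow_smul_eq_bot_of_isLocalRing 𝔪 (M := N ⧸ P) (Ideal.IsPrime.ne_top inferInstance),
    Submodule.mem_iInf]
  intro n
  have h1 : (𝔪 ^ n • (⊤ : Submodule A N)).map P.mkQ = 𝔪 ^ n • ⊤ := by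
    rw [Submodule.map_smul'', Submodule.map_top, Submodule.range_mkQ]
  rw [← h1]
  obtain ⟨y, hy, z, hz, rfl⟩ := Submodule.mem_sup.1 (h n)
  refine ⟨z, hz, ?_⟩
  simp [(Submodule.Quotient.mk_eq_zero P).2 hy]

theorem exists_pow_inf_sat_le (P : Submodule A N) :
    ∃ k, 𝔪 ^ k • (⊤ : Submodule A N) ⊓ sat P ≤ P := by
  obtain ⟨K, hK⟩ := exists_pow_le_colon (le_refl (sat P))
  obtain ⟨k, hk⟩ := Ideal.exists_pow_inf_eq_pow_smul 𝔪 (sat P)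
  refine ⟨k + K, ?_⟩
  rw [hk (k + K) (by omega), Nat.add_sub_cancel_left, Submodule.smul_le]
  exact fun c hc a ha => hK c hc a ha.2

theorem exists_avoid {I : Ideal A} (Ps : List (ℕ × Submodule A N))
    (hI : ∀ x ∈ Ps, ∀ p ∈ assP (low x.1 x.2), ¬ I ≤ p) :
    ∃ y ∈ I, ∀ x ∈ Ps, sdiv (low x.1 x.2) y ≤ low x.1 x.2 := by
  have hfin : (⋃ x ∈ {x | x ∈ Ps}, assP (low x.1 x.2)).Finite :=
    Set.Finite.biUnion (List.finite_toSet Ps) fun x _ => assP_finite _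
  obtain ⟨y, hy, hy2⟩ := exists_mem_notMem_of_finite I hfin (by
    intro p hp
    simp only [Set.mem_iUnion] at hp
    obtain ⟨x, hx, hxp⟩ := hp
    exact ⟨hxp.1, hI x hx p hxp⟩)
  refine ⟨y, hy, fun x hx a ha => ?_⟩
  by_contra h
  obtain ⟨p, hp, hap⟩ := exists_mem_assP h
  refine hy2 p ?_ (hap (Submodule.mem_colon_singleton.2 ha))
  simp only [Set.mem_iUnion]
  exact ⟨x, hx, hp⟩

theorem pow_not_le_of_mem_assP_low {d k : ℕ} {P : Submodule A N} {p : Ideal A}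
    (hp : p ∈ assP (low d P)) : ¬ 𝔪 ^ k ≤ p := by
  intro h
  refine not_coheight_le_of_mem_assP_low hp ?_
  have hprime := hp.1
  have h2 : (⟨p, hp.1⟩ : PrimeSpectrum A) = closedPoint A :=
    PrimeSpectrum.ext (((IsLocalRing.le_maximalIdeal hp.1.ne_top)).antisymm
      (Ideal.IsPrime.le_of_pow_le h))
  rw [h2, coheight_maximalIdeal]
  exact bot_le

theorem low_adj_eq_top {d : ℕ} {P : Submodule A N} {x : A} (hP : low (d + 1) P = ⊤)
    (hx : sdiv P x ≤ low d P) : low d (adj P x) = ⊤ := by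
  rw [← top_le_iff, le_low_iff] at hP ⊢
  intro p hp
  by_contra hd
  have hpP : P.colon ((⊤ : Submodule A N) : Set N) ≤ p.asIdeal :=
    (Submodule.colon_mono (le_adj P x) subset_rfl).trans hp
  have hxp : x ∈ p.asIdeal := hp (Submodule.mem_colon.2 fun a _ => smul_mem_adj P x a)
  have hmin : p.asIdeal ∈ (P.colon (Set.univ : Set N)).minimalPrimes := by
    refine ⟨⟨p.2, by simpa using hpP⟩, fun q hq hqp => ?_⟩
    by_contra hne
    have hlt : (⟨q, hq.1⟩ : PrimeSpectrum A) < p := lt_of_le_not_ge hqp hne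
    have h1 := (coheight_le_coe_iff (n := d + 1)).1 (hP ⟨q, hq.1⟩ (by simpa using hq.2)) p hlt
    refine hd (Order.le_of_lt_add_one ?_)
    exact_mod_cast h1
  obtain ⟨-, a, ha⟩ := mem_assP_of_minimal hmin
  have h1 : a ∈ low d P := hx (Submodule.mem_colon_singleton.1 (ha ▸ hxp))
  exact hd (h1 p ha.ge)

theorem sdiv_low_le {d : ℕ} {P : Submodule A N} {x : A} (h : low d (adj P x) = ⊤) :
    sdiv (low d P) x ≤ low d P := by
  intro a ha
  by_contra hn
  obtain ⟨p, hp, hap⟩ := exists_mem_assP hn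
  refine not_coheight_le_of_mem_assP_low hp ?_
  rw [← top_le_iff, le_low_iff] at h
  refine h ⟨p, hp.1⟩ ?_
  have hxp : x ∈ p := hap (Submodule.mem_colon_singleton.2 ha)
  refine colon_le_of_smul_sup hp.1 ((Ideal.span_singleton_le_iff_mem p).2 hxp) ?_
  obtain ⟨-, b, rfl⟩ := hp
  exact Submodule.colon_mono (le_low d P) (by simp)

theorem iDimLE_colon_of_sup {d : ℕ} {P W : Submodule A N} {x : A} (hx : x ∈ 𝔪)
    (h : W ≤ low d (P ⊔ Ideal.span {x} • W)) : W ≤ low (d + 1) P := by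
  rw [le_low_iff] at h ⊢
  refine IDimLE.of_sup_span hx fun p hp => h p ?_
  rw [sup_le_iff] at hp
  exact colon_le_of_smul_sup p.2 hp.2 hp.1

theorem low_succ_eq_top {d : ℕ} {P : Submodule A N} {x : A} (hx : x ∈ 𝔪)
    (h : low d (adj P x) = ⊤) : low (d + 1) P = ⊤ :=
  top_le_iff.1 (iDimLE_colon_of_sup hx h.ge)

/-- Successively adjoining the elements of a list. -/
def adjs (P : Submodule A N) : List A → Submodule A N
  | [] => P
  | x :: xs => adjs (adj P x) xs

@[simp] theorem adjs_nil (P : Submodule A N) : adjs P [] = P := rfl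

@[simp] theorem adjs_cons (P : Submodule A N) (x : A) (xs : List A) :
    adjs P (x :: xs) = adjs (adj P x) xs := rfl

theorem adjs_eq (P : Submodule A N) (xs : List A) : adjs P xs = P ⊔ Ideal.ofList xs • ⊤ := by
  induction xs generalizing P with
  | nil => simp
  | cons x xs ih => rw [adjs_cons, ih, adj, Ideal.ofList_cons, Submodule.sup_smul, sup_assoc]

theorem le_adjs (P : Submodule A N) (xs : List A) : P ≤ adjs P xs := by
  rw [adjs_eq]
  exact le_sup_left

theorem adjs_mono {P P' : Submodule A N} (h : P ≤ P') (xs : List A) : adjs P xs ≤ adjs P' xs := by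
  rw [adjs_eq, adjs_eq]
  exact sup_le_sup_right h _

theorem adjs_perm (P : Submodule A N) {xs ys : List A} (h : xs.Perm ys) :
    adjs P xs = adjs P ys := by
  rw [adjs_eq, adjs_eq, Ideal.ofList, Ideal.ofList]
  simp only [h.mem_iff]

theorem adjs_append (P : Submodule A N) (xs ys : List A) :
    adjs P (xs ++ ys) = adjs (adjs P xs) ys := by
  induction xs generalizing P with
  | nil => rfl
  | cons x xs ih => exact ih _

/-- A system of parameters for `N ⧸ P`, up to the number of elements. -/
def Sop (P : Submodule A N) (xs : List A) : Prop := (∀ x ∈ xs, x ∈ 𝔪) ∧ sat (adjs P xs) = ⊤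

theorem Sop.tail {P : Submodule A N} {x : A} {xs : List A} (h : Sop P (x :: xs)) :
    Sop (adj P x) xs := ⟨fun y hy => h.1 y (List.mem_cons_of_mem _ hy), h.2⟩

theorem Sop.mono {P P' : Submodule A N} (hP : P ≤ P') {xs : List A} (h : Sop P xs) : Sop P' xs :=
  ⟨h.1, top_le_iff.1 (h.2 ▸ low_mono (adjs_mono hP xs))⟩

theorem Sop.perm {P : Submodule A N} {xs ys : List A} (hxs : xs.Perm ys) (h : Sop P xs) :
    Sop P ys := ⟨fun y hy => h.1 y (hxs.mem_iff.2 hy), by rw [← adjs_perm P hxs]; exact h.2⟩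

theorem Sop.low_eq_top {P : Submodule A N} {xs : List A} (h : Sop P xs) :
    low xs.length P = ⊤ := by
  induction xs generalizing P with
  | nil => exact h.2
  | cons x xs ih => exact low_succ_eq_top (h.1 x (by simp)) (ih h.tail)

/-- `x` is a parameter for `N ⧸ P`, of dimension at most `r + 1`. -/
def IsPar (r : ℕ) (P : Submodule A N) (x : A) : Prop := x ∈ 𝔪 ∧ low r (adj P x) = ⊤

theorem Sop.isPar {P : Submodule A N} {x : A} {xs : List A} (h : Sop P (x :: xs)) :
    IsPar xs.length P x := ⟨h.1 x (by simp), h.tail.low_eq_top⟩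

end LowLocal

section HcBasics

open Pointwise

variable {A : Type} [CommRing A] [IsLocalRing A] [IsNoetherianRing A]
  {N : Type} [AddCommGroup N] [Module A N] [Module.Finite A N]

local notation "𝔪" => maximalIdeal A

/-- The local cohomology of `N ⧸ P`. -/
abbrev Hc (i : ℕ) (P : Submodule A N) : Type := LH (maximalIdeal A) i (N ⧸ P)

theorem mk_mem_ptors {P : Submodule A N} {a : N} :
    (Submodule.Quotient.mk a : N ⧸ P) ∈ ptors 𝔪 (N ⧸ P) ↔ a ∈ sat P := by
  rw [mem_ptors, mem_sat]
  simp only [← Submodule.Quotient.mk_smul, Submodule.Quotient.mk_eq_zero]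

theorem ptors_quotient (P : Submodule A N) :
    ptors 𝔪 (N ⧸ P) = (sat P).map P.mkQ := by
  ext z
  obtain ⟨a, rfl⟩ := Submodule.Quotient.mk_surjective _ z
  rw [mk_mem_ptors, Submodule.mem_map]
  constructor
  · exact fun h => ⟨a, h, rfl⟩
  · rintro ⟨b, hb, hab⟩
    have h1 : b - a ∈ P := (Submodule.Quotient.eq P).1 hab
    have := (sat P).sub_mem hb (le_low 0 P h1)
    simpa using this

theorem exists_hcZeroEquiv (P : Submodule A N) : Nonempty (Hc 0 P ≃ₗ[A] (sat P).map P.mkQ) := by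
  obtain ⟨θ, h1, -⟩ := exists_theta (A := A) 𝔪
  obtain ⟨hi, hr⟩ := h1 (N ⧸ P)
  exact ⟨(LinearEquiv.ofInjective _ hi).trans
    (LinearEquiv.ofEq _ _ (hr.trans (ptors_quotient P)))⟩

theorem hc_zero_smul_iff {P : Submodule A N} {c : A} :
    (∀ h : Hc 0 P, c • h = 0) ↔ ∀ a ∈ sat P, c • a ∈ P := by
  obtain ⟨e⟩ := exists_hcZeroEquiv P
  constructor
  · intro h a ha
    have h1 := h (e.symm ⟨P.mkQ a, Submodule.mem_map_of_mem ha⟩)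
    rw [← map_smul, LinearEquiv.map_eq_zero_iff] at h1
    exact (Submodule.Quotient.mk_eq_zero P).1 (congrArg Subtype.val h1)
  · intro h z
    rw [← LinearEquiv.map_eq_zero_iff e, map_smul]
    obtain ⟨a, ha, hz⟩ := (e z).2
    apply Subtype.ext
    rw [Submodule.coe_smul, ← hz, ← map_smul]
    exact (Submodule.Quotient.mk_eq_zero P).2 (h a ha)

theorem exists_hcEquiv {P P' : Submodule A N} (h : P ≤ P') (h' : P' ≤ sat P) (i : ℕ) :
    Nonempty (Hc (i + 1) P ≃ₗ[A] Hc (i + 1) P') := by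
  have hk : LinearMap.ker (Submodule.factor h) ≤ ptors 𝔪 (N ⧸ P) := by
    intro z hz
    obtain ⟨a, rfl⟩ := Submodule.Quotient.mk_surjective _ z
    rw [mk_mem_ptors]
    exact h' ((Submodule.Quotient.mk_eq_zero P').1 hz)
  have hs : Function.Surjective (Submodule.factor h) := Submodule.factor_surjective h
  exact ⟨LinearEquiv.ofBijective (lhMap 𝔪 (i + 1) (Submodule.factor h))
    ⟨lhMap_injective_of_torsion _ hs hk i, lhMap_surjective_of_torsion _ hs hk (i + 1)⟩⟩

theorem exists_quotSMulTopEquiv (P : Submodule A N) (x : A) :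
    Nonempty (QuotSMulTop x (N ⧸ P) ≃ₗ[A] N ⧸ adj P x) := by
  let f : N →ₗ[A] QuotSMulTop x (N ⧸ P) := (Submodule.mkQ _).comp P.mkQ
  have hf : Function.Surjective f :=
    (Submodule.mkQ_surjective _).comp (Submodule.mkQ_surjective _)
  have hk : LinearMap.ker f = adj P x := by
    ext a
    rw [LinearMap.mem_ker, mem_adj]
    simp only [f, LinearMap.comp_apply, Submodule.mkQ_apply, Submodule.Quotient.mk_eq_zero,
      Submodule.mem_smul_pointwise_iff_exists]
    constructor
    · rintro ⟨z, -, hz⟩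
      obtain ⟨b, rfl⟩ := Submodule.Quotient.mk_surjective _ z
      exact ⟨b, (Submodule.Quotient.eq P).1 hz.symm⟩
    · rintro ⟨b, hb⟩
      exact ⟨Submodule.Quotient.mk b, trivial, ((Submodule.Quotient.eq P).2 hb).symm⟩
  exact ⟨((Submodule.quotEquivOfEq _ _ hk.symm).trans (f.quotKerEquivOfSurjective hf)).symm⟩

theorem exists_hc_les {P : Submodule A N} {x : A} (hx : sdiv P x ≤ sat P) (i : ℕ) :
    ∃ (p : Hc i P →ₗ[A] Hc i (adj P x)) (δ : Hc i (adj P x) →ₗ[A] Hc (i + 1) P),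
      (∀ h, p h = 0 ↔ ∃ h', x • h' = h) ∧ Function.Exact p δ ∧
      (∀ h, x • h = 0 ↔ ∃ c, δ c = h) := by
  obtain ⟨e⟩ := exists_quotSMulTopEquiv P x
  obtain ⟨p, δ, h1, h2, h3⟩ := exists_mul_les (J := 𝔪) (N := N ⧸ P) x (by
    intro y hy
    obtain ⟨a, rfl⟩ := Submodule.Quotient.mk_surjective _ y
    rw [mk_mem_ptors]
    exact hx ((Submodule.Quotient.mk_eq_zero P).1 hy)) i
  let E := lhEquiv 𝔪 i e
  refine ⟨E.toLinearMap.comp p, δ.comp E.symm.toLinearMap, fun h => ?_, fun c => ?_, fun h => ?_⟩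
  · rw [← h1]
    simp
  · have := h2 (E.symm c)
    rw [LinearMap.comp_apply]
    refine this.trans ⟨?_, ?_⟩
    · rintro ⟨y, hy⟩
      exact ⟨y, by simp [hy]⟩
    · rintro ⟨y, hy⟩
      exact ⟨y, by simp [← hy]⟩
  · rw [h3]
    constructor
    · rintro ⟨c, hc⟩
      exact ⟨E c, by simp [hc]⟩
    · rintro ⟨c, hc⟩
      exact ⟨E.symm c, hc⟩

/-- The ideal `I` kills the local cohomology of `N ⧸ P` in degrees below `r`. -/
def HKill (P : Submodule A N) (r : ℕ) (I : Ideal A) : Prop :=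
  ∀ i < r, ∀ c ∈ I, ∀ h : Hc i P, c • h = 0

theorem HKill.mono {P : Submodule A N} {r r' : ℕ} {I I' : Ideal A} (h : HKill P r I)
    (hr : r' ≤ r) (hI : I' ≤ I) : HKill P r' I' :=
  fun i hi c hc => h i (hi.trans_le hr) c (hI hc)

theorem HKill.adj {P : Submodule A N} {x : A} (hx : sdiv P x ≤ sat P) {r : ℕ} {I I' : Ideal A}
    (h : HKill P (r + 1) I) (h' : HKill P (r + 1) I') : HKill (adj P x) r (I * I') := by
  intro i hi
  obtain ⟨p, δ, -, h2, -⟩ := exists_hc_les hx i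
  intro c hc z
  refine Submodule.mul_induction_on hc (fun a ha b hb => ?_) (fun a b ha hb => ?_)
  · have h1 : δ (b • z) = 0 := by rw [map_smul, h' _ (by omega) b hb]
    obtain ⟨y, hy⟩ := (h2 _).1 h1
    rw [mul_smul, ← hy, ← map_smul, h _ (by omega) a ha, map_zero]
  · rw [add_smul, ha, hb, add_zero]

theorem HKill.of_sat {P P' : Submodule A N} (h : P ≤ P') (h' : P' ≤ sat P) {r : ℕ} {I : Ideal A}
    (hK : HKill P r I) : HKill P' r I := by
  intro i hi c hc
  rcases i with _ | i
  · rw [hc_zero_smul_iff]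
    intro a ha
    exact h (hc_zero_smul_iff.1 (hK 0 hi c hc) a (low_le_of_le h' ha))
  · obtain ⟨e⟩ := exists_hcEquiv h h' i
    intro z
    rw [← LinearEquiv.map_eq_zero_iff e.symm, map_smul]
    exact hK _ hi c hc _

end HcBasics

section LemmaAss

open Order

variable {A : Type} [CommRing A] [IsLocalRing A] [IsNoetherianRing A]
  {N : Type} [AddCommGroup N] [Module A N] [Module.Finite A N]

local notation "𝔪" => maximalIdeal A

theorem sdiv_pow_le {P P' : Submodule A N} {y : A} (h : sdiv P' y ≤ P') (hP : P ≤ P') (n : ℕ) :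
    sdiv P (y ^ n) ≤ P' := by
  induction n with
  | zero => intro a ha; simpa using hP (by simpa using ha : a ∈ P)
  | succ n ih =>
    intro a ha
    rw [mem_sdiv, pow_succ, mul_smul] at ha
    exact h (ih ha)

theorem mem_of_forall_mem_adj_pow {P : Submodule A N} {y : A} (hy : y ∈ 𝔪) {a : N}
    (h : ∀ n : ℕ, a ∈ adj P (y ^ (n + 1))) : a ∈ P := by
  refine eq_of_forall_mem_sup_pow fun n => ?_
  refine (sup_le_sup_left (Submodule.smul_mono_left ?_) P) (h n)
  rw [Ideal.span_singleton_le_iff_mem]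
  exact Ideal.pow_le_pow_right (Nat.le_succ n) (Ideal.pow_mem_pow hy _)

theorem low_succ_le_low_adj {d : ℕ} {P : Submodule A N} {y : A} (hy : sdiv P y ≤ P) (n : ℕ) :
    low (d + 1) P ≤ low d (adj P (y ^ n)) := by
  intro a ha q hq
  have hI : P.colon {a} ≤ q.asIdeal :=
    (Submodule.colon_mono (le_adj P _) subset_rfl).trans hq
  have hyq : y ∈ q.asIdeal := q.2.mem_of_pow_mem n
    (hq (Submodule.mem_colon_singleton.2 (smul_mem_adj P _ a)))
  by_contra hd
  have hmin : q.asIdeal ∈ ((P.colon {a}).colon (Set.univ : Set A)).minimalPrimes := by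
    rw [Submodule.colon_univ]
    refine ⟨⟨q.2, hI⟩, fun p hp hpq => ?_⟩
    by_contra hne
    have hlt : (⟨p, hp.1⟩ : PrimeSpectrum A) < q := lt_of_le_not_ge hpq hne
    have h1 := (coheight_le_coe_iff (n := d + 1)).1 (ha ⟨p, hp.1⟩ hp.2) q hlt
    refine hd (Order.le_of_lt_add_one ?_)
    exact_mod_cast h1
  obtain ⟨-, c, hc⟩ := mem_assP_of_minimal hmin
  have h1 : y * c ∈ P.colon {a} := Submodule.mem_colon_singleton.1 (hc ▸ hyq)
  rw [Submodule.mem_colon_singleton, mul_smul] at h1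
  have h2 : c ∈ P.colon {a} := Submodule.mem_colon_singleton.2 (hy h1)
  refine q.2.ne_top ?_
  rw [hc, Submodule.colon_eq_top_iff_subset]
  simpa using h2

theorem exists_sdiv_sat_le (Ps : List (Submodule A N)) (k : ℕ) :
    ∃ y ∈ 𝔪 ^ k, ∀ P ∈ Ps, sdiv (sat P) y ≤ sat P := by
  obtain ⟨y, hy, h⟩ := exists_avoid (I := 𝔪 ^ k) (Ps.map fun P => (0, P)) (by
    intro x hx p hp
    exact pow_not_le_of_mem_assP_low hp)
  exact ⟨y, hy, fun P hP => h (0, P) (List.mem_map.2 ⟨P, hP, rfl⟩)⟩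

theorem low_le_sat_of_hKill (d : ℕ) : ∀ (P : Submodule A N) (r K : ℕ), d < r →
    HKill P r (𝔪 ^ K) → low d P ≤ sat P := by
  induction d with
  | zero => exact fun P _ _ _ _ => le_rfl
  | succ d ih =>
    intro P r K hr hK
    obtain ⟨r, rfl⟩ : ∃ s, r = s + 1 := ⟨r - 1, by omega⟩
    have hK' := hK.of_sat (le_low 0 P) le_rfl
    obtain ⟨y, hy, hyP⟩ := exists_sdiv_sat_le [P] 1
    have hyP := hyP P (by simp)
    rw [pow_one] at hy
    have h1 : ∀ c ∈ 𝔪 ^ K * 𝔪 ^ K, ∀ a ∈ low (d + 1) (sat P), c • a ∈ sat P := by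
      intro c hc a ha
      refine mem_of_forall_mem_adj_pow hy fun n => ?_
      have h2 : sdiv (sat P) (y ^ (n + 1)) ≤ sat (sat P) :=
        (sdiv_pow_le hyP le_rfl _).trans (le_low _ _)
      have h3 := hK'.adj h2 hK'
      rw [← pow_add] at h3
      have h4 := ih _ r _ (by omega) h3 (low_succ_le_low_adj hyP (n + 1) ha)
      rw [← pow_add] at hc
      exact hc_zero_smul_iff.1 (h3 0 (by omega) c hc) a h4
    rw [← low_low_of_le (Nat.zero_le (d + 1)) P]
    refine (le_sat_of_pow (k := K + K) ?_).trans (low_low 0 P).le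
    rwa [pow_add]

theorem IsPar.sdiv_le {r K : ℕ} {P : Submodule A N} {x : A} (hx : IsPar r P x)
    (hK : HKill P (r + 1) (𝔪 ^ K)) : sdiv P x ≤ sat P :=
  ((sdiv_mono (le_low r P) x).trans (sdiv_low_le hx.2)).trans
    (low_le_sat_of_hKill r P (r + 1) K (Nat.lt_succ_self r) hK)

end LemmaAss

section Kills

variable {A : Type} [CommRing A] [IsLocalRing A] [IsNoetherianRing A]
  {N : Type} [AddCommGroup N] [Module A N] [Module.Finite A N]

local notation "𝔪" => maximalIdeal A

/-- `xs` is a d-sequence on `N ⧸ P`. -/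
def DSeq (P : Submodule A N) : List A → Prop
  | [] => True
  | x :: xs => (∀ y ∈ x :: xs, ∀ a : N, x • y • a ∈ P → y • a ∈ P) ∧ DSeq (adj P x) xs

/-- `xs` consists of parameters killing the relevant local cohomology at each stage. -/
def Kills (P : Submodule A N) : List A → Prop
  | [] => True
  | x :: xs => (∀ y ∈ x :: xs, sdiv P y ≤ sat P ∧ HKill P (xs.length + 1) (Ideal.span {y})) ∧
      Kills (adj P x) xs

theorem hKill_span_singleton {P : Submodule A N} {r : ℕ} {y : A} :
    HKill P r (Ideal.span {y}) ↔ ∀ i < r, ∀ h : Hc i P, y • h = 0 := by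
  constructor
  · exact fun h i hi => h i hi y (Ideal.mem_span_singleton_self y)
  · intro h i hi c hc z
    obtain ⟨b, rfl⟩ := Ideal.mem_span_singleton'.1 hc
    rw [mul_smul, h i hi, smul_zero]

theorem sdiv_sat_le {P : Submodule A N} {y : A} (h : sdiv P y ≤ sat P) :
    sdiv (sat P) y ≤ sat P := by
  intro a ha
  rw [sat, ← low_low 0 P]
  obtain ⟨k, hk⟩ := mem_sat.1 ha
  exact mem_sat.2 ⟨k, fun c hc => h (by rw [mem_sdiv, smul_comm]; exact hk c hc)⟩

theorem Kills.dSeq {P : Submodule A N} {xs : List A} (h : Kills P xs) : DSeq P xs := by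
  induction xs generalizing P with
  | nil => trivial
  | cons x xs ih =>
    refine ⟨fun y hy a ha => ?_, ih h.2⟩
    have h1 : y • a ∈ sat P := (h.1 x (by simp)).1 ha
    have h2 : a ∈ sat P := sdiv_sat_le (h.1 y hy).1 h1
    exact hc_zero_smul_iff.1 ((h.1 y hy).2 0 (by omega) y (Ideal.mem_span_singleton_self y)) a h2

theorem kills_of_deep (xs : List A) : ∀ (P : Submodule A N) (K : ℕ),
    HKill P xs.length (𝔪 ^ K) → Sop P xs → (∀ y ∈ xs, y ∈ 𝔪 ^ (2 ^ xs.length * K)) →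
    Kills P xs := by
  induction xs with
  | nil => exact fun _ _ _ _ _ => trivial
  | cons x xs ih =>
    intro P K hK hs hd
    have hpar : ∀ y ∈ x :: xs, sdiv P y ≤ sat P := by
      intro y hy
      obtain ⟨l, hl⟩ : ∃ l, (x :: xs).Perm (y :: l) := by
        classical
        exact ⟨_, List.perm_cons_erase hy⟩
      have hlen : l.length = xs.length := by simpa using hl.length_eq.symm
      have := (hs.perm hl).isPar
      rw [hlen] at this
      exact this.sdiv_le hK
    refine ⟨fun y hy => ⟨hpar y hy, hK.mono le_rfl ?_⟩, ih _ (K + K) ?_ hs.tail ?_⟩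
    · rw [Ideal.span_singleton_le_iff_mem]
      exact Ideal.pow_le_pow_right (Nat.le_mul_of_pos_left K (by positivity)) (hd y hy)
    · rw [pow_add]
      exact HKill.adj (hpar x (by simp)) hK hK
    · intro y hy
      have := hd y (by simp [hy])
      rw [List.length_cons, pow_succ, mul_assoc, two_mul] at this
      exact this

end Kills

section DeepSop

variable {A : Type} [CommRing A] [IsLocalRing A] [IsNoetherianRing A]
  {N : Type} [AddCommGroup N] [Module A N] [Module.Finite A N]

local notation "𝔪" => maximalIdeal A

theorem exists_pow_inf_sat_le_list (Ps : List (Submodule A N)) (k : ℕ) :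
    ∃ K ≥ k, ∀ P ∈ Ps, 𝔪 ^ K • (⊤ : Submodule A N) ⊓ sat P ≤ P := by
  induction Ps with
  | nil => exact ⟨k, le_rfl, by simp⟩
  | cons P Ps ih =>
    obtain ⟨K, hK, h⟩ := ih
    obtain ⟨K', hK'⟩ := exists_pow_inf_sat_le P
    refine ⟨K + K', by omega, fun P' hP' => ?_⟩
    rcases List.mem_cons.1 hP' with rfl | hP'
    · exact le_trans (inf_le_inf_right _ (Submodule.smul_mono_left
        (Ideal.pow_le_pow_right (by omega)))) hK'
    · exact le_trans (inf_le_inf_right _ (Submodule.smul_mono_left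
        (Ideal.pow_le_pow_right (by omega)))) (h P' hP')

theorem exists_deep (r : ℕ) : ∀ (k : ℕ) (Ps : List (Submodule A N)),
    (∀ P ∈ Ps, low r P = ⊤) → ∃ xs : List A, xs.length = r ∧ (∀ y ∈ xs, y ∈ 𝔪 ^ (k + 1)) ∧
      ∀ P ∈ Ps, DSeq P xs ∧ Sop P xs := by
  induction r with
  | zero => exact fun k Ps h => ⟨[], rfl, by simp, fun P hP => ⟨trivial, by simp, h P hP⟩⟩
  | succ r ih =>
    intro k Ps h
    obtain ⟨K, hK, hKP⟩ := exists_pow_inf_sat_le_list Ps (k + 1)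
    obtain ⟨x, hx, hxP⟩ := exists_sdiv_sat_le Ps K
    obtain ⟨xs, hlen, hdeep, hxs⟩ := ih K (Ps.map fun P => adj P x) (by
      intro P' hP'
      obtain ⟨P, hP, rfl⟩ := List.mem_map.1 hP'
      exact low_adj_eq_top (h P hP) ((sdiv_mono (le_low 0 P) x).trans
        ((hxP P hP).trans (low_mono_dim (Nat.zero_le r) P))))
    have hall : ∀ y ∈ x :: xs, y ∈ 𝔪 ^ K := by
      intro y hy
      rcases List.mem_cons.1 hy with rfl | hy
      · exact hx
      · exact Ideal.pow_le_pow_right (Nat.le_succ K) (hdeep y hy)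
    refine ⟨x :: xs, by simp [hlen], fun y hy => Ideal.pow_le_pow_right hK (hall y hy),
      fun P hP => ?_⟩
    obtain ⟨h1, h2⟩ := hxs (adj P x) (List.mem_map.2 ⟨P, hP, rfl⟩)
    refine ⟨⟨fun y hy a ha => hKP P hP ⟨?_, ?_⟩, h1⟩, fun y hy => ?_, h2.2⟩
    · exact Submodule.smul_mem_smul (hall y hy) trivial
    · exact hxP P hP (le_low 0 P ha)
    · exact Ideal.pow_le_self (by omega) (hall y hy)

theorem Sop.exists_pow_le {P : Submodule A N} {xs : List A} (h : Sop P xs) :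
    ∃ k, 𝔪 ^ k ≤ P.colon ((⊤ : Submodule A N) : Set N) ⊔ Ideal.ofList xs := by
  have h1 := h.2.ge
  rw [le_low_iff, adjs_eq] at h1
  rw [← iDimLE_zero_iff]
  intro p hp
  rw [sup_le_iff] at hp
  exact h1 p (colon_le_of_smul_sup p.2 hp.2 hp.1)

theorem Sop.mem_sat {P : Submodule A N} {xs : List A} (h : Sop P xs) {a : N}
    (ha : ∀ y ∈ xs, y • a ∈ P) : a ∈ sat P := by
  obtain ⟨k, hk⟩ := h.exists_pow_le
  refine _root_.mem_sat.2 ⟨k, fun c hc => ?_⟩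
  have h1 : P.colon ((⊤ : Submodule A N) : Set N) ⊔ Ideal.ofList xs ≤ P.colon {a} := by
    refine sup_le (Submodule.colon_mono le_rfl (by simp)) (Ideal.span_le.2 fun y hy => ?_)
    exact Submodule.mem_colon_singleton.2 (ha y hy)
  exact Submodule.mem_colon_singleton.1 (h1 (hk hc))

theorem DSeq.smul_mem {P : Submodule A N} {x : A} {xs : List A} (h : DSeq P (x :: xs))
    (hx : x ∈ 𝔪) {a : N} (ha : a ∈ sat P) : ∀ y ∈ x :: xs, y • a ∈ P := by
  obtain ⟨k, hk⟩ := _root_.mem_sat.1 ha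
  have h1 : x ^ (k + 1) • a ∈ P := by
    rw [pow_succ', mul_smul]
    exact P.smul_mem _ (hk _ (Ideal.pow_mem_pow hx k))
  have h2 : x • a ∈ P := by
    clear hk
    induction k with
    | zero => simpa using h1
    | succ k ih =>
      refine ih ?_
      rw [pow_succ', mul_smul] at h1 ⊢
      rw [pow_succ', mul_smul] at h1
      exact h.1 x (by simp) _ h1
  intro y hy
  refine h.1 y hy a ?_
  rw [smul_comm]
  exact P.smul_mem _ h2

theorem DSeq.sdiv_eq {P : Submodule A N} {x : A} {xs : List A} (h : DSeq P (x :: xs))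
    (hs : Sop P (x :: xs)) : sdiv P x = sat P := by
  refine le_antisymm (fun a ha => hs.mem_sat fun y hy => h.1 y hy a ?_)
    (fun a ha => h.smul_mem (hs.1 x (by simp)) ha x (by simp))
  rw [smul_comm]
  exact P.smul_mem _ ha

end DeepSop

section HLen

variable {A : Type} [CommRing A] [IsLocalRing A] [IsNoetherianRing A]
  {N : Type} [AddCommGroup N] [Module A N] [Module.Finite A N]

local notation "𝔪" => maximalIdeal A

/-- The length of the local cohomology. -/
noncomputable def hlen (i : ℕ) (P : Submodule A N) : ℕ∞ := Module.length A (Hc i P)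

theorem isFiniteLength_of_pow_smul {W : Type} [AddCommGroup W] [Module A W] [Module.Finite A W]
    {k : ℕ} (h : ∀ c ∈ 𝔪 ^ k, ∀ w : W, c • w = 0) : IsFiniteLength A W := by
  rw [isFiniteLength_iff_isNoetherian_isArtinian]
  refine ⟨isNoetherian_of_isNoetherianRing_of_finite A W, ?_⟩
  have hle : 𝔪 ^ k ≤ Module.annihilator A W :=
    fun c hc => Module.mem_annihilator.2 (h c hc)
  have hdim : Ring.KrullDimLE 0 (A ⧸ Module.annihilator A W) := by
    rw [Ring.KrullDimLE, Order.krullDimLE_iff]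
    exact iDimLE_iff_ringKrullDim.1 (iDimLE_zero_iff.2 ⟨k, hle⟩)
  let _ := Module.quotientAnnihilator (R := A) (M := W)
  have : IsArtinianRing (A ⧸ Module.annihilator A W) :=
    isArtinianRing_iff_isNoetherianRing_krullDimLE_zero.2 ⟨inferInstance, hdim⟩
  have : IsScalarTower A (A ⧸ Module.annihilator A W) W := ⟨fun a b w => by
    obtain ⟨b, rfl⟩ := Ideal.Quotient.mk_surjective b
    rw [Algebra.smul_def, mul_smul]
    rfl⟩
  have : Module.Finite (A ⧸ Module.annihilator A W) W :=
    Module.Finite.of_restrictScalars_finite A _ W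
  have : IsArtinian (A ⧸ Module.annihilator A W) W := isArtinian_of_fg_of_artinian' 
  exact isArtinian_of_surjective_algebraMap (S := A)
    (R := A ⧸ Module.annihilator A W) Ideal.Quotient.mk_surjective

theorem exists_pow_smul_of_length_le (C : ℕ) : ∀ {W : Type} [AddCommGroup W] [Module A W],
    Module.length A W ≤ C → ∀ c ∈ 𝔪 ^ C, ∀ w : W, c • w = 0 := by
  induction C with
  | zero =>
    intro W _ _ h c _ w
    have := Module.length_eq_zero_iff.1 (by simpa using h)
    exact Subsingleton.elim _ _
  | succ C ih =>
    intro W _ _ h c hc w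
    have hfl : IsFiniteLength A W := Module.length_ne_top_iff.1 (ne_top_of_le_ne_top (by simp) h)
    obtain ⟨h1, h2⟩ := isFiniteLength_iff_isNoetherian_isArtinian.1 hfl
    by_cases hW : Subsingleton W
    · exact Subsingleton.elim _ _
    rw [not_subsingleton_iff_nontrivial] at hW
    have hlt : 𝔪 • (⊤ : Submodule A W) ≠ ⊤ := by
      intro he
      have := Submodule.eq_bot_of_le_smul_of_le_jacobson_bot 𝔪 (⊤ : Submodule A W)
        (IsNoetherian.noetherian _) he.ge (maximalIdeal_le_jacobson _)
      exact absurd this top_ne_bot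
    have h3 : Module.length A (𝔪 • (⊤ : Submodule A W) : Submodule A W) ≤ C := by
      have := Submodule.length_lt (lt_top_iff_ne_top.2 hlt).ne
      exact Order.le_of_lt_add_one (this.trans_le (by exact_mod_cast h))
    rw [pow_succ] at hc
    refine Submodule.mul_induction_on hc (fun a ha b hb => ?_) (fun a b ha hb => ?_)
    · rw [mul_smul]
      exact congrArg Subtype.val (ih h3 a ha ⟨b • w, Submodule.smul_mem_smul hb trivial⟩)
    · rw [add_smul, ha, hb, add_zero]

theorem hlen_zero_ne_top (P : Submodule A N) : hlen 0 P ≠ ⊤ := by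
  obtain ⟨e⟩ := exists_hcZeroEquiv P
  obtain ⟨k, hk⟩ := exists_pow_le_colon (le_refl (sat P))
  rw [hlen, e.length_eq, Module.length_ne_top_iff]
  refine isFiniteLength_of_pow_smul (k := k) ?_
  rintro c hc ⟨w, a, ha, rfl⟩
  refine Subtype.ext ?_
  rw [Submodule.coe_smul, ZeroMemClass.coe_zero]
  simp only [← map_smul]
  rw [Submodule.mkQ_apply, Submodule.Quotient.mk_eq_zero]
  exact hk c hc a ha

theorem hlen_adj {P : Submodule A N} {x : A} (hx : sdiv P x ≤ sat P) {i : ℕ}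
    (h0 : ∀ h : Hc i P, x • h = 0) (h1 : ∀ h : Hc (i + 1) P, x • h = 0) :
    hlen i (adj P x) = hlen i P + hlen (i + 1) P := by
  obtain ⟨p, δ, hp, hpd, hd⟩ := exists_hc_les hx i
  refine Module.length_eq_add_of_exact p δ ?_ (fun h => (hd h).1 (h1 h)) hpd
  rw [injective_iff_map_eq_zero]
  intro h hh
  obtain ⟨h', rfl⟩ := (hp h).1 hh
  exact h0 h'

end HLen

section Chern

variable {A : Type} [CommRing A] [IsLocalRing A] [IsNoetherianRing A]
  {N : Type} [AddCommGroup N] [Module A N] [Module.Finite A N]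

local notation "𝔪" => maximalIdeal A

/-- The length of the local cohomology as an integer, zero if it is infinite. -/
noncomputable def hn (i : ℕ) (P : Submodule A N) : ℤ := ((hlen i P).toNat : ℤ)

theorem hn_nonneg (i : ℕ) (P : Submodule A N) : 0 ≤ hn i P := Int.natCast_nonneg _

/-- The coefficients of the Hilbert polynomial of a d-sequence in the basis `C(n+i, i)`. -/
noncomputable def cf (P : Submodule A N) : List A → ℕ → ℤ
  | [], i => if i = 0 then hn 0 P else 0
  | _ :: _, 0 => hn 0 P
  | x :: xs, 1 => cf (adj P x) xs 0 - hn 0 P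
  | x :: xs, i + 2 => cf (adj P x) xs (i + 1)

/-- The negative of the first Hilbert coefficient of a d-sequence. -/
noncomputable def E (P : Submodule A N) (xs : List A) : ℤ := cf P xs (xs.length - 1)

/-- The sum of the lengths of local cohomology modules with binomial weights. -/
noncomputable def Sg (s : ℕ) (P : Submodule A N) : ℤ :=
  ∑ i ∈ Finset.range (s + 1), (s.choose i : ℤ) * hn (i + 1) P

theorem cf_zero (P : Submodule A N) (xs : List A) : cf P xs 0 = hn 0 P := by
  cases xs <;> simp [cf]

theorem E_two (P : Submodule A N) (x y : A) : E P [x, y] = hn 0 (adj P x) - hn 0 P := by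
  simp [E, cf]

theorem E_cons (P : Submodule A N) (x : A) (xs : List A) (h : 2 ≤ xs.length) :
    E P (x :: xs) = E (adj P x) xs := by
  obtain ⟨n, hn⟩ : ∃ n, xs.length = n + 2 := ⟨xs.length - 2, by omega⟩
  simp [E, hn, cf]

theorem Kills.hlen_ne_top : ∀ {xs : List A} {P : Submodule A N}, Kills P xs → ∀ i < xs.length,
    hlen i P ≠ ⊤
  | [], _, _, i, hi => by simp at hi
  | x :: xs, P, _, 0, _ => hlen_zero_ne_top P
  | x :: xs, P, h, i + 1, hi => by
    have h1 := h.1 x (by simp)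
    rw [hKill_span_singleton] at h1
    simp only [List.length_cons] at hi
    have h2 := hlen_adj h1.1 (h1.2 i (by omega)) (h1.2 (i + 1) (by omega))
    have h3 := Kills.hlen_ne_top h.2 i (by omega)
    rw [h2] at h3
    exact fun h4 => h3 (by simp [h4])

theorem hn_add_of_hlen {i : ℕ} {P P' : Submodule A N} (h : hlen i P' = hlen i P + hlen (i + 1) P)
    (h0 : hlen i P' ≠ ⊤) : hn i P' = hn i P + hn (i + 1) P := by
  rw [h] at h0
  obtain ⟨h1, h2⟩ := WithTop.add_ne_top.1 h0
  rw [hn, hn, hn, h, ENat.toNat_add h1 h2, Nat.cast_add]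

theorem Kills.hn_adj {x : A} {xs : List A} {P : Submodule A N} (h : Kills P (x :: xs)) {i : ℕ}
    (hi : i < xs.length) : hn i (adj P x) = hn i P + hn (i + 1) P := by
  have h1 := h.1 x (by simp)
  rw [hKill_span_singleton] at h1
  exact hn_add_of_hlen (hlen_adj h1.1 (h1.2 i (by omega)) (h1.2 (i + 1) (by omega)))
    (h.2.hlen_ne_top i hi)

theorem Sg_succ_of_add {s : ℕ} {P P' : Submodule A N}
    (h : ∀ i ≤ s, hn (i + 1) P' = hn (i + 1) P + hn (i + 2) P) : Sg s P' = Sg (s + 1) P := by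
  have h1 : Sg s P' = ∑ i ∈ Finset.range (s + 1), ((s.choose i : ℤ) * hn (i + 1) P +
      (s.choose i : ℤ) * hn (i + 2) P) :=
    Finset.sum_congr rfl fun i hi => by
      rw [h i (by simpa [Nat.lt_succ_iff] using hi), mul_add]
  rw [h1, Finset.sum_add_distrib, Sg, Finset.sum_range_succ' _ (s + 1)]
  simp only [Nat.choose_succ_succ, Nat.cast_add, add_mul, Finset.sum_add_distrib]
  rw [Finset.sum_range_succ' _ s,
    Finset.sum_range_succ (fun i => ((s.choose (i + 1) : ℕ) : ℤ) * hn (i + 1 + 1) P) s]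
  simp
  ring

theorem Kills.E_eq (s : ℕ) : ∀ {xs : List A} {P : Submodule A N}, Kills P xs →
    xs.length = s + 2 → E P xs = Sg s P := by
  induction s with
  | zero =>
    rintro (_ | ⟨x, _ | ⟨y, _ | _⟩⟩) P h hs <;> simp at hs
    rw [E_two, h.hn_adj (i := 0) (by simp)]
    simp [Sg]
  | succ s ih =>
    rintro (_ | ⟨x, xs⟩) P h hs <;> simp at hs
    rw [E_cons _ _ _ (by omega), ih h.2 (by omega)]
    exact Sg_succ_of_add fun i hi => h.hn_adj (by omega)

theorem length_ker_of_dSeq {P : Submodule A N} {x : A} {xs : List A} (hx : x ∈ 𝔪)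
    (h : DSeq P (x :: xs)) (hs : Sop P (x :: xs)) :
    hlen 0 (adj P x) = hlen 0 P +
      Module.length A (LinearMap.ker (LinearMap.lsmul A (Hc 1 P) x)) := by
  have hsd := (h.sdiv_eq hs)
  obtain ⟨p, δ, hp, hpd, hd⟩ := exists_hc_les hsd.le 0
  have hk : ∀ z : Hc 0 P, x • z = 0 := by
    rw [hc_zero_smul_iff]
    exact fun a ha => h.smul_mem hx ha x (by simp)
  refine Module.length_eq_add_of_exact p (δ.codRestrict _ fun c => ?_) ?_ ?_ ?_
  · exact (hd _).2 ⟨c, rfl⟩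
  · rw [injective_iff_map_eq_zero]
    intro z hz
    obtain ⟨z', rfl⟩ := (hp z).1 hz
    exact hk z'
  · rintro ⟨z, hz⟩
    obtain ⟨c, hc⟩ := (hd z).1 hz
    exact ⟨c, Subtype.ext hc⟩
  · intro c
    rw [← hpd c]
    exact ⟨fun h => congrArg Subtype.val h, fun h => Subtype.ext h⟩

theorem E_two_eq {P : Submodule A N} {x y : A} (hx : x ∈ 𝔪)
    (h : DSeq P [x, y]) (hs : Sop P [x, y]) :
    Module.length A (LinearMap.ker (LinearMap.lsmul A (Hc 1 P) x)) ≠ ⊤ ∧ E P [x, y] =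
      (Module.length A (LinearMap.ker (LinearMap.lsmul A (Hc 1 P) x))).toNat := by
  have h1 := length_ker_of_dSeq hx h hs
  have h2 := hlen_zero_ne_top (adj P x)
  rw [h1] at h2
  obtain ⟨h3, h4⟩ := WithTop.add_ne_top.1 h2
  refine ⟨h4, ?_⟩
  rw [E_two, hn, hn, h1, ENat.toNat_add h3 h4]
  push_cast
  ring

end Chern

section HilbertFunction

variable {A : Type} [CommRing A] [IsLocalRing A] [IsNoetherianRing A]
  {N : Type} [AddCommGroup N] [Module A N] [Module.Finite A N]

local notation "𝔪" => maximalIdeal A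

/-- The filtration of `N ⧸ P` by powers of `Q`. -/
def fil (P : Submodule A N) (Q : Ideal A) (n : ℕ) : Submodule A N := P ⊔ Q ^ n • ⊤

theorem DSeq.of_append {P : Submodule A N} {l₁ l₂ : List A} (h : DSeq P (l₁ ++ l₂)) :
    DSeq (adjs P l₁) l₂ := by
  induction l₁ generalizing P with
  | nil => exact h
  | cons x l ih => exact ih h.2

theorem DSeq.mem_of_mem_adjs {P : Submodule A N} {xs : List A} (h : DSeq P xs) {a : N}
    (ha : a ∈ adjs P xs) (h' : ∀ z ∈ xs, z • a ∈ P) : a ∈ P := by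
  induction xs generalizing P with
  | nil => exact ha
  | cons x xs ih =>
    have h1 : a ∈ adj P x := ih h.2 ha fun z hz => le_adj P x (h' z (by simp [hz]))
    obtain ⟨b, hb⟩ := mem_adj.1 h1
    have h2 : x • x • b ∈ P := by
      have h3 := P.sub_mem (h' x (by simp)) (P.smul_mem x hb)
      rwa [smul_sub, sub_sub_cancel] at h3
    have h4 := P.add_mem hb (h.1 x (by simp) b h2)
    rwa [sub_add_cancel] at h4

theorem DSeq.mem_of_smul_mem {P : Submodule A N} {x : A} {xs : List A} (h : DSeq P (x :: xs))
    {a : N} (ha : a ∈ adjs P (x :: xs)) (h' : x • a ∈ P) : a ∈ P :=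
  h.mem_of_mem_adjs ha fun z hz => h.1 z hz a (by rw [smul_comm]; exact P.smul_mem z h')

theorem DSeq.inf_fil_le (l₂ : List A) : ∀ (P : Submodule A N) (l₁ : List A),
    DSeq P (l₁ ++ l₂) → ∀ n : ℕ, adjs P l₁ ⊓ fil P (Ideal.ofList (l₁ ++ l₂)) (n + 1) ≤
      P ⊔ Ideal.ofList l₁ • Ideal.ofList (l₁ ++ l₂) ^ n • ⊤ := by
  induction l₂ with
  | nil =>
    intro P l₁ _ n
    refine inf_le_right.trans ?_
    rw [fil, List.append_nil, pow_succ', mul_smul]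
  | cons y l₂ ih =>
    intro P l₁ hd n
    have ih' := ih P (l₁ ++ [y]) (by simpa using hd)
    simp only [List.append_assoc, List.singleton_append] at ih'
    set Q := Ideal.ofList (l₁ ++ y :: l₂)
    have hd' := hd.of_append
    induction n with
    | zero =>
      refine inf_le_left.trans ?_
      rw [adjs_eq, pow_zero, Ideal.one_eq_top, Submodule.top_smul]
    | succ n ihn =>
      rintro u ⟨hu, hu'⟩
      have hle : adjs P l₁ ≤ adjs P (l₁ ++ [y]) := by
        rw [adjs_append]
        exact le_adjs _ _
      have h1 := ih' (n + 1) ⟨hle hu, hu'⟩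
      rw [Ideal.ofList_append, Ideal.ofList_singleton, Submodule.sup_smul, ← sup_assoc,
        Submodule.ideal_span_singleton_smul] at h1
      obtain ⟨v, hv, w, hw, rfl⟩ := Submodule.mem_sup.1 h1
      obtain ⟨c, hc, rfl⟩ := Submodule.mem_smul_pointwise_iff_exists _ _ _ |>.1 hw
      refine Submodule.add_mem _ hv ?_
      have hv' : v ∈ adjs P l₁ := by
        rw [adjs_eq]
        refine sup_le_sup_left (Submodule.smul_mono le_rfl le_top) P hv
      have hyc : y • c ∈ adjs P l₁ := (Submodule.add_mem_iff_right _ hv').1 hu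
      have hc1 : c ∈ adjs P l₁ := by
        refine hd'.mem_of_smul_mem ?_ hyc
        rw [← adjs_append, adjs_eq]
        refine Submodule.mem_sup_right ?_
        rw [pow_succ', mul_smul] at hc
        exact Submodule.smul_mono le_rfl le_top hc
      have hc2 := ihn ⟨hc1, Submodule.mem_sup_right hc⟩
      have hyQ : y ∈ Q := Ideal.subset_span (by simp)
      obtain ⟨p, hp, t, ht, hpt⟩ := Submodule.mem_sup.1 hc2
      rw [← hpt, smul_add]
      refine Submodule.add_mem_sup (P.smul_mem y hp) ?_
      rw [pow_succ', mul_smul, ← mul_smul, mul_comm, mul_smul]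
      exact Submodule.smul_mem_smul hyQ ht

theorem fil_adj (P : Submodule A N) (x : A) (xs : List A) (n : ℕ) :
    fil P (Ideal.ofList (x :: xs)) n ⊔ Ideal.span {x} • ⊤ = fil (adj P x) (Ideal.ofList xs) n := by
  refine le_antisymm (sup_le (sup_le ?_ ?_) ?_) (sup_le (sup_le ?_ ?_) ?_)
  · exact (le_adj P x).trans le_sup_left
  · induction n with
    | zero => simp [fil]
    | succ n ih =>
      rw [pow_succ', mul_smul, Ideal.ofList_cons, Submodule.sup_smul]
      refine sup_le ((Submodule.smul_mono le_rfl le_top).trans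
        (le_sup_right.trans le_sup_left)) ?_
      rw [Ideal.ofList_cons] at ih
      refine (Submodule.smul_mono le_rfl ih).trans ?_
      rw [fil, Submodule.smul_sup, ← mul_smul, ← pow_succ']
      exact sup_le_sup_right Submodule.smul_le_right _
  · exact le_sup_right.trans le_sup_left
  · exact le_sup_left.trans le_sup_left
  · exact le_sup_right
  · refine le_trans (Submodule.smul_mono_left (Ideal.pow_right_mono ?_ n))
      (le_sup_right.trans le_sup_left)
    rw [Ideal.ofList_cons]
    exact le_sup_right

theorem DSeq.smul_mem_fil_iff {P : Submodule A N} {x : A} {xs : List A} (h : DSeq P (x :: xs))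
    (n : ℕ) {a : N} : x • a ∈ fil P (Ideal.ofList (x :: xs)) (n + 1) ↔
      a ∈ fil (sdiv P x) (Ideal.ofList (x :: xs)) n := by
  constructor
  · intro ha
    have h1 := DSeq.inf_fil_le xs P [x] h n ⟨smul_mem_adj P x a, ha⟩
    rw [Ideal.ofList_singleton, Submodule.ideal_span_singleton_smul] at h1
    obtain ⟨p, hp, w, hw, hpw⟩ := Submodule.mem_sup.1 h1
    obtain ⟨c, hc, rfl⟩ := Submodule.mem_smul_pointwise_iff_exists _ _ _ |>.1 hw
    rw [← sub_add_cancel a c]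
    refine Submodule.add_mem_sup ?_ hc
    rw [mem_sdiv, smul_sub, ← hpw, add_sub_cancel_right]
    exact hp
  · intro ha
    obtain ⟨p, hp, w, hw, rfl⟩ := Submodule.mem_sup.1 ha
    rw [smul_add]
    refine Submodule.add_mem_sup hp ?_
    rw [pow_succ', mul_smul]
    exact Submodule.smul_mem_smul (Ideal.subset_span (by simp)) hw

theorem length_quotient_adj (F F' F'' : Submodule A N) (x : A)
    (h : F'' = F ⊔ Ideal.span {x} • ⊤) (h' : ∀ a, x • a ∈ F ↔ a ∈ F') :
    Module.length A (N ⧸ F) = Module.length A (N ⧸ F') + Module.length A (N ⧸ F'') := by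
  have hF : F ≤ F'' := h ▸ le_sup_left
  let f : N ⧸ F' →ₗ[A] N ⧸ F := F'.mapQ F (LinearMap.lsmul A N x) fun a ha => (h' a).2 ha
  refine Module.length_eq_add_of_exact f (Submodule.factor hF) ?_
    (Submodule.factor_surjective hF) ?_
  · rw [injective_iff_map_eq_zero]
    intro z hz
    obtain ⟨a, rfl⟩ := Submodule.Quotient.mk_surjective _ z
    rw [Submodule.Quotient.mk_eq_zero, ← h']
    exact (Submodule.Quotient.mk_eq_zero F).1 hz
  · intro z
    obtain ⟨a, rfl⟩ := Submodule.Quotient.mk_surjective _ z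
    have h1 : Submodule.factor hF (Submodule.Quotient.mk a) = 0 ↔ a ∈ F'' :=
      Submodule.Quotient.mk_eq_zero F''
    rw [h1, h]
    constructor
    · intro h2
      obtain ⟨b, hb⟩ := (mem_adj (P := F)).1 h2
      exact ⟨Submodule.Quotient.mk b, ((Submodule.Quotient.eq F).2 hb).symm⟩
    · rintro ⟨b, hb⟩
      obtain ⟨b, rfl⟩ := Submodule.Quotient.mk_surjective _ b
      exact (mem_adj (P := F)).2 ⟨b, (Submodule.Quotient.eq F).1 hb.symm⟩

theorem length_quotient_sup (P F W : Submodule A N) (h : W ⊓ F = P) :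
    Module.length A (N ⧸ F) = Module.length A (W.map P.mkQ) + Module.length A (N ⧸ (W ⊔ F)) := by
  have hF : F ≤ W ⊔ F := le_sup_right
  have hPF : P ≤ F := h ▸ inf_le_right
  let f : W.map P.mkQ →ₗ[A] N ⧸ F := (Submodule.factor hPF).comp (Submodule.subtype _)
  refine Module.length_eq_add_of_exact f (Submodule.factor hF) ?_
    (Submodule.factor_surjective hF) ?_
  · rw [injective_iff_map_eq_zero]
    rintro ⟨_, a, ha, rfl⟩ hz
    refine Subtype.ext ((Submodule.Quotient.mk_eq_zero P).2 ?_)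
    rw [← h]
    exact ⟨ha, (Submodule.Quotient.mk_eq_zero F).1 hz⟩
  · intro z
    obtain ⟨a, rfl⟩ := Submodule.Quotient.mk_surjective _ z
    have h1 : Submodule.factor hF (Submodule.Quotient.mk a) = 0 ↔ a ∈ W ⊔ F :=
      Submodule.Quotient.mk_eq_zero _
    rw [h1]
    constructor
    · intro h2
      obtain ⟨b, hb, c, hc, rfl⟩ := Submodule.mem_sup.1 h2
      refine ⟨⟨_, b, hb, rfl⟩, ((Submodule.Quotient.eq F).2 ?_)⟩
      rw [LinearMap.id_apply, sub_add_cancel_left]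
      exact F.neg_mem hc
    · rintro ⟨⟨_, b, hb, rfl⟩, hb'⟩
      have h2 : b - a ∈ F := (Submodule.Quotient.eq F).1 hb'
      have h3 := Submodule.sub_mem _ (Submodule.mem_sup_left hb : b ∈ W ⊔ F)
        (Submodule.mem_sup_right h2)
      rwa [sub_sub_cancel] at h3

theorem DSeq.length_fil {P : Submodule A N} {x : A} {xs : List A} (h : DSeq P (x :: xs))
    (hs : Sop P (x :: xs)) (n : ℕ) :
    Module.length A (N ⧸ fil P (Ideal.ofList (x :: xs)) (n + 2)) + hlen 0 P =
      Module.length A (N ⧸ fil P (Ideal.ofList (x :: xs)) (n + 1)) +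
      Module.length A (N ⧸ fil (adj P x) (Ideal.ofList xs) (n + 2)) := by
  set Q := Ideal.ofList (x :: xs)
  have h1 := length_quotient_adj (fil P Q (n + 2)) (fil (sdiv P x) Q (n + 1)) _ x
    (fil_adj P x xs (n + 2)).symm fun a => h.smul_mem_fil_iff (n + 1)
  have hsup : fil (sdiv P x) Q (n + 1) = sdiv P x ⊔ fil P Q (n + 1) := by
    rw [fil, fil, ← sup_assoc, sup_eq_left.2 (le_sdiv P x)]
  have h2 := length_quotient_sup P (fil P Q (n + 1)) (sdiv P x) (by
    refine le_antisymm ?_ (le_inf (le_sdiv P x) le_sup_left)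
    rintro a ⟨ha, ha'⟩
    refine h.mem_of_smul_mem ?_ ha
    rw [adjs_eq]
    refine sup_le_sup_left ?_ P ha'
    rw [pow_succ', mul_smul]
    exact Submodule.smul_mono le_rfl le_top)
  obtain ⟨e⟩ := exists_hcZeroEquiv P
  rw [h.sdiv_eq hs, ← e.length_eq, ← h.sdiv_eq hs] at h2
  rw [h1, h2, hsup, hlen]
  abel

theorem DSeq.length_fil_one {P : Submodule A N} {x : A} {xs : List A} :
    Module.length A (N ⧸ fil P (Ideal.ofList (x :: xs)) 1) =
      Module.length A (N ⧸ fil (adj P x) (Ideal.ofList xs) 1) := by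
  rw [← fil_adj, sup_eq_left.2]
  rw [fil, pow_one, Ideal.ofList_cons, Submodule.sup_smul]
  exact le_sup_left.trans le_sup_right

end HilbertFunction

section Binomial

/-- The numerical polynomial with coefficients `c` in the basis `C(n+i, i)`. -/
def numPoly (r : ℕ) (c : ℕ → ℤ) (n : ℕ) : ℤ :=
  ∑ i ∈ Finset.range (r + 1), c i * ((n + i).choose i : ℤ)

theorem numPoly_succ (r : ℕ) (c : ℕ → ℤ) (n : ℕ) :
    numPoly (r + 1) c n = numPoly r c n + c (r + 1) * ((n + (r + 1)).choose (r + 1) : ℤ) :=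
  Finset.sum_range_succ _ _

theorem numPoly_diff (r : ℕ) (c : ℕ → ℤ) (n : ℕ) :
    numPoly (r + 1) c (n + 1) = numPoly (r + 1) c n + numPoly r (fun i => c (i + 1)) (n + 1) := by
  have h1 : ∑ i ∈ Finset.range (r + 1), c (i + 1) * ((n + 1 + (i + 1)).choose (i + 1) : ℤ) =
      ∑ i ∈ Finset.range (r + 1), c (i + 1) * ((n + (i + 1)).choose (i + 1) : ℤ) +
      ∑ i ∈ Finset.range (r + 1), c (i + 1) * ((n + 1 + i).choose i : ℤ) := by
    rw [← Finset.sum_add_distrib]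
    refine Finset.sum_congr rfl fun i _ => ?_
    rw [← mul_add, ← Nat.cast_add, show n + 1 + (i + 1) = (n + 1 + i) + 1 by ring,
      Nat.choose_succ_succ, show n + (i + 1) = n + 1 + i by ring, add_comm ((n + 1 + i).choose i)]
  simp only [numPoly]
  rw [Finset.sum_range_succ' _ (r + 1), Finset.sum_range_succ' _ (r + 1), h1]
  simp only [add_zero, Nat.choose_zero_right]
  ring

theorem numPoly_zero_right (r : ℕ) (c : ℕ → ℤ) :
    numPoly r c 0 = ∑ i ∈ Finset.range (r + 1), c i := by
  simp [numPoly]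

theorem choose_add_le (n i : ℕ) : (n + i).choose i ≤ (n + 1) ^ i := by
  induction i with
  | zero => simp
  | succ i ih =>
    have h1 := Nat.add_one_mul_choose_eq (n + i) i
    have h2 : (n + i + 1) ≤ (n + 1) * (i + 1) := by nlinarith
    have h3 : (n + i + 1).choose (i + 1) * (i + 1) ≤ (n + 1) ^ (i + 1) * (i + 1) := by
      rw [← h1]
      calc (n + i + 1) * (n + i).choose i ≤ ((n + 1) * (i + 1)) * (n + 1) ^ i := by gcongr
        _ = _ := by ring
    exact Nat.le_of_mul_le_mul_right h3 (Nat.succ_pos i)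

theorem pow_le_factorial_mul_choose (n i : ℕ) : (n + 1) ^ i ≤ i.factorial * (n + i).choose i := by
  rw [← Nat.ascFactorial_eq_factorial_mul_choose]
  exact Nat.pow_succ_le_ascFactorial (n + 1) i

theorem exists_abs_numPoly_le (r : ℕ) (c : ℕ → ℤ) :
    ∃ B : ℕ, ∀ n, |numPoly r c n| ≤ B * ((n : ℤ) + 1) ^ r := by
  refine ⟨∑ i ∈ Finset.range (r + 1), (c i).natAbs, fun n => ?_⟩
  push_cast
  rw [Finset.sum_mul]
  refine (Finset.abs_sum_le_sum_abs _ _).trans (Finset.sum_le_sum fun i hi => ?_)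
  rw [abs_mul, Nat.abs_cast]
  refine mul_le_mul_of_nonneg_left ?_ (abs_nonneg _)
  refine le_trans (b := ((n : ℤ) + 1) ^ i) (by exact_mod_cast choose_add_le n i) ?_
  exact pow_le_pow_right₀ (by omega) (by simpa [Nat.lt_succ_iff] using hi)

theorem numPoly_top_eq_zero {r s B N₀ : ℕ} {c : ℕ → ℤ} (hs : s ≤ r)
    (h : ∀ n ≥ N₀, |numPoly (r + 1) c n| ≤ B * ((n : ℤ) + 1) ^ s) : c (r + 1) = 0 := by
  obtain ⟨B', hB'⟩ := exists_abs_numPoly_le r c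
  by_contra hc
  set n := N₀ + (r + 1).factorial * (B + B')
  have h1 := h n (by simp [n])
  rw [numPoly_succ] at h1
  have h2 : |c (r + 1)| * ((n + (r + 1)).choose (r + 1) : ℤ) ≤ (B + B') * ((n : ℤ) + 1) ^ r := by
    have h3 : |c (r + 1) * ((n + (r + 1)).choose (r + 1) : ℤ)| ≤
        |numPoly r c n + c (r + 1) * ((n + (r + 1)).choose (r + 1) : ℤ)| + |numPoly r c n| := by
      have := abs_sub (numPoly r c n + c (r + 1) * ((n + (r + 1)).choose (r + 1) : ℤ))
        (numPoly r c n)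
      rwa [add_sub_cancel_left] at this
    rw [abs_mul, Nat.abs_cast] at h3
    have h4 : (B : ℤ) * ((n : ℤ) + 1) ^ s ≤ B * ((n : ℤ) + 1) ^ r :=
      mul_le_mul_of_nonneg_left (pow_le_pow_right₀ (by omega) hs) (by positivity)
    linarith [hB' n]
  have h5 : ((n + (r + 1)).choose (r + 1) : ℤ) ≤
      |c (r + 1)| * ((n + (r + 1)).choose (r + 1) : ℤ) :=
    le_mul_of_one_le_left (by positivity) (Int.one_le_abs hc)
  have h6 : ((n : ℤ) + 1) ^ (r + 1) ≤
      (r + 1).factorial * ((n + (r + 1)).choose (r + 1) : ℤ) := by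
    exact_mod_cast pow_le_factorial_mul_choose n (r + 1)
  have h7 : ((n : ℤ) + 1) ^ (r + 1) ≤ (r + 1).factorial * ((B + B') * ((n : ℤ) + 1) ^ r) :=
    h6.trans (mul_le_mul_of_nonneg_left (h5.trans h2) (by positivity))
  have h8 : ((n : ℤ) + 1) * ((n : ℤ) + 1) ^ r ≤
      ((r + 1).factorial * (B + B')) * ((n : ℤ) + 1) ^ r := by
    rw [pow_succ] at h7
    linarith
  have h9 := le_of_mul_le_mul_right h8 (by positivity)
  have h10 : (n : ℤ) = N₀ + (r + 1).factorial * (B + B') := by simp [n]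
  linarith [Int.natCast_nonneg N₀]

theorem numPoly_coeff_eq_zero {r s B N₀ : ℕ} {c : ℕ → ℤ}
    (h : ∀ n ≥ N₀, |numPoly r c n| ≤ B * ((n : ℤ) + 1) ^ s) (i : ℕ) (hi : s < i) (hir : i ≤ r) :
    c i = 0 := by
  induction r with
  | zero => omega
  | succ r ih =>
    have h1 := numPoly_top_eq_zero (by omega) h
    rcases hir.eq_or_lt with rfl | hir
    · exact h1
    · refine ih (fun n hn => ?_) (by omega)
      have := h n hn
      rwa [numPoly_succ, h1, zero_mul, add_zero] at this

theorem numPoly_sub (r : ℕ) (c c' : ℕ → ℤ) (n : ℕ) :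
    numPoly r c n - numPoly r c' n = numPoly r (fun i => c i - c' i) n := by
  simp only [numPoly, ← Finset.sum_sub_distrib, sub_mul]

end Binomial

section HilbertPolynomial

variable {A : Type} [CommRing A] [IsLocalRing A] [IsNoetherianRing A]
  {N : Type} [AddCommGroup N] [Module A N] [Module.Finite A N]

local notation "𝔪" => maximalIdeal A

/-- The Hilbert function agrees for large arguments with a numerical polynomial. -/
def HP (P : Submodule A N) (Q : Ideal A) (r : ℕ) (c : ℕ → ℤ) : Prop :=
  ∃ N₀ : ℕ, ∀ n ≥ N₀, ∃ l : ℕ, Module.length A (N ⧸ fil P Q (n + 1)) = l ∧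
    (l : ℤ) = numPoly r c n

theorem DSeq.length_fil_eq {xs : List A} : ∀ {P : Submodule A N}, DSeq P xs → Sop P xs →
    ∀ n : ℕ, ∃ l : ℕ, Module.length A (N ⧸ fil P (Ideal.ofList xs) (n + 1)) = l ∧
      (l : ℤ) = numPoly xs.length (cf P xs) n := by
  induction xs with
  | nil =>
    intro P _ hs n
    obtain ⟨e⟩ := exists_hcZeroEquiv P
    have hf : fil P (Ideal.ofList []) (n + 1) = P := by simp [fil]
    have h1 : hlen 0 P = Module.length A (N ⧸ P) := by
      have h2 : sat P = ⊤ := hs.2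
      rw [hlen, e.length_eq, h2, Submodule.map_top, Submodule.range_mkQ]
      exact Submodule.topEquiv.length_eq
    obtain ⟨l, hl⟩ := ENat.ne_top_iff_exists.1 (hlen_zero_ne_top P)
    refine ⟨l, by rw [hf, ← h1, hl], ?_⟩
    simp [numPoly, cf, hn, ← hl]
  | cons x xs ih =>
    intro P h hs n
    obtain ⟨h0, hh0⟩ := ENat.ne_top_iff_exists.1 (hlen_zero_ne_top P)
    have hhn : hn 0 P = h0 := by simp [hn, ← hh0]
    have hcf : (fun i => cf P (x :: xs) (i + 1)) =
        fun i => cf (adj P x) xs i - if i = 0 then (h0 : ℤ) else 0 := by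
      funext i
      cases i <;> simp [cf, hhn]
    induction n with
    | zero =>
      obtain ⟨l, hl, hl'⟩ := ih h.2 hs.tail 0
      refine ⟨l, by rw [zero_add, DSeq.length_fil_one]; exact hl, ?_⟩
      rw [hl', numPoly_zero_right, numPoly_zero_right, List.length_cons,
        Finset.sum_range_succ' _ (xs.length + 1), cf_zero, hhn,
        Finset.sum_congr rfl fun i _ => congrFun hcf i, Finset.sum_sub_distrib]
      simp
    | succ n ihn =>
      obtain ⟨l₁, hl₁, hl₁'⟩ := ihn
      obtain ⟨l₂, hl₂, hl₂'⟩ := ih h.2 hs.tail (n + 1)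
      have h1 := h.length_fil hs n
      rw [hl₁, hl₂, ← hh0] at h1
      have h2 : Module.length A (N ⧸ fil P (Ideal.ofList (x :: xs)) (n + 2)) ≠ ⊤ := by
        intro h3
        rw [h3, top_add] at h1
        exact absurd h1 (by rw [← Nat.cast_add]; exact ENat.top_ne_natCast _)
      obtain ⟨l, hl⟩ := ENat.ne_top_iff_exists.1 h2
      refine ⟨l, hl.symm, ?_⟩
      rw [← hl] at h1
      have h4 : l + h0 = l₁ + l₂ := by exact_mod_cast h1
      rw [List.length_cons, numPoly_diff, hcf, ← List.length_cons (a := x), ← hl₁',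
        ← numPoly_sub, ← hl₂']
      have h5 : numPoly xs.length (fun i => if i = 0 then (h0 : ℤ) else 0) (n + 1) = h0 := by
        rw [numPoly, Finset.sum_range_succ', Finset.sum_eq_zero] <;> simp
      rw [h5]
      have h6 : (l : ℤ) + h0 = l₁ + l₂ := by exact_mod_cast h4
      linarith

theorem DSeq.hP {P : Submodule A N} {xs : List A} (h : DSeq P xs) (hs : Sop P xs) :
    HP P (Ideal.ofList xs) xs.length (cf P xs) := ⟨0, fun n _ => h.length_fil_eq hs n⟩

end HilbertPolynomial

section Comparison

variable {A : Type} [CommRing A] [IsLocalRing A] [IsNoetherianRing A]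
  {N : Type} [AddCommGroup N] [Module A N] [Module.Finite A N]

local notation "𝔪" => maximalIdeal A

theorem not_le_of_mem_assP_low {P : Submodule A N} {I : Ideal A}
    (h : sat (P ⊔ I • ⊤) = ⊤) {d : ℕ} {p : Ideal A} (hp : p ∈ assP (low d P)) : ¬ I ≤ p := by
  intro hI
  have h1 : P.colon ((⊤ : Submodule A N) : Set N) ≤ p := by
    rw [hp.2.choose_spec]
    exact Submodule.colon_mono (le_low d P) (by simp)
  have h2 := colon_le_of_smul_sup hp.1 hI h1
  have h3 := h.ge
  rw [le_low_iff] at h3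
  obtain ⟨k, hk⟩ := iDimLE_zero_iff.1 h3
  exact pow_not_le_of_mem_assP_low hp (hk.trans h2)

theorem exists_sop_mem (s : ℕ) : ∀ {P : Submodule A N} {I : Ideal A}, I ≤ 𝔪 →
    sat (P ⊔ I • ⊤) = ⊤ → low s P = ⊤ →
    ∃ ys : List A, ys.length = s ∧ (∀ y ∈ ys, y ∈ I) ∧ Sop P ys := by
  induction s with
  | zero => exact fun _ _ h => ⟨[], rfl, by simp, by simp, h⟩
  | succ s ih =>
    intro P I hI hs hP
    obtain ⟨y, hy, hyP⟩ := exists_avoid (I := I) [(s, P)] (by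
      intro x hx p hp
      rw [List.mem_singleton] at hx
      subst hx
      exact not_le_of_mem_assP_low hs hp)
    have h1 : low s (adj P y) = ⊤ :=
      low_adj_eq_top hP ((sdiv_mono (le_low s P) y).trans (hyP (s, P) (by simp)))
    obtain ⟨ys, h2, h3, h4⟩ := ih (P := adj P y) hI
      (top_le_iff.1 (hs.ge.trans (low_mono (sup_le_sup_right (le_adj P y) _)))) h1
    refine ⟨y :: ys, by simp [h2], ?_, ?_, h4.2⟩
    · simpa using ⟨hy, h3⟩
    · simpa using ⟨hI hy, h4.1⟩

theorem length_quotient_le {F F' : Submodule A N} (h : F ≤ F') :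
    Module.length A (N ⧸ F') ≤ Module.length A (N ⧸ F) :=
  Module.length_le_of_surjective (Submodule.factor h) (Submodule.factor_surjective h)

theorem length_adj_pow_le (P : Submodule A N) (y : A) (n : ℕ) :
    Module.length A (N ⧸ adj P (y ^ n)) ≤ n * Module.length A (N ⧸ adj P y) := by
  induction n with
  | zero =>
    have h1 : adj P (y ^ 0) = ⊤ := by simp [adj]
    rw [h1]
    rw [Module.length_eq_zero]
    simp
  | succ n ih =>
    have h1 := length_quotient_adj (adj P (y ^ (n + 1))) (sdiv (adj P (y ^ (n + 1))) y) _ y rfl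
      fun a => mem_sdiv.symm
    rw [h1, Nat.cast_succ, add_mul, one_mul]
    refine add_le_add (le_trans (length_quotient_le fun a ha => ?_) ih)
      (length_quotient_le (sup_le_sup_right (le_adj _ _) _))
    obtain ⟨b, hb⟩ := mem_adj.1 ha
    refine mem_sdiv.2 (mem_adj.2 ⟨b, ?_⟩)
    rw [pow_succ', mul_smul, ← smul_sub]
    exact P.smul_mem y hb

theorem length_adjs_pow_le (n : ℕ) (ys : List A) : ∀ P : Submodule A N,
    Module.length A (N ⧸ adjs P (ys.map (· ^ n))) ≤
      (n : ℕ∞) ^ ys.length * Module.length A (N ⧸ adjs P ys) := by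
  induction ys with
  | nil => exact fun P => by rw [List.map_nil, List.length_nil, pow_zero, one_mul]
  | cons y ys ih =>
    intro P
    rw [List.map_cons, adjs_cons]
    refine (ih _).trans ?_
    have h1 : adjs (adj P (y ^ n)) ys = adj (adjs P ys) (y ^ n) := by
      rw [← adjs_cons, adjs_perm P (List.perm_append_singleton (y ^ n) ys).symm, adjs_append]
      rfl
    have h2 : adjs P (y :: ys) = adj (adjs P ys) y := by
      rw [adjs_perm P (List.perm_append_singleton y ys).symm, adjs_append]
      rfl
    rw [h1, h2, List.length_cons, pow_succ, mul_assoc]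
    exact mul_le_mul_right (length_adj_pow_le _ _ _) _

theorem exists_length_fil_le {s : ℕ} {P : Submodule A N} {I : Ideal A} (hI : I ≤ 𝔪)
    (hs : sat (P ⊔ I • ⊤) = ⊤) (hP : low s P = ⊤) :
    ∃ B : ℕ, ∀ n : ℕ, Module.length A (N ⧸ fil P I n) ≤ (B : ℕ∞) * (n : ℕ∞) ^ s := by
  obtain ⟨ys, rfl, hyI, hys⟩ := exists_sop_mem s hI hs hP
  have hfl : Module.length A (N ⧸ adjs P ys) ≠ ⊤ := by
    obtain ⟨e⟩ := exists_hcZeroEquiv (adjs P ys)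
    have h1 := hlen_zero_ne_top (adjs P ys)
    rw [hlen, e.length_eq, hys.2, Submodule.map_top, Submodule.range_mkQ] at h1
    rwa [← (Submodule.topEquiv (R := A) (M := N ⧸ adjs P ys)).length_eq]
  obtain ⟨B, hB⟩ := ENat.ne_top_iff_exists.1 hfl
  refine ⟨B, fun n => ?_⟩
  rw [mul_comm, hB]
  refine (length_quotient_le ?_).trans (length_adjs_pow_le n ys P)
  rw [adjs_eq]
  refine sup_le_sup_left (Submodule.smul_mono_left (Ideal.span_le.2 fun z hz => ?_)) P
  obtain ⟨y, hy, rfl⟩ := List.mem_map.1 hz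
  exact Ideal.pow_mem_pow (hyI y hy) n

theorem length_fil_le (P U : Submodule A N) (I : Ideal A) (n : ℕ) :
    Module.length A (N ⧸ fil P I n) ≤
      Module.length A (U ⧸ fil (P.comap U.subtype) I n) + Module.length A (N ⧸ fil U I n) := by
  set F := fil P I n
  have h1 := length_quotient_sup (U ⊓ F) F U rfl
  rw [h1]
  refine add_le_add ?_ (length_quotient_le (sup_le le_sup_left
    (le_sup_right.trans le_sup_right)))
  let g : U →ₗ[A] U.map (U ⊓ F).mkQ := (U ⊓ F).mkQ.submoduleMap U
  have hg : fil (P.comap U.subtype) I n ≤ LinearMap.ker g := by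
    have h2 : (fil (P.comap U.subtype) I n).map U.subtype ≤ F := by
      rw [fil, Submodule.map_sup, Submodule.map_smul'']
      exact sup_le_sup (Submodule.map_comap_le _ _) (Submodule.smul_mono le_rfl le_top)
    intro a ha
    rw [LinearMap.mem_ker]
    refine Subtype.ext ((Submodule.Quotient.mk_eq_zero _).2 ⟨a.2, ?_⟩)
    exact h2 (Submodule.mem_map_of_mem ha)
  refine Module.length_le_of_surjective (Submodule.liftQ _ g hg) ?_
  intro z
  obtain ⟨a, rfl⟩ := (U ⊓ F).mkQ.submoduleMap_surjective U z
  exact ⟨Submodule.Quotient.mk a, rfl⟩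

theorem HP.coeff_eq {P U : Submodule A N} {Q : Ideal A} {r s : ℕ} {c c' : ℕ → ℤ} (hQ : Q ≤ 𝔪)
    (hs : sat (P ⊔ Q • ⊤) = ⊤) (hPU : P ≤ U) (hU : U ≤ low s P) (h : HP P Q r c)
    (h' : HP U Q r c') (i : ℕ) (hi : s < i) (hir : i ≤ r) : c i = c' i := by
  set P' := P.comap U.subtype
  obtain ⟨B, hB⟩ := exists_length_fil_le (s := s) (P := P') hQ (by
    rw [eq_top_iff, le_low_iff]
    intro p hp
    have h1 : P'.colon ((⊤ : Submodule A U) : Set U) ≤ p.asIdeal :=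
      (Submodule.colon_mono le_sup_left subset_rfl).trans hp
    have h2 : Q ≤ p.asIdeal := fun c hc => hp (Submodule.mem_colon.2 fun a _ =>
      Submodule.mem_sup_right (Submodule.smul_mem_smul hc trivial))
    refine le_low_iff.1 hs.ge p (colon_le_of_smul_sup p.2 h2 (le_trans (fun c hc => ?_) h1))
    exact Submodule.mem_colon.2 fun a _ => Submodule.mem_colon.1 hc a.1 trivial) (by
    refine top_le_iff.1 fun a _ => IDimLE.mono (hU a.2) fun c hc => ?_
    exact Submodule.mem_colon_singleton.2 (Submodule.mem_colon_singleton.1 hc :))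
  obtain ⟨n₁, h1⟩ := h
  obtain ⟨n₂, h2⟩ := h'
  rw [← sub_eq_zero]
  refine numPoly_coeff_eq_zero (r := r) (s := s) (B := B) (N₀ := n₁ + n₂)
    (c := fun i => c i - c' i) (fun n hn => ?_) i hi hir
  obtain ⟨l₁, hl₁, hl₁'⟩ := h1 n (by omega)
  obtain ⟨l₂, hl₂, hl₂'⟩ := h2 n (by omega)
  rw [← numPoly_sub, ← hl₁', ← hl₂']
  have h3 := (length_fil_le P U Q (n + 1)).trans (add_le_add_left (hB (n + 1)) _)
  have h4 := length_quotient_le (sup_le_sup_right hPU (Q ^ (n + 1) • ⊤))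
  change Module.length A (N ⧸ fil U Q (n + 1)) ≤ Module.length A (N ⧸ fil P Q (n + 1)) at h4
  rw [hl₁, hl₂] at h3 h4
  have h5 : l₁ ≤ B * (n + 1) ^ s + l₂ := by exact_mod_cast h3
  have h6 : l₂ ≤ l₁ := by exact_mod_cast h4
  have h7 : (l₁ : ℤ) ≤ B * (n + 1) ^ s + l₂ := by exact_mod_cast h5
  rw [abs_of_nonneg (by omega)]
  linarith

end Comparison

section Standard

variable {A : Type} [CommRing A] [IsLocalRing A] [IsNoetherianRing A]
  {N : Type} [AddCommGroup N] [Module A N] [Module.Finite A N]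

local notation "𝔪" => maximalIdeal A

/-- All positive powers of the elements of `xs`, in any order, are d-sequences on `N ⧸ P`. -/
def Std (P : Submodule A N) (xs : List A) : Prop :=
  ∀ l : List (A × ℕ), (l.map Prod.fst).Perm xs → (∀ p ∈ l, 1 ≤ p.2) →
    DSeq P (l.map fun p => p.1 ^ p.2)

theorem Std.perm {P : Submodule A N} {xs ys : List A} (h : Std P xs) (hp : xs.Perm ys) :
    Std P ys := fun l hl => h l (hl.trans hp.symm)

theorem Std.tail {P : Submodule A N} {x : A} {xs : List A} (h : Std P (x :: xs)) {n : ℕ}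
    (hn : 1 ≤ n) : Std (adj P (x ^ n)) xs := by
  intro l hl hl1
  exact (h ((x, n) :: l) (by simpa using hl) (by simpa using ⟨hn, fun a b hb => hl1 (a, b) hb⟩)).2

theorem Std.dSeq_pow {P : Submodule A N} {x : A} {xs : List A} (h : Std P (x :: xs)) {n : ℕ}
    (hn : 1 ≤ n) : DSeq P (x ^ n :: xs) := by
  have := h ((x, n) :: xs.map fun y => (y, 1)) (by simp [Function.comp_def])
    (by simpa using hn)
  simpa [Function.comp_def] using this

theorem Sop.pow {P : Submodule A N} {x : A} {xs : List A} (h : Sop P (x :: xs)) {n : ℕ}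
    (hn : 1 ≤ n) : Sop P (x ^ n :: xs) := by
  refine ⟨?_, top_le_iff.1 ?_⟩
  · intro y hy
    rcases List.mem_cons.1 hy with rfl | hy
    · exact Ideal.pow_mem_of_mem _ (h.1 x (by simp)) n hn
    · exact h.1 y (by simp [hy])
  · rw [le_low_iff]
    intro p hp
    have hx : x ∈ p.asIdeal := p.2.mem_of_pow_mem n (hp (Submodule.mem_colon.2 fun a _ => by
      rw [adjs_cons]
      exact le_adjs _ _ (smul_mem_adj P _ a)))
    refine le_low_iff.1 h.2.ge p (le_trans (Submodule.colon_mono ?_ subset_rfl)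
      (colon_le_of_smul_sup p.2 ((Ideal.span_singleton_le_iff_mem _).2 hx) hp))
    rw [adjs_eq, adjs_eq, Ideal.ofList_cons, Ideal.ofList_cons, Submodule.sup_smul,
      Submodule.sup_smul]
    refine sup_le (le_sup_left.trans le_sup_left) (sup_le le_sup_right
      (le_sup_right.trans (le_sup_right.trans le_sup_left)))

theorem exists_perm_cons {xs : List A} {y : A} (hy : y ∈ xs) : ∃ l, xs.Perm (y :: l) := by
  classical
  exact ⟨_, List.perm_cons_erase hy⟩

theorem Std.sdiv_pow_eq {P : Submodule A N} {x : A} {xs : List A} (h : Std P (x :: xs))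
    (hs : Sop P (x :: xs)) {n : ℕ} (hn : 1 ≤ n) : sdiv P (x ^ n) = sat P :=
  (h.dSeq_pow hn).sdiv_eq (hs.pow hn)

theorem Std.hKill (r : ℕ) : ∀ {P : Submodule A N} {xs : List A}, xs.length = r → Std P xs →
    Sop P xs → ∀ y ∈ xs, HKill P r (Ideal.span {y}) := by
  induction r with
  | zero => exact fun _ _ _ y _ i hi => absurd hi (Nat.not_lt_zero i)
  | succ r ih =>
    intro P xs hr h hs y hy
    rw [hKill_span_singleton]
    obtain ⟨ys, hys⟩ := exists_perm_cons hy
    have h' := h.perm hys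
    have hs' := hs.perm hys
    rintro (_ | i) hi
    · rw [hc_zero_smul_iff]
      have h1 := h'.dSeq_pow le_rfl
      rw [pow_one] at h1
      exact fun a ha => h1.smul_mem (hs'.1 y (by simp)) ha y (by simp)
    · intro z
      have hlen : ys.length = r := by simpa [hr] using hys.length_eq.symm
      obtain ⟨x, zs, rfl⟩ := List.exists_cons_of_length_pos (l := ys) (by omega)
      have h2 := h'.perm (List.Perm.swap x y zs)
      have hs2 := hs'.perm (List.Perm.swap x y zs)
      obtain ⟨n, hn⟩ := lh_torsion z
      have hn1 : x ^ (n + 1) • z = 0 := by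
        rw [pow_succ', mul_smul, hn _ (Ideal.pow_mem_pow (hs2.1 x (by simp)) n), smul_zero]
      obtain ⟨p, δ, -, -, hδ⟩ := exists_hc_les (h2.sdiv_pow_eq hs2 (n := n + 1) (by omega)).le i
      obtain ⟨c, rfl⟩ := (hδ z).1 hn1
      have h3 := hKill_span_singleton.1 (ih (by simpa using hlen) (h2.tail (n := n + 1) (by omega))
        (hs2.pow (n := n + 1) (by omega)).tail y (by simp)) i (by omega) c
      rw [← map_smul, h3, map_zero]

theorem Std.kills {xs : List A} : ∀ {P : Submodule A N}, Std P xs → Sop P xs → Kills P xs := by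
  induction xs with
  | nil => exact fun _ _ => trivial
  | cons x xs ih =>
    intro P h hs
    refine ⟨fun y hy => ⟨?_, ?_⟩, ih ?_ hs.tail⟩
    · obtain ⟨ys, hys⟩ := exists_perm_cons hy
      have := ((h.perm hys).sdiv_pow_eq (hs.perm hys) le_rfl).le
      rwa [pow_one] at this
    · exact h.hKill _ rfl hs y hy
    · have := h.tail (le_refl 1)
      rwa [pow_one] at this

end Standard

section Chevalley

variable {A : Type} [CommRing A] [IsLocalRing A] [IsNoetherianRing A]
  {N : Type} [AddCommGroup N] [Module A N] [Module.Finite A N]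

local notation "𝔪" => maximalIdeal A

theorem isPrecomplete_of_finite (I : Ideal A) [IsPrecomplete I A] (N : Type) [AddCommGroup N]
    [Module A N] [Module.Finite A N] : IsPrecomplete I N := by
  obtain ⟨n, f, hf⟩ := Module.Finite.exists_fin' A N
  rw [← AdicCompletion.of_surjective_iff]
  intro y
  obtain ⟨z, rfl⟩ := AdicCompletion.map_surjective I hf y
  choose c hc using fun i => AdicCompletion.of_surjective I A
    (AdicCompletion.pi I (fun _ : Fin n => A) z i)
  refine ⟨f c, ?_⟩
  rw [← AdicCompletion.map_of]
  congr 1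
  apply (AdicCompletion.piEquivFin I n).injective
  rw [AdicCompletion.piEquivFin_apply, AdicCompletion.piEquivFin_apply]
  funext i
  rw [← hc i]
  simp [AdicCompletion.pi, AdicCompletion.map_of]

theorem chevalley [IsAdicComplete 𝔪 A] {U : Submodule A N} (Un : ℕ → Submodule A N)
    (hU : Antitone Un) (h : ∀ s, (∀ n, s ∈ Un n) → s ∈ U) (i : ℕ) :
    ∃ n, Un n ≤ U ⊔ 𝔪 ^ i • ⊤ := by
  have hst : ∀ j : ℕ, ∃ n, ∀ k, n ≤ k → Un n ≤ Un k ⊔ 𝔪 ^ j • ⊤ := by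
    intro j
    have hfl : IsFiniteLength A (N ⧸ (𝔪 ^ j • ⊤ : Submodule A N)) := by
      refine isFiniteLength_of_pow_smul (k := j) fun c hc w => ?_
      obtain ⟨w, rfl⟩ := Submodule.mkQ_surjective _ w
      rw [← map_smul]
      exact (Submodule.Quotient.mk_eq_zero _).2 (Submodule.smul_mem_smul hc trivial)
    have := (isFiniteLength_iff_isNoetherian_isArtinian.1 hfl).2
    obtain ⟨n, hn⟩ := IsArtinian.monotone_stabilizes
      (⟨fun n => OrderDual.toDual ((Un n).map (Submodule.mkQ (𝔪 ^ j • ⊤ : Submodule A N))),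
        fun a b hab => OrderDual.toDual_le_toDual.2 (Submodule.map_mono (hU hab))⟩ :
        ℕ →o (Submodule A (N ⧸ (𝔪 ^ j • ⊤ : Submodule A N)))ᵒᵈ)
    refine ⟨n, fun k hk => ?_⟩
    have h1 := OrderDual.toDual_inj.1 (hn k hk)
    have h2 := congrArg (Submodule.comap (Submodule.mkQ (𝔪 ^ j • ⊤ : Submodule A N))) h1
    simp only [Submodule.comap_map_mkQ] at h2
    rw [sup_comm (Un k), ← h2]
    exact le_sup_right
  choose ν hν using hst
  have := isPrecomplete_of_finite 𝔪 N
  set μ : ℕ → ℕ := fun j => ∑ k ∈ Finset.range (j + 1), ν k + j with hμ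
  have hμν : ∀ j k, μ j ≤ k → Un (μ j) ≤ Un k ⊔ 𝔪 ^ j • ⊤ := fun j k hjk => by
    have : ν j ≤ μ j := by
      simp only [hμ, Finset.sum_range_succ]; omega
    exact (hU this).trans (hν j k (this.trans hjk))
  have hμs : ∀ j, μ j ≤ μ (j + 1) := fun j => by
    simp only [hμ, Finset.sum_range_succ]; omega
  refine ⟨μ i, fun s0 hs0 => ?_⟩
  have hstep : ∀ j (s : N), s ∈ Un (μ (i + j)) →
      ∃ s' ∈ Un (μ (i + j + 1)), s - s' ∈ (𝔪 ^ (i + j) • ⊤ : Submodule A N) := by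
    intro j s hs
    obtain ⟨s', hs', t, ht, rfl⟩ := Submodule.mem_sup.1 (hμν _ _ (hμs (i + j)) hs)
    exact ⟨s', hs', by simpa using ht⟩
  choose! F hF hF' using hstep
  let s : ℕ → N := fun j => Nat.rec s0 (fun j t => F j t) j
  have hs : ∀ j, s j ∈ Un (μ (i + j)) := by
    intro j
    induction j with
    | zero => exact hs0
    | succ j ih => exact hF j _ ih
  have hd : ∀ j k, s j - s (j + k) ∈ (𝔪 ^ (i + j) • ⊤ : Submodule A N) := by
    intro j k
    induction k with
    | zero => simp
    | succ k ih =>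
      have h1 : s (j + k) - s (j + (k + 1)) ∈ (𝔪 ^ (i + (j + k)) • ⊤ : Submodule A N) :=
        hF' (j + k) _ (hs (j + k))
      have h2 := Submodule.add_mem _ ih
        (Submodule.smul_mono_left (Ideal.pow_le_pow_right (by omega)) h1)
      simpa using h2
  obtain ⟨L, hL⟩ := this.prec (f := s) (fun {m n} hmn => by
    obtain ⟨k, rfl⟩ := Nat.exists_eq_add_of_le hmn
    exact SModEq.sub_mem.2
      (Submodule.smul_mono_left (Ideal.pow_le_pow_right (by omega)) (hd m k)))
  have hLU : L ∈ U := by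
    refine h L fun n => eq_of_forall_mem_sup_pow fun j => ?_
    have h1 : s (n + j) ∈ Un n := hU (by simp only [hμ]; omega) (hs (n + j))
    have h2 := SModEq.sub_mem.1 (hL (n + j))
    have h3 := Submodule.smul_mono_left (Ideal.pow_le_pow_right (Nat.le_add_left j n)) h2
    have := Submodule.sub_mem _ (Submodule.mem_sup_left (T := 𝔪 ^ j • ⊤) h1)
      (Submodule.mem_sup_right (S := Un n) h3)
    simpa using this
  have h1 := SModEq.sub_mem.1 (hL i)
  have h2 := Submodule.smul_mono_left (Ideal.pow_le_pow_right (by omega)) (hd 0 i) (J := 𝔪 ^ i)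
  have := Submodule.add_mem _ (Submodule.mem_sup_left (T := 𝔪 ^ i • ⊤) hLU)
    (Submodule.mem_sup_right (S := U) (Submodule.add_mem _ h2 h1))
  simpa [s] using this

end Chevalley

section Tubes

variable {A : Type} [CommRing A] [IsLocalRing A] [IsNoetherianRing A]
  {N : Type} [AddCommGroup N] [Module A N] [Module.Finite A N]

local notation "𝔪" => maximalIdeal A

theorem pow_smul_mem_adj_iff {U : Submodule A N} {x : A} (hU : sdiv U x ≤ U) {n k : ℕ} {s : N} :
    x ^ k • s ∈ adj U (x ^ (n + k)) ↔ s ∈ adj U (x ^ n) := by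
  rw [mem_adj, mem_adj]
  refine exists_congr fun b => ?_
  rw [add_comm n k, pow_add, mul_smul, ← smul_sub]
  exact ⟨fun h => sdiv_pow_le hU le_rfl k h, fun h => U.smul_mem _ h⟩

/-- The submodules `low (d + 1) (U + x ^ n N)`. -/
def tube (d : ℕ) (U : Submodule A N) (x : A) (n : ℕ) : Submodule A N :=
  low (d + 1) (adj U (x ^ n))

variable {d K : ℕ} {U : Submodule A N} {x : A}

theorem le_tube (n : ℕ) : U ≤ tube d U x n := (le_adj _ _).trans (le_low _ _)

theorem tube_antitone : Antitone (tube d U x) := fun _ _ h =>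
  low_mono (adj_le_adj_of_dvd U (pow_dvd_pow x h))

theorem low_tube {e : ℕ} (he : e ≤ d + 1) (n : ℕ) : low e (tube d U x n) ≤ tube d U x n :=
  (low_mono_dim he _).trans (low_low _ _).le

theorem smul_mem_tube (hU : sdiv U x ≤ U) {n k : ℕ} {s : N} :
    x ^ k • s ∈ tube d U x (n + k) ↔ s ∈ tube d U x n := by
  rw [tube, tube, mem_low, mem_low]
  have : (adj U (x ^ (n + k))).colon {x ^ k • s} = (adj U (x ^ n)).colon {s} := by
    ext c
    rw [Submodule.mem_colon_singleton, Submodule.mem_colon_singleton, smul_comm,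
      pow_smul_mem_adj_iff hU]
  rw [this]

theorem exists_smul_sub_mem {V : Submodule A N} {a : A} (ha : sdiv V a ≤ V) (hV : sat V ≤ V)
    (hK : HKill V (d + 2) (𝔪 ^ K)) {c : A} (hc : c ∈ 𝔪 ^ K) {l : N}
    (hl : l ∈ low d (adj V a)) : ∃ l₀, c • l - a • l₀ ∈ V := by
  have hk : HKill (adj V a) (d + 1) (𝔪 ^ (K + K)) := by
    rw [pow_add]
    exact HKill.adj (ha.trans (le_low 0 _)) hK hK
  have hl' := low_le_sat_of_hKill d _ (d + 1) (K + K) (Nat.lt_succ_self d) hk hl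
  refine mem_adj.1 (hc_zero_smul_iff.1 (fun h => ?_) _ hl')
  obtain ⟨p, δ, -, hpδ, -⟩ := exists_hc_les (ha.trans (le_low 0 _)) 0
  have h1 : δ (c • h) = 0 := by rw [map_smul]; exact hK 1 (by omega) c hc _
  obtain ⟨h', hh'⟩ := (hpδ _).1 h1
  have h2 : h' = 0 := by
    have := (hc_zero_smul_iff (P := V) (c := 1)).2 (fun a ha => by simpa using hV ha) h'
    simpa using this
  rw [← hh', h2, map_zero]

theorem exists_sub_mem_tube (hU : sdiv U x ≤ U) (hK : HKill (tube d U x 1) (d + 2) (𝔪 ^ K))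
    {n : ℕ} (hn : tube d U x n ≤ low d (adj U (x ^ n))) {c : A} (hc : c ∈ 𝔪 ^ K) {s : N}
    (hs : s ∈ tube d U x n) : ∃ l, c • s - x ^ n • l ∈ tube d U x (n + 1) := by
  set I := (adj U (x ^ n)).colon {s} with hI
  have hId : IDimLE d I := hn hs
  obtain ⟨a, haI, ha⟩ := exists_avoid (I := I) [(d + 1, adj U (x ^ 1))] (by
    intro y hy p hp
    obtain rfl := List.mem_singleton.1 hy
    exact fun hle => not_coheight_le_of_mem_assP_low hp
      (hId.mono_dim (Nat.le_succ d) ⟨p, hp.1⟩ hle))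
  have ha' : sdiv (tube d U x 1) a ≤ tube d U x 1 :=
    ha (d + 1, adj U (x ^ 1)) (List.mem_singleton_self _)
  have hl : ∀ b ∈ I, ∃ l, b • s - x ^ n • l ∈ U := fun b hb =>
    mem_adj.1 (Submodule.mem_colon_singleton.1 hb)
  choose! l hl using hl
  have hab : ∀ b ∈ I, b • l a - a • l b ∈ U := fun b hb => by
    refine sdiv_pow_le hU le_rfl n ?_
    rw [mem_sdiv]
    have := U.sub_mem (U.smul_mem a (hl b hb)) (U.smul_mem b (hl a haI))
    convert this using 1
    module
  have hla : l a ∈ low d (adj (tube d U x 1) a) := by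
    refine mem_low.2 (hId.mono fun b hb => Submodule.mem_colon_singleton.2 ?_)
    exact mem_adj.2 ⟨l b, le_tube 1 (hab b hb)⟩
  obtain ⟨l₀, hl₀⟩ := exists_smul_sub_mem ha' (low_tube (Nat.zero_le _) 1) hK hc hla
  refine ⟨l₀, ?_⟩
  have hb : ∀ b ∈ I, c • l b - b • l₀ ∈ tube d U x 1 := fun b hb => by
    refine ha' ?_
    rw [mem_sdiv]
    have := Submodule.sub_mem _ (Submodule.smul_mem _ b hl₀)
      (le_tube (d := d) (x := x) 1 (U.smul_mem c (hab b hb)))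
    convert this using 1
    module
  refine low_tube (Nat.le_succ d) _ (mem_low.2 (hId.mono fun b hb' =>
    Submodule.mem_colon_singleton.2 ?_))
  have h1 := (smul_mem_tube (d := d) hU (n := 1) (k := n)).2 (hb b hb')
  rw [add_comm 1 n] at h1
  have := Submodule.add_mem _ h1 (le_tube (n + 1) (U.smul_mem c (hl b hb')))
  convert this using 1
  module

theorem mem_of_forall_mem_tube (hx : x ∈ 𝔪) (hlow : low (d + 2) U ≤ U)
    {s : N} (hs : ∀ n, s ∈ tube d U x n) : s ∈ U := by
  by_contra hsU
  have h1 : ¬ IDimLE (d + 1) (U.colon {s} ⊔ Ideal.span {x}) := fun h =>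
    hsU (hlow (mem_low.2 (h.of_sup_span hx)))
  simp only [IDimLE, not_forall] at h1
  obtain ⟨q, hq, hqd⟩ := h1
  have hxq : x ∈ q.asIdeal := hq (Submodule.mem_sup_right (Ideal.mem_span_singleton_self x))
  have hsq : U.colon {s} ≤ q.asIdeal := le_sup_left.trans hq
  set V := U ⊔ Submodule.span A {s} with hV
  obtain ⟨k, hk⟩ := (monotone_stabilizes_iff_noetherian (R := A) (M := N)).2 inferInstance
    ⟨fun k => sdiv V (x ^ k), monotone_nat_of_le_succ fun k a ha => by
      rw [mem_sdiv] at ha ⊢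
      rw [pow_succ', mul_smul]
      exact V.smul_mem x ha⟩
  have h2 : ¬ (adj U (x ^ (k + 1))).colon {s} ≤ q.asIdeal := fun h =>
    hqd (mem_low.1 (hs (k + 1)) q h)
  obtain ⟨t, ht, htq⟩ := Set.not_subset.1 h2
  obtain ⟨b, hb⟩ := mem_adj.1 (Submodule.mem_colon_singleton.1 ht)
  have hsV : s ∈ V := Submodule.mem_sup_right (Submodule.mem_span_singleton_self s)
  have h3 : x ^ (k + 1) • b ∈ V := by
    have := V.sub_mem (V.smul_mem t hsV) (Submodule.mem_sup_left hb)
    simpa using this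
  have h4 : x ^ k • b ∈ V := by
    have := hk (k + 1) (Nat.le_succ k)
    simp only [OrderHom.coe_mk] at this
    rw [← mem_sdiv, this, mem_sdiv]
    exact h3
  obtain ⟨u, hu, v, hv, huv⟩ := Submodule.mem_sup.1 h4
  obtain ⟨e, rfl⟩ := Submodule.mem_span_singleton.1 hv
  have h5 : t - x * e ∈ U.colon {s} := by
    rw [Submodule.mem_colon_singleton]
    have := U.add_mem hb (U.smul_mem x hu)
    convert this using 1
    rw [pow_succ', mul_smul, ← huv]
    module
  refine htq ?_
  have := q.asIdeal.add_mem (hsq h5) (q.asIdeal.mul_mem_right e hxq)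
  simpa using this

theorem exists_tube_eq [IsAdicComplete 𝔪 A] (hU : sdiv U x ≤ U) (hx : x ∈ 𝔪)
    (hlow : low (d + 2) U ≤ U) (hK : HKill (tube d U x 1) (d + 2) (𝔪 ^ K))
    (hd : ∀ n, 1 ≤ n → tube d U x n ≤ low d (adj U (x ^ n))) :
    ∃ k, 1 ≤ k ∧ ∀ i, ∀ s ∈ tube d U x (k + i), ∃ s' ∈ tube d U x k, s - x ^ i • s' ∈ U := by
  obtain ⟨g, c, hc⟩ := Submodule.fg_iff_exists_fin_generating_family.1
    (IsNoetherian.noetherian (𝔪 ^ K))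
  have hcm : ∀ i, c i ∈ 𝔪 ^ K := fun i => hc ▸ Submodule.subset_span ⟨i, rfl⟩
  let W : ℕ → Submodule A (Fin g → N) := fun n =>
    { carrier := {l | ∃ s ∈ tube d U x n, ∀ i, c i • s - x ^ n • l i ∈ tube d U x (n + 1)}
      add_mem' := by
        rintro l l' ⟨s, hs, h⟩ ⟨s', hs', h'⟩
        refine ⟨s + s', add_mem hs hs', fun i => ?_⟩
        convert add_mem (h i) (h' i) using 1
        simp only [Pi.add_apply]
        module
      zero_mem' := ⟨0, zero_mem _, fun i => by simp⟩
      smul_mem' := by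
        rintro a l ⟨s, hs, h⟩
        refine ⟨a • s, Submodule.smul_mem _ _ hs, fun i => ?_⟩
        convert Submodule.smul_mem _ a (h i) using 1
        simp only [Pi.smul_apply]
        module }
  obtain ⟨k, hk⟩ := (monotone_stabilizes_iff_noetherian (R := A) (M := Fin g → N)).2 inferInstance
    ⟨W, monotone_nat_of_le_succ fun n => by
      rintro l ⟨s, hs, h⟩
      refine ⟨x • s, ?_, fun i => ?_⟩
      · simpa using (smul_mem_tube hU (n := n) (k := 1)).2 hs
      · have := (smul_mem_tube hU (n := n + 1) (k := 1)).2 (h i)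
        convert this using 1
        rw [pow_one, pow_succ', mul_smul]
        module⟩
  have hstep : ∀ n, k ≤ n → ∀ s ∈ tube d U x (n + 1), ∃ s' ∈ tube d U x n,
      s - x • s' ∈ tube d U x (n + 2) := by
    intro n hn s hs
    choose l hl using fun i => exists_sub_mem_tube hU hK (hd (n + 1) (by omega)) (hcm i) hs
    have h1 : l ∈ W (n + 1) := ⟨s, hs, hl⟩
    have h2 : l ∈ W n := by
      have e1 := hk n hn
      have e2 := hk (n + 1) (by omega)
      simp only [OrderHom.coe_mk] at e1 e2
      rwa [← e1, e2]
    obtain ⟨s', hs', hl'⟩ := h2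
    refine ⟨s', hs', low_tube (Nat.zero_le _) _ (mem_sat.2 ⟨K, fun a ha => ?_⟩)⟩
    rw [← hc] at ha
    induction ha using Submodule.span_induction with
    | mem a ha =>
      obtain ⟨i, rfl⟩ := ha
      have h3 := (smul_mem_tube hU (n := n + 1) (k := 1)).2 (hl' i)
      have := sub_mem (hl i) h3
      convert this using 1
      rw [pow_one, pow_succ' x n, mul_smul]
      module
    | zero => simp
    | add a b _ _ h h' => rw [add_smul]; exact add_mem h h'
    | smul b a _ h => rw [smul_eq_mul, mul_smul]; exact Submodule.smul_mem _ _ h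
  set m := k + 1 with hm
  have h1 : ∀ i, ∀ s ∈ tube d U x (m + i), ∃ s' ∈ tube d U x m,
      s - x ^ i • s' ∈ tube d U x (m + i + 1) := by
    intro i
    induction i with
    | zero => exact fun s hs => ⟨s, hs, by simp⟩
    | succ i ih =>
      intro s hs
      obtain ⟨s₁, hs₁, h₁⟩ := hstep (m + i) (by omega) s hs
      obtain ⟨s₂, hs₂, h₂⟩ := ih s₁ hs₁
      refine ⟨s₂, hs₂, ?_⟩
      have h3 := (smul_mem_tube hU (n := m + i + 1) (k := 1)).2 h₂
      rw [show m + (i + 1) + 1 = m + i + 2 by omega]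
      convert add_mem h₁ h3 using 1
      rw [pow_one, pow_succ', mul_smul]
      module
  have h2 : ∀ i j, ∀ s ∈ tube d U x (m + i), ∃ s' ∈ tube d U x m,
      s - x ^ i • s' ∈ tube d U x (m + i + j) := by
    intro i j
    induction j with
    | zero => exact fun s hs => ⟨0, zero_mem _, by simpa using hs⟩
    | succ j ih =>
      intro s hs
      obtain ⟨s₁, hs₁, h₁⟩ := ih s hs
      obtain ⟨s₂, hs₂, h₂⟩ := h1 (i + j) _ (by rwa [← add_assoc])
      refine ⟨s₁ + x ^ j • s₂, add_mem hs₁ (Submodule.smul_mem _ _ hs₂), ?_⟩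
      rw [show m + i + (j + 1) = m + (i + j) + 1 by omega]
      convert h₂ using 1
      rw [pow_add, mul_smul]
      module
  refine ⟨m, by omega, fun i s hs => ?_⟩
  have h3 : s ∈ U ⊔ (tube d U x m).map (LinearMap.lsmul A N (x ^ i)) := by
    refine eq_of_forall_mem_sup_pow fun j => ?_
    obtain ⟨n, hn⟩ := chevalley (tube d U x) tube_antitone
      (fun s hs => mem_of_forall_mem_tube hx hlow hs) j
    obtain ⟨s', hs', h⟩ := h2 i n s hs
    obtain ⟨u, hu, v, hv, huv⟩ := Submodule.mem_sup.1 (hn (tube_antitone (by omega) h))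
    have : s = (u + x ^ i • s') + v := by
      rw [add_right_comm, huv]; simp
    rw [this]
    exact Submodule.add_mem_sup (Submodule.add_mem_sup hu ⟨s', hs', rfl⟩) hv
  obtain ⟨u, hu, v, ⟨s', hs', rfl⟩, rfl⟩ := Submodule.mem_sup.1 h3
  exact ⟨s', hs', by simpa using hu⟩

theorem exists_pow_smul_mem_adj [IsAdicComplete 𝔪 A] (hU : sdiv U x ≤ U) (hx : x ∈ 𝔪)
    (hlow : low (d + 2) U ≤ U) (hK : HKill (tube d U x 1) (d + 2) (𝔪 ^ K))
    (hd : ∀ n, 1 ≤ n → tube d U x n ≤ low d (adj U (x ^ n))) :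
    ∃ K', ∀ n, ∀ c ∈ 𝔪 ^ K', ∀ s ∈ tube d U x n, c • s ∈ adj U (x ^ n) := by
  obtain ⟨k, hk, hk'⟩ := exists_tube_eq hU hx hlow hK hd
  have h1 : ∀ n, 1 ≤ n → ∀ j, ∀ c ∈ 𝔪 ^ (K * j), ∀ s ∈ tube d U x n,
      ∃ l, c • s - x ^ n • l ∈ tube d U x (n + j) := by
    intro n hn j
    induction j with
    | zero => exact fun c _ s hs => ⟨0, by simpa using Submodule.smul_mem _ c hs⟩
    | succ j ih =>
      intro c hc s hs
      rw [Nat.mul_succ, pow_add] at hc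
      induction hc using Submodule.mul_induction_on' with
      | mem_mul_mem a ha b hb =>
        obtain ⟨l, hl⟩ := ih a ha s hs
        obtain ⟨l', hl'⟩ := exists_sub_mem_tube hU hK (hd (n + j) (by omega)) hb hl
        refine ⟨b • l + x ^ j • l', ?_⟩
        rw [← add_assoc n j 1]
        convert hl' using 1
        rw [pow_add, mul_smul]
        module
      | add a _ b _ h h' =>
        obtain ⟨l, hl⟩ := h
        obtain ⟨l', hl'⟩ := h'
        refine ⟨l + l', ?_⟩
        convert add_mem hl hl' using 1
        module
  have h2 : ∀ c ∈ 𝔪 ^ (K * k), ∀ s ∈ tube d U x k, c • s ∈ adj U (x ^ k) := by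
    intro c hc s hs
    obtain ⟨l, hl⟩ := h1 k hk k c hc s hs
    obtain ⟨s', -, hs'⟩ := hk' k _ hl
    refine mem_adj.2 ⟨l + s', ?_⟩
    convert hs' using 1
    module
  refine ⟨K * k, fun n c hc s hs => ?_⟩
  rcases le_total n k with h | h
  · obtain ⟨j, rfl⟩ := Nat.exists_eq_add_of_le h
    rw [← pow_smul_mem_adj_iff hU (k := j), smul_comm]
    exact h2 c hc _ ((smul_mem_tube hU).2 hs)
  · obtain ⟨j, rfl⟩ := Nat.exists_eq_add_of_le h
    obtain ⟨s', hs', h'⟩ := hk' j s hs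
    have h3 := (pow_smul_mem_adj_iff hU (k := j)).2 (h2 c hc s' hs')
    have := add_mem h3 (le_adj U (x ^ (k + j)) (U.smul_mem c h'))
    convert this using 1
    module

end Tubes

section BoundedE

variable {A : Type} [CommRing A] [IsLocalRing A] [IsNoetherianRing A]
  {N : Type} [AddCommGroup N] [Module A N] [Module.Finite A N]

local notation "𝔪" => maximalIdeal A

theorem Sop.ofList_le {P : Submodule A N} {xs : List A} (h : Sop P xs) : Ideal.ofList xs ≤ 𝔪 :=
  Ideal.span_le.2 h.1

theorem E_eq_E {P U : Submodule A N} {xs : List A} {s : ℕ} (h : DSeq P xs) (hs : Sop P xs)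
    (h' : DSeq U xs) (hPU : P ≤ U) (hU : U ≤ low s P) (hl : s + 2 ≤ xs.length) :
    E P xs = E U xs :=
  (h.hP hs).coeff_eq hs.ofList_le (by rw [← adjs_eq]; exact hs.2) hPU hU
    (h'.hP (hs.mono hPU)) _ (by omega) (by omega)

theorem hKill_low_one {P : Submodule A N} (hP : low 2 P = ⊤) {k C : ℕ}
    (hC : ∀ xs : List A, xs.length = 2 → DSeq P xs → Sop P xs → (∀ y ∈ xs, y ∈ 𝔪 ^ k) →
      E P xs ≤ C) : low 1 P ≤ sat P ∧ HKill (low 1 P) 2 (𝔪 ^ C) := by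
  have h1 : ∀ c ∈ 𝔪 ^ C, ∀ h : Hc 1 P, c • h = 0 := by
    intro c hc h
    obtain ⟨n, hn⟩ := lh_torsion h
    obtain ⟨xs, hl, hxs, h'⟩ := exists_deep 2 (max k n) [P] (by simpa using hP)
    obtain ⟨hd, hs⟩ := h' P (by simp)
    obtain ⟨x, y, rfl⟩ := List.length_eq_two.1 hl
    obtain ⟨h2, h3⟩ := E_two_eq (hs.1 x (by simp)) hd hs
    have h4 := hC _ hl hd hs fun z hz => Ideal.pow_le_pow_right (by omega) (hxs z hz)
    rw [h3] at h4
    have h5 : Module.length A (LinearMap.ker (LinearMap.lsmul A (Hc 1 P) x)) ≤ C := by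
      rw [← ENat.natCast_toNat h2]
      exact_mod_cast h4
    have h6 := exists_pow_smul_of_length_le C h5 c hc ⟨h, 
      hn x (Ideal.pow_le_pow_right (by omega) (hxs x (by simp)))⟩
    exact congrArg Subtype.val h6
  obtain ⟨k, hk⟩ := exists_pow_le_colon (le_refl (sat P))
  have h2 : HKill P 2 (𝔪 ^ (max C k)) := by
    intro i hi c hc
    interval_cases i
    · exact hc_zero_smul_iff.2 fun a ha => hk c (Ideal.pow_le_pow_right (le_max_right _ _) hc) a ha
    · exact h1 c (Ideal.pow_le_pow_right (le_max_left _ _) hc)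
  have h3 := low_le_sat_of_hKill 1 P 2 _ (by omega) h2
  refine ⟨h3, fun i hi c hc => ?_⟩
  interval_cases i
  · exact hc_zero_smul_iff.2 fun a ha => Submodule.smul_mem _ _
      (((low_mono_dim (Nat.zero_le 1) _).trans (low_low 1 P).le) ha)
  · obtain ⟨e⟩ := exists_hcEquiv (le_low 1 P) h3 0
    intro h
    have := h1 c hc (e.symm h)
    rwa [← map_smul, LinearEquiv.map_eq_zero_iff] at this

theorem hKill_of_E_le {P U : Submodule A N} {s k C K : ℕ} (hP : low (s + 2) P = ⊤)
    (hC : ∀ xs : List A, xs.length = s + 2 → DSeq P xs → Sop P xs → (∀ y ∈ xs, y ∈ 𝔪 ^ k) →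
      E P xs ≤ C) (hPU : P ≤ U) (hU : U ≤ low s P) (hUs : sat U ≤ U)
    (hK : HKill U (s + 2) (𝔪 ^ K)) : HKill U (s + 2) (𝔪 ^ C) := by
  obtain ⟨xs, hl, hxs, h'⟩ := exists_deep (s + 2) (max k (2 ^ (s + 2) * K)) [P] (by simpa using hP)
  obtain ⟨hd, hs⟩ := h' P (by simp)
  have hkl : Kills U xs := kills_of_deep xs U K (by rwa [hl]) (hs.mono hPU) fun y hy =>
    Ideal.pow_le_pow_right (by rw [hl]; omega) (hxs y hy)
  have h1 := hC xs hl hd hs fun z hz => Ideal.pow_le_pow_right (by omega) (hxs z hz)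
  rw [E_eq_E hd hs hkl.dSeq hPU hU (by omega), hkl.E_eq s hl] at h1
  intro i hi
  rcases i with _ | i
  · exact fun c _ => hc_zero_smul_iff.2 fun a ha => U.smul_mem _ (hUs ha)
  · have h2 : hn (i + 1) U ≤ Sg s U := by
      have h3 := Finset.single_le_sum (f := fun i => (s.choose i : ℤ) * hn (i + 1) U)
        (fun j _ => mul_nonneg (Int.natCast_nonneg _) (hn_nonneg _ _))
        (Finset.mem_range.2 (by omega : i < s + 1))
      refine le_trans ?_ h3
      have h4 : (1 : ℤ) ≤ s.choose i := by exact_mod_cast Nat.choose_pos (by omega)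
      nlinarith [hn_nonneg (i + 1) U]
    refine exists_pow_smul_of_length_le C ?_
    change hlen (i + 1) U ≤ C
    rw [← ENat.natCast_toNat (hkl.hlen_ne_top (i + 1) (by omega))]
    have h3 : ((hlen (i + 1) U).toNat : ℤ) ≤ C := h2.trans h1
    exact_mod_cast h3

theorem hKill_of_bounded [IsAdicComplete 𝔪 A] (s : ℕ) : ∀ (P : Submodule A N),
    low (s + 2) P = ⊤ → ∀ k C : ℕ, (∀ xs : List A, xs.length = s + 2 → DSeq P xs → Sop P xs →
      (∀ y ∈ xs, y ∈ 𝔪 ^ k) → E P xs ≤ C) →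
    low (s + 1) P ≤ low s P ∧ HKill (low (s + 1) P) (s + 2) (𝔪 ^ C) := by
  induction s with
  | zero => exact fun P hP k C hC => hKill_low_one hP hC
  | succ s ih =>
    intro P hP k C hC
    set U := low (s + 2) P with hUdef
    have hPU : P ≤ U := le_low _ _
    have hUU : ∀ e ≤ s + 2, low e U ≤ U := fun e he => (low_mono_dim he _).trans (low_low _ _).le
    obtain ⟨K₀, hK₀⟩ := exists_pow_inf_sat_le P
    obtain ⟨x, hx, hxP⟩ := exists_avoid (I := 𝔪 ^ (max k K₀ + 1)) [(0, P), (s + 2, P)]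
      (fun y _ p hp => pow_not_le_of_mem_assP_low hp)
    have hx0 : sdiv (sat P) x ≤ sat P := hxP (0, P) (by simp)
    have hxU : sdiv U x ≤ U := hxP (s + 2, P) (by simp)
    have hxm : x ∈ 𝔪 := Ideal.pow_le_self (by omega) hx
    have hxn : ∀ n, 1 ≤ n → x ^ n ∈ 𝔪 ^ (max k K₀) := fun n hn =>
      Ideal.pow_mem_of_mem _ (Ideal.pow_le_pow_right (by omega) hx) n hn
    have hB : ∀ n, 1 ≤ n → low (s + 1) (adj P (x ^ n)) ≤ low s (adj P (x ^ n)) ∧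
        HKill (low (s + 1) (adj P (x ^ n))) (s + 2) (𝔪 ^ C) := by
      intro n hn
      refine ih (adj P (x ^ n)) (low_adj_eq_top hP (sdiv_pow_le hxU hPU n)) (max k K₀) C ?_
      intro xs hl hd hs hm
      rw [← E_cons _ _ _ (by omega)]
      refine hC (x ^ n :: xs) (by simp [hl]) ⟨fun y hy a ha => hK₀ ⟨?_, ?_⟩, hd⟩
        ⟨?_, hs.2⟩ ?_
      · have : y ∈ 𝔪 ^ K₀ := by
          refine Ideal.pow_le_pow_right (le_max_right k K₀) ?_
          rcases List.mem_cons.1 hy with rfl | hy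
          exacts [hxn n hn, hm y hy]
        exact Submodule.smul_mem_smul this trivial
      · exact sdiv_pow_le hx0 (le_low 0 P) n ha
      · rintro y hy
        rcases List.mem_cons.1 hy with rfl | hy
        exacts [Ideal.pow_mem_of_mem _ hxm n hn, hs.1 y hy]
      · rintro y hy
        refine Ideal.pow_le_pow_right (le_max_left k K₀) ?_
        rcases List.mem_cons.1 hy with rfl | hy
        exacts [hxn n hn, hm y hy]
    have hUn : ∀ n, U ≤ low (s + 1) (adj P (x ^ n)) := fun n =>
      ((low_mono (le_low 0 P)).trans (low_succ_le_low_adj (d := s + 1) hx0 n)).trans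
        (low_le_of_le (sup_le ((low_mono_dim (Nat.zero_le _) _).trans (low_mono (le_adj _ _)))
          (le_sup_right.trans (le_low _ _))))
    have hUlow : U ≤ low (s + 1) P := by
      refine iDimLE_colon_of_sup hxm fun u hu => ?_
      have h1 := (hB 1 le_rfl).1 (hUn 1 hu)
      rw [pow_one] at h1
      refine mem_low.2 ((mem_low.1 h1).mono fun c hc => ?_)
      rw [Submodule.mem_colon_singleton] at hc ⊢
      obtain ⟨b, hb⟩ := mem_adj.1 hc
      have hbU : b ∈ U := hxU (by
        rw [mem_sdiv]
        simpa using U.sub_mem (U.smul_mem c hu) (hPU hb))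
      have := Submodule.add_mem_sup hb
        (Submodule.smul_mem_smul (Ideal.mem_span_singleton_self x) hbU)
      simpa using this
    have htube : ∀ n, tube s U x n = low (s + 1) (adj P (x ^ n)) := fun n =>
      le_antisymm (low_le_of_le (sup_le (hUn n) (le_sup_right.trans (le_low _ _))))
        (low_mono (adj_mono hPU _))
    obtain ⟨K, hK⟩ := exists_pow_smul_mem_adj (d := s) (K := C) hxU hxm (hUU _ le_rfl)
      (by rw [htube]; exact (hB 1 le_rfl).2)
      (fun n hn => by
        rw [htube]; exact (hB n hn).1.trans (low_mono (adj_mono hPU _)))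
    have hker : ∀ i (h : Hc (i + 1) U), ∃ n, 1 ≤ n ∧
        ∃ δ : Hc i (adj U (x ^ n)) →ₗ[A] Hc (i + 1) U, ∃ c, δ c = h := by
      intro i h
      obtain ⟨n, hn⟩ := lh_torsion h
      obtain ⟨p, δ, -, -, h3⟩ := exists_hc_les (P := U) (x := x ^ (n + 1))
        ((sdiv_pow_le hxU le_rfl _).trans (le_low 0 _)) i
      exact ⟨n + 1, by omega, δ, (h3 h).1
        (hn _ (Ideal.pow_le_pow_right (Nat.le_succ n) (Ideal.pow_mem_pow hxm _)))⟩
    refine ⟨hUlow, hKill_of_E_le (K := max K C) hP hC hPU hUlow (hUU 0 (Nat.zero_le _)) ?_⟩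
    intro i hi c hc
    have hcK := Ideal.pow_le_pow_right (le_max_left K C) hc
    have hcC := Ideal.pow_le_pow_right (le_max_right K C) hc
    rcases i with _ | _ | i
    · exact hc_zero_smul_iff.2 fun a ha => U.smul_mem _ (hUU 0 (Nat.zero_le _) ha)
    · intro h
      obtain ⟨n, hn, δ, z, rfl⟩ := hker 0 h
      rw [← map_smul, hc_zero_smul_iff.2 (fun a ha => hK n c hcK a
        (low_mono_dim (Nat.zero_le _) _ ha)) z, map_zero]
    · intro h
      obtain ⟨n, hn, δ, z, rfl⟩ := hker (i + 1) h
      obtain ⟨e⟩ := exists_hcEquiv (P := adj U (x ^ n)) (le_low (s + 1) _)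
        (le_sat_of_pow (hK n)) i
      have h1 : HKill (tube s U x n) (s + 2) (𝔪 ^ C) := by rw [htube]; exact (hB n hn).2
      have h2 : e (c • z) = 0 := (map_smul e c z).trans (h1 (i + 1) (by omega) c hcC (e z))
      rw [← map_smul, (LinearEquiv.map_eq_zero_iff e).1 h2, map_zero]

end BoundedE

section EveryPar

variable {A : Type} [CommRing A] [IsLocalRing A] [IsNoetherianRing A]
  {N : Type} [AddCommGroup N] [Module A N] [Module.Finite A N]

local notation "𝔪" => maximalIdeal A

theorem le_of_forall_isPar {d : ℕ} {P : Submodule A N} (hP : low (d + 1) P = ⊤) {I : Ideal A}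
    (h : ∀ x : A, IsPar d P x → x ∈ I) : 𝔪 ≤ I := by
  classical
  have hf := assP_finite (low d P)
  have h1 : ((𝔪 : Ideal A) : Set A) ⊆
      ⋃ i ∈ ((insert I hf.toFinset : Finset (Ideal A)) : Set (Ideal A)),
        ((id i : Ideal A) : Set A) := by
    intro x hx
    by_contra hx'
    simp only [Set.mem_iUnion, not_exists, id] at hx'
    have h2 : sdiv (low d P) x ≤ low d P := by
      intro a ha
      by_contra ha'
      obtain ⟨p, hp, hap⟩ := exists_mem_assP ha'
      exact hx' p (by simp [hp]) (hap (Submodule.mem_colon_singleton.2 ha))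
    exact hx' I (by simp) (h x ⟨hx, low_adj_eq_top hP ((sdiv_mono (le_low _ _) x).trans h2)⟩)
  obtain ⟨p, hp, hmp⟩ := (Ideal.subset_union_prime I I (fun i hi hi' _ => by
    simp only [Finset.mem_insert, Set.Finite.mem_toFinset, hi', false_or] at hi
    exact hi.1)).1 h1
  simp only [Finset.mem_insert, Set.Finite.mem_toFinset] at hp
  rcases hp with rfl | hp
  · exact hmp
  · exact absurd (by simpa using hmp) (pow_not_le_of_mem_assP_low (k := 1) hp)

theorem hKill_of_forall_isPar {d r : ℕ} {P : Submodule A N} (hP : low (d + 1) P = ⊤)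
    (h : ∀ x : A, IsPar d P x → HKill P r (Ideal.span {x})) : HKill P r 𝔪 := by
  intro i hi c hc z
  have := le_of_forall_isPar hP (I := Module.annihilator A (Hc i P))
    fun x hx => Module.mem_annihilator.2 (hKill_span_singleton.1 (h x hx) i hi)
  exact Module.mem_annihilator.1 (this hc) z

/-- The length of the image of multiplication by `x` on a local cohomology module. -/
noncomputable def rlen (x : A) (i : ℕ) (P : Submodule A N) : ℕ∞ :=
  Module.length A (LinearMap.range (LinearMap.lsmul A (Hc i P) x))

theorem length_eq_ker_add_range {V W : Type} [AddCommGroup V] [Module A V] [AddCommGroup W]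
    [Module A W] (f : V →ₗ[A] W) : Module.length A V =
      Module.length A (LinearMap.ker f) + Module.length A (LinearMap.range f) :=
  Module.length_eq_add_of_exact (LinearMap.ker f).subtype f.rangeRestrict
    (Submodule.subtype_injective _) f.surjective_rangeRestrict
    (by
      rw [LinearMap.exact_iff, LinearMap.ker_rangeRestrict, Submodule.range_subtype])

theorem hlen_adj_add {P : Submodule A N} {x : A} (hx : sdiv P x ≤ sat P) (i : ℕ) :
    hlen i (adj P x) + rlen x i P + rlen x (i + 1) P = hlen i P + hlen (i + 1) P := by
  obtain ⟨p, δ, hp, hpd, hd⟩ := exists_hc_les hx i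
  have h1 : LinearMap.ker p = LinearMap.range (LinearMap.lsmul A (Hc i P) x) := by
    ext h
    rw [LinearMap.mem_ker, hp, LinearMap.mem_range]
    rfl
  have h2 : LinearMap.range δ = LinearMap.ker (LinearMap.lsmul A (Hc (i + 1) P) x) := by
    ext h
    rw [LinearMap.mem_ker, LinearMap.mem_range, ← hd]
    rfl
  have h3 := length_eq_ker_add_range p
  have h4 := length_eq_ker_add_range δ
  have h5 := length_eq_ker_add_range (LinearMap.lsmul A (Hc (i + 1) P) x)
  rw [h1] at h3
  rw [LinearMap.exact_iff.1 hpd, h2] at h4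
  unfold hlen rlen
  rw [h3, h4, h5]
  ac_rfl

theorem hKill_of_rlen {x : A} {i : ℕ} {P : Submodule A N} (h : rlen x i P = 0) (z : Hc i P) :
    x • z = 0 := by
  have h1 : Subsingleton (LinearMap.range (LinearMap.lsmul A (Hc i P) x)) :=
    Module.length_eq_zero_iff.1 h
  have h2 := Subsingleton.elim (⟨x • z, z, rfl⟩ : LinearMap.range (LinearMap.lsmul A (Hc i P) x)) 0
  exact congrArg Subtype.val h2

theorem rlen_le (x : A) (i : ℕ) (P : Submodule A N) : rlen x i P ≤ hlen i P := by
  rw [hlen, length_eq_ker_add_range (LinearMap.lsmul A (Hc i P) x)]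
  exact le_add_self

theorem sum_choose_succ (s : ℕ) (f : ℕ → ℤ) :
    ∑ i ∈ Finset.range (s + 1), (s.choose i : ℤ) * (f i + f (i + 1)) =
      ∑ i ∈ Finset.range (s + 1 + 1), ((s + 1).choose i : ℤ) * f i := by
  simp only [mul_add]
  rw [Finset.sum_add_distrib, Finset.sum_range_succ' _ (s + 1)]
  simp only [Nat.choose_succ_succ, Nat.cast_add, add_mul, Finset.sum_add_distrib]
  rw [Finset.sum_range_succ' _ s,
    Finset.sum_range_succ (fun i => ((s.choose (i + 1) : ℕ) : ℤ) * f (i + 1)) s]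
  simp
  ring

theorem hn_adj_add {P : Submodule A N} {x : A} (hx : sdiv P x ≤ sat P) {i : ℕ}
    (h0 : hlen i P ≠ ⊤) (h1 : hlen (i + 1) P ≠ ⊤) :
    hn i (adj P x) + ((rlen x i P).toNat : ℤ) + ((rlen x (i + 1) P).toNat : ℤ) =
      hn i P + hn (i + 1) P := by
  have h := hlen_adj_add hx i
  have h2 : rlen x i P ≠ ⊤ := ne_top_of_le_ne_top h0 (rlen_le _ _ _)
  have h3 : rlen x (i + 1) P ≠ ⊤ := ne_top_of_le_ne_top h1 (rlen_le _ _ _)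
  have h4 : hlen i (adj P x) ≠ ⊤ := by
    intro h4
    rw [h4, top_add, top_add] at h
    exact (WithTop.add_ne_top.2 ⟨h0, h1⟩) h.symm
  unfold hn
  generalize hlen i (adj P x) = a at *
  generalize hlen i P = b at *
  generalize hlen (i + 1) P = c at *
  generalize rlen x i P = d at *
  generalize rlen x (i + 1) P = e at *
  lift a to ℕ using h4
  lift b to ℕ using h0
  lift c to ℕ using h1
  lift d to ℕ using h2
  lift e to ℕ using h3
  simp only [ENat.toNat_natCast]
  exact_mod_cast h

end EveryPar

section ParSeq

variable {A : Type} [CommRing A] [IsLocalRing A] [IsNoetherianRing A]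
  {N : Type} [AddCommGroup N] [Module A N] [Module.Finite A N]

local notation "𝔪" => maximalIdeal A

/-- The maximal ideal annihilates the zeroth local cohomology of `N ⧸ P`. -/
def SatKill (P : Submodule A N) : Prop := ∀ c ∈ 𝔪, ∀ a ∈ sat P, c • a ∈ P

/-- Part of a system of parameters, cutting the dimension down to at most `d`. -/
def SopLE (d : ℕ) (P : Submodule A N) (xs : List A) : Prop :=
  (∀ x ∈ xs, x ∈ 𝔪) ∧ low d (adjs P xs) = ⊤

theorem SopLE.tail {d : ℕ} {P : Submodule A N} {x : A} {xs : List A} (h : SopLE d P (x :: xs)) :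
    SopLE d (adj P x) xs := ⟨fun y hy => h.1 y (List.mem_cons_of_mem _ hy), h.2⟩

theorem SopLE.perm {d : ℕ} {P : Submodule A N} {xs ys : List A} (hxs : xs.Perm ys)
    (h : SopLE d P xs) : SopLE d P ys :=
  ⟨fun y hy => h.1 y (hxs.mem_iff.2 hy), by rw [← adjs_perm P hxs]; exact h.2⟩

theorem SopLE.low_eq_top {d : ℕ} {P : Submodule A N} {xs : List A} (h : SopLE d P xs) :
    low (d + xs.length) P = ⊤ := by
  induction xs generalizing P with
  | nil => exact h.2
  | cons x xs ih => exact low_succ_eq_top (h.1 x (by simp)) (ih h.tail)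

theorem SopLE.isPar {d : ℕ} {P : Submodule A N} {xs : List A} (h : SopLE d P xs) {y : A}
    (hy : y ∈ xs) : IsPar (d + (xs.length - 1)) P y := by
  obtain ⟨l, hl⟩ := exists_perm_cons hy
  have h' := h.perm hl
  rw [hl.length_eq]
  exact ⟨h.1 y hy, h'.tail.low_eq_top⟩

theorem SopLE.append {d : ℕ} {P : Submodule A N} {l₁ l₂ : List A} (h : SopLE d P (l₁ ++ l₂)) :
    SopLE (d + l₂.length) P l₁ :=
  ⟨fun x hx => h.1 x (List.mem_append_left _ hx),
    SopLE.low_eq_top ⟨fun x hx => h.1 x (List.mem_append_right _ hx),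
      by rw [← adjs_append]; exact h.2⟩⟩

theorem SopLE.append_right {d : ℕ} {P : Submodule A N} {l₁ l₂ : List A}
    (h : SopLE d P (l₁ ++ l₂)) : SopLE d (adjs P l₁) l₂ :=
  ⟨fun x hx => h.1 x (List.mem_append_right _ hx), by rw [← adjs_append]; exact h.2⟩

theorem SopLE.pow {d : ℕ} {P : Submodule A N} {x : A} {xs : List A} (h : SopLE d P (x :: xs))
    {n : ℕ} (hn : 1 ≤ n) : SopLE d P (x ^ n :: xs) := by
  refine ⟨?_, top_le_iff.1 ?_⟩
  · intro y hy
    rcases List.mem_cons.1 hy with rfl | hy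
    · exact Ideal.pow_mem_of_mem _ (h.1 x (by simp)) n hn
    · exact h.1 y (by simp [hy])
  · rw [le_low_iff]
    intro p hp
    have hx : x ∈ p.asIdeal := p.2.mem_of_pow_mem n (hp (Submodule.mem_colon.2 fun a _ => by
      rw [adjs_cons]
      exact le_adjs _ _ (smul_mem_adj P _ a)))
    refine le_low_iff.1 h.2.ge p (le_trans (Submodule.colon_mono ?_ subset_rfl)
      (colon_le_of_smul_sup p.2 ((Ideal.span_singleton_le_iff_mem _).2 hx) hp))
    rw [adjs_eq, adjs_eq, Ideal.ofList_cons, Ideal.ofList_cons, Submodule.sup_smul,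
      Submodule.sup_smul]
    refine sup_le (le_sup_left.trans le_sup_left) (sup_le le_sup_right
      (le_sup_right.trans (le_sup_right.trans le_sup_left)))

theorem SopLE.cons {d : ℕ} {P : Submodule A N} {x : A} {xs : List A} (hx : x ∈ 𝔪)
    (h : SopLE d (adj P x) xs) : SopLE d P (x :: xs) :=
  ⟨fun y hy => (List.mem_cons.1 hy).elim (fun e => e ▸ hx) (h.1 y), h.2⟩

theorem DSeq.cons {d K : ℕ} {P : Submodule A N} {x : A} {xs : List A} (h : SopLE d P (x :: xs))
    (hK : HKill P (d + xs.length + 1) (𝔪 ^ K)) (hP : SatKill P) (hd : DSeq (adj P x) xs) :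
    DSeq P (x :: xs) := by
  have h1 : ∀ y ∈ x :: xs, sdiv P y ≤ sat P := fun y hy => (h.isPar hy).sdiv_le hK
  refine ⟨fun y hy a ha => hP y (h.1 y hy) a ?_, hd⟩
  exact sdiv_sat_le (h1 y hy) (h1 x (by simp) ha)

theorem DSeq.of_satKill {d : ℕ} (xs : List A) : ∀ (P : Submodule A N) (K : ℕ), SopLE d P xs →
    HKill P (d + xs.length) (𝔪 ^ K) →
    (∀ l₁ l₂, xs = l₁ ++ l₂ → l₂ ≠ [] → SatKill (adjs P l₁)) → DSeq P xs := by
  induction xs with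
  | nil => exact fun P K _ _ _ => trivial
  | cons x xs ih =>
    intro P K h hK hS
    refine DSeq.cons h hK (hS [] _ rfl (by simp)) (ih _ (K + K) h.tail ?_ ?_)
    · rw [pow_add]
      exact HKill.adj ((h.isPar (List.mem_cons_self)).sdiv_le hK) hK hK
    · rintro l₁ l₂ rfl h₂
      exact hS (x :: l₁) l₂ rfl h₂

/-- `N ⧸ P` is generalized Cohen–Macaulay in dimension at most `s + 2`, and the first Hilbert
coefficient of each d-sequence of parameters is extremal. -/
structure Extremal (s : ℕ) (P : Submodule A N) : Prop where
  low_eq_top : low (s + 2) P = ⊤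
  exists_hKill : ∃ K, HKill P (s + 2) (𝔪 ^ K)
  le_E : ∀ xs : List A, xs.length = s + 2 → DSeq P xs → Sop P xs → Sg s P ≤ E P xs

theorem exists_kills {r K : ℕ} {P : Submodule A N} (hP : low r P = ⊤) (hK : HKill P r (𝔪 ^ K)) :
    ∃ xs : List A, xs.length = r ∧ Kills P xs ∧ DSeq P xs ∧ Sop P xs := by
  obtain ⟨xs, rfl, hxs, h⟩ := exists_deep r (2 ^ r * K) [P] (by simpa using hP)
  obtain ⟨hd, hs⟩ := h P (by simp)
  exact ⟨xs, rfl, kills_of_deep xs P K hK hs fun y hy =>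
    Ideal.pow_le_pow_right (Nat.le_succ _) (hxs y hy), hd, hs⟩

theorem Extremal.hlen_ne_top {s : ℕ} {P : Submodule A N} (h : Extremal s P) {i : ℕ}
    (hi : i < s + 2) : hlen i P ≠ ⊤ := by
  obtain ⟨K, hK⟩ := h.exists_hKill
  obtain ⟨xs, hl, hk, -, -⟩ := exists_kills h.low_eq_top hK
  exact hk.hlen_ne_top i (hl ▸ hi)

theorem Extremal.sdiv_le {s : ℕ} {P : Submodule A N} (h : Extremal s P) {x : A}
    (hx : IsPar (s + 1) P x) : sdiv P x ≤ sat P := by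
  obtain ⟨K, hK⟩ := h.exists_hKill
  exact hx.sdiv_le hK

theorem Extremal.dSeq_cons {s : ℕ} {P : Submodule A N} (h : Extremal s P) (hP : SatKill P) {x : A}
    {xs : List A} (hx : x ∈ 𝔪) (hl : xs.length = s + 1) (hd : DSeq (adj P x) xs)
    (hs : Sop (adj P x) xs) : DSeq P (x :: xs) := by
  obtain ⟨K, hK⟩ := h.exists_hKill
  refine DSeq.cons (d := 0) (K := K) (SopLE.cons hx hs) ?_ hP hd
  rwa [zero_add, hl]

theorem Sop.cons {P : Submodule A N} {x : A} {xs : List A} (hx : x ∈ 𝔪)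
    (h : Sop (adj P x) xs) : Sop P (x :: xs) := SopLE.cons hx h

theorem Extremal.exists_hKill_adj {s : ℕ} {P : Submodule A N} (h : Extremal s P) {x : A}
    (hx : IsPar (s + 1) P x) : ∃ K, HKill (adj P x) (s + 1) (𝔪 ^ K) := by
  obtain ⟨K, hK⟩ := h.exists_hKill
  refine ⟨K + K, ?_⟩
  rw [pow_add]
  exact HKill.adj (hx.sdiv_le hK) hK hK

theorem Extremal.rlen_eq_zero {s : ℕ} {P : Submodule A N} (h : Extremal s P) (hP : SatKill P)
    {x : A} (hx : IsPar (s + 1) P x) {i : ℕ} (hi : i < s + 1) : rlen x (i + 1) P = 0 := by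
  obtain ⟨K, hK⟩ := h.exists_hKill_adj hx
  obtain ⟨ys, hl, hk, hd, hs⟩ := exists_kills hx.2 hK
  have hd' := h.dSeq_cons hP hx.1 hl hd hs
  have hE := h.le_E (x :: ys) (by simp [hl]) hd' (Sop.cons hx.1 hs)
  have hsd := h.sdiv_le hx
  have hne : ∀ j < s + 1, rlen x (j + 1) P ≠ ⊤ := fun j hj =>
    ne_top_of_le_ne_top (h.hlen_ne_top (by omega)) (rlen_le _ _ _)
  cases s with
  | zero =>
    obtain ⟨y, rfl⟩ := List.length_eq_one_iff.1 hl
    obtain ⟨h2, h3⟩ := E_two_eq hx.1 hd' (Sop.cons hx.1 hs)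
    obtain rfl : i = 0 := by omega
    rw [h3] at hE
    have h4 : Sg 0 P = hn 1 P := by simp [Sg]
    rw [h4] at hE
    have h5 := length_eq_ker_add_range (LinearMap.lsmul A (Hc 1 P) x)
    have h6 := h.hlen_ne_top (i := 1) (by omega)
    have h7 : rlen x 1 P ≠ ⊤ := hne 0 (by omega)
    change rlen x 1 P = 0
    unfold hn at hE
    unfold rlen at *
    unfold hlen at *
    generalize Module.length A (Hc 1 P) = a at *
    generalize Module.length A (LinearMap.ker (LinearMap.lsmul A (Hc 1 P) x)) = b at *
    generalize Module.length A (LinearMap.range (LinearMap.lsmul A (Hc 1 P) x)) = c at *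
    lift a to ℕ using h6
    lift b to ℕ using h2
    lift c to ℕ using h7
    simp only [ENat.toNat_natCast] at hE
    norm_cast at h5 hE ⊢
    omega
  | succ s =>
    rw [E_cons _ _ _ (by omega), hk.E_eq s hl] at hE
    have h1 : ∀ j ∈ Finset.range (s + 1), hn (j + 1) (adj P x) = hn (j + 1) P + hn (j + 2) P -
        ((rlen x (j + 1) P).toNat + (rlen x (j + 2) P).toNat) := by
      intro j hj
      rw [Finset.mem_range] at hj
      have := hn_adj_add hsd (h.hlen_ne_top (i := j + 1) (by omega))
        (h.hlen_ne_top (i := j + 1 + 1) (by omega))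
      linarith
    have h2 : Sg s (adj P x) = Sg (s + 1) P - ∑ j ∈ Finset.range (s + 1), (s.choose j : ℤ) *
        ((rlen x (j + 1) P).toNat + (rlen x (j + 2) P).toNat) := by
      rw [Sg, Sg, ← sum_choose_succ s fun j => hn (j + 1) P, ← Finset.sum_sub_distrib]
      exact Finset.sum_congr rfl fun j hj => by rw [h1 j hj, mul_sub]
    have h3 : ∀ j ∈ Finset.range (s + 1), 0 ≤ (s.choose j : ℤ) *
        ((rlen x (j + 1) P).toNat + (rlen x (j + 2) P).toNat) := fun j _ => by positivity
    have h4 := (Finset.sum_eq_zero_iff_of_nonneg h3).1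
      (le_antisymm (by linarith) (Finset.sum_nonneg h3))
    have h5 : ∀ j < s + 1, (rlen x (j + 1) P).toNat = 0 ∧ (rlen x (j + 2) P).toNat = 0 := by
      intro j hj
      have h6 := h4 j (Finset.mem_range.2 hj)
      have h7 : (s.choose j : ℤ) ≠ 0 := by
        exact_mod_cast (Nat.choose_pos (Nat.lt_succ_iff.1 hj)).ne'
      have h8 := (mul_eq_zero.1 h6).resolve_left h7
      constructor <;> omega
    have h6 : (rlen x (i + 1) P).toNat = 0 := by
      rcases Nat.lt_or_ge i (s + 1) with h7 | h7
      · exact (h5 i h7).1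
      · obtain rfl : i = s + 1 := by omega
        exact (h5 s (by omega)).2
    exact (ENat.toNat_eq_zero.1 h6).resolve_right (hne i hi)

theorem Extremal.hKill_span {s : ℕ} {P : Submodule A N} (h : Extremal s P) (hP : SatKill P)
    {x : A} (hx : IsPar (s + 1) P x) : HKill P (s + 2) (Ideal.span {x}) := by
  rw [hKill_span_singleton]
  intro i hi
  cases i with
  | zero => exact hc_zero_smul_iff.2 (hP x hx.1)
  | succ i => exact hKill_of_rlen (h.rlen_eq_zero hP hx (by omega))

theorem Extremal.hKill {s : ℕ} {P : Submodule A N} (h : Extremal s P) (hP : SatKill P) :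
    HKill P (s + 2) 𝔪 :=
  hKill_of_forall_isPar h.low_eq_top fun _ hx => h.hKill_span hP hx

theorem Extremal.to_adj {s : ℕ} {P : Submodule A N} (h : Extremal (s + 1) P) (hP : SatKill P)
    {x : A} (hx : IsPar (s + 2) P x) : Extremal s (adj P x) where
  low_eq_top := hx.2
  exists_hKill := h.exists_hKill_adj hx
  le_E xs hl hd hs := by
    have hk := h.hKill_span hP hx
    rw [hKill_span_singleton] at hk
    have hsd := h.sdiv_le hx
    rw [← E_cons P x xs (by omega)]
    refine le_trans (le_of_eq ?_) (h.le_E (x :: xs) (by simp [hl]) (h.dSeq_cons hP hx.1 hl hd hs)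
      (Sop.cons hx.1 hs))
    refine Sg_succ_of_add fun i hi => ?_
    have h1 := hlen_adj hsd (hk (i + 1) (by omega)) (hk (i + 2) (by omega))
    refine hn_add_of_hlen h1 ?_
    rw [h1]
    exact WithTop.add_ne_top.2 ⟨h.hlen_ne_top (by omega), h.hlen_ne_top (by omega)⟩

theorem Extremal.to_adjs (T : List A) : ∀ {s : ℕ} {P : Submodule A N}, Extremal (s + T.length) P →
    (∀ l₁ l₂, T = l₁ ++ l₂ → l₂ ≠ [] → SatKill (adjs P l₁)) → SopLE (s + 2) P T →
    Extremal s (adjs P T) := by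
  induction T with
  | nil => exact fun h _ _ => h
  | cons x T ih =>
    intro s P h hS hT
    have hx : IsPar (s + T.length + 2) P x :=
      ⟨hT.1 x (by simp), by rw [add_right_comm]; exact hT.tail.low_eq_top⟩
    refine ih (Extremal.to_adj (s := s + T.length) h (hS [] _ rfl (by simp)) hx) ?_ hT.tail
    rintro l₁ l₂ rfl h₂
    exact hS (x :: l₁) l₂ rfl h₂

end ParSeq

section EverySop

variable {A : Type} [CommRing A] [IsLocalRing A] [IsNoetherianRing A]
  {N : Type} [AddCommGroup N] [Module A N] [Module.Finite A N]

local notation "𝔪" => maximalIdeal A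

theorem smul_mem_sat_adj_sq {P : Submodule A N} {x : A} {w : N} (hw : w ∈ sat (adj P x)) :
    x • w ∈ sat (adj P (x ^ 2)) := by
  obtain ⟨k, hk⟩ := mem_sat.1 hw
  refine mem_sat.2 ⟨k, fun c hc => ?_⟩
  obtain ⟨b, hb⟩ := mem_adj.1 (hk c hc)
  refine mem_adj.2 ⟨b, ?_⟩
  have := P.smul_mem x hb
  rwa [smul_sub, smul_smul x x, ← pow_two, smul_comm] at this

theorem sat_adj_sup_inf_le {P : Submodule A N} {x x' : A} {R : List A} (hx' : x' ∈ 𝔪)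
    (hxm : x ∈ 𝔪) (hx : sdiv P x ≤ sat P)
    (hd : DSeq (adj P (x ^ 2)) (x' :: R)) (h₁ : SatKill (adj P x'))
    (h₂ : SatKill (adj P (x ^ 2))) :
    (sat (adj P x) ⊔ adjs P (x :: x' :: R)) ⊓ (sat (adj P x') ⊔ adjs P (x :: x' :: R)) ≤
      sat P ⊔ adjs P (x :: x' :: R) := by
  set B := adjs P (x :: x' :: R) with hB
  have hB' : B = adj (adjs P (x' :: R)) x := by
    have := adjs_perm P (xs := x :: x' :: R) (ys := (x' :: R) ++ [x])
      (List.perm_append_singleton x (x' :: R)).symm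
    rw [hB, this, adjs_append]
    rfl
  have hxB : ∀ e : N, x • e ∈ B := fun e => hB' ▸ smul_mem_adj _ x e
  rintro a ⟨ha, ha'⟩
  obtain ⟨w, hw, b, hb, rfl⟩ := Submodule.mem_sup.1 ha
  have hw' : w ∈ sat (adj P x') ⊔ B := by
    have := sub_mem ha' (Submodule.mem_sup_right hb : b ∈ sat (adj P x') ⊔ B)
    rwa [add_sub_cancel_right] at this
  obtain ⟨w', hw'', b', hb', rfl⟩ := Submodule.mem_sup.1 hw'
  rw [hB'] at hb'
  obtain ⟨e, he⟩ := mem_adj.1 hb'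
  have hw1 : w' + (b' - x • e) ∈ sat (adj P x) := by
    have := sub_mem hw (le_low 0 _ (smul_mem_adj P x e))
    rwa [add_sub_assoc] at this
  have hle : adjs P (x' :: R) ≤ adjs (adj P (x ^ 2)) (x' :: R) := adjs_mono (le_adj _ _) _
  have h1 : x • (w' + (b' - x • e)) ∈ adjs (adj P (x ^ 2)) (x' :: R) := by
    rw [smul_add]
    exact hle (add_mem (le_adjs (adj P x') R (h₁ x hxm w' hw'')) (Submodule.smul_mem _ _ he))
  have h2 := hd.mem_of_smul_mem h1 (h₂ x' hx' _ (smul_mem_sat_adj_sq hw1))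
  obtain ⟨c, hc⟩ := mem_adj.1 h2
  have h3 : w' + (b' - x • e) - x • c ∈ sat P := hx (by
    rw [mem_sdiv, smul_sub, smul_smul, ← pow_two]
    exact hc)
  have h4 : w' + b' + b = (w' + (b' - x • e) - x • c) + (x • (c + e) + b) := by
    rw [smul_add]
    abel
  rw [h4]
  exact Submodule.add_mem_sup h3 (add_mem (hxB _) hb)

theorem smul_mem_sat_sup_adj {P : Submodule A N} {z c : A} (hK : HKill P 2 𝔪)
    (hz : sdiv P z ≤ sat P) (hc : c ∈ 𝔪) {w : N} (hw : w ∈ sat (adj P z)) :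
    c • w ∈ sat P ⊔ adj P z := by
  obtain ⟨l, hl⟩ := exists_smul_sub_mem (d := 0) (K := 1) (sdiv_sat_le hz) (low_low 0 P).le
    (by rw [pow_one]; exact hK.of_sat (le_low 0 P) le_rfl) (by rwa [pow_one])
    (low_mono (adj_mono (le_low 0 P) z) hw)
  have := Submodule.add_mem_sup hl (smul_mem_adj P z l)
  rwa [sub_add_cancel] at this

theorem Extremal.satKill {s : ℕ} {U : Submodule A N} (h : Extremal s U) (hU : sat U ≤ U) (j : ℕ) :
    ∀ d, d + j = s + 2 → 1 ≤ d → ∀ S : List A, S.length = j → SopLE d U S →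
      SatKill (adjs U S) := by
  induction j using Nat.strong_induction_on with
  | _ j ih =>
  intro d hd h1 S hl hS c hc a ha
  cases j with
  | zero =>
    obtain rfl := List.length_eq_zero_iff.1 hl
    exact Submodule.smul_mem _ _ (hU ha)
  | succ j =>
  have hpre : ∀ l₁ l₂ : List A, SopLE d U (l₁ ++ l₂) → (l₁ ++ l₂).length = j + 1 → l₂ ≠ [] →
      SatKill (adjs U l₁) := by
    intro l₁ l₂ h' hl' h₂
    have := List.length_pos_iff.2 h₂
    rw [List.length_append] at hl'
    exact ih l₁.length (by omega) (d + l₂.length) (by omega) (by omega) l₁ rfl h'.append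
  have hpre' : ∀ l₁ l₂ : List A, SopLE d U (l₁ ++ l₂) → (l₁ ++ l₂).length = j + 1 → l₂ ≠ [] →
      Extremal (d + l₂.length - 2) (adjs U l₁) := by
    intro l₁ l₂ h' hl' h₂
    have h3 := List.length_pos_iff.2 h₂
    have h4 := hl'
    rw [List.length_append] at h4
    have h5 : s = d + l₂.length - 2 + l₁.length := by omega
    refine Extremal.to_adjs l₁ (h5 ▸ h) ?_ ?_
    · rintro t₁ t₂ rfl ht
      rw [List.append_assoc] at h' hl'
      exact hpre t₁ _ h' hl' (by simp [ht])
    · rw [show d + l₂.length - 2 + 2 = d + l₂.length by omega]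
      exact h'.append
  have main : ∀ l₂ : List A, l₂ ≠ [] → ∀ l₁ : List A, (l₁ ++ l₂).Perm S →
      c • a ∈ sat (adjs U l₁) ⊔ adjs U S := by
    intro l₂
    induction hn : l₂.length using Nat.strong_induction_on generalizing l₂ with
    | _ n ihn =>
    intro h₂ l₁ hp
    have h' := hS.perm hp.symm
    have hl' : (l₁ ++ l₂).length = j + 1 := hp.length_eq.trans hl
    have hX := hpre' l₁ l₂ h' hl' h₂
    have hQ := hpre l₁ l₂ h' hl' h₂
    have hpos := List.length_pos_iff.2 h₂
    have hsd : ∀ y ∈ l₂, sdiv (adjs U l₁) y ≤ sat (adjs U l₁) := fun y hy =>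
      hX.sdiv_le (by
        have := h'.append_right.isPar hy
        rwa [show d + l₂.length - 2 + 1 = d + (l₂.length - 1) by omega])
    rw [← adjs_perm U hp, adjs_append]
    rw [← adjs_perm U hp, adjs_append] at ha
    match l₂, h₂ with
    | [z], _ =>
      exact smul_mem_sat_sup_adj ((hX.hKill hQ).mono (by omega) le_rfl) (hsd z (by simp)) hc ha
    | x :: x' :: R, _ =>
      have hp1 : ((l₁ ++ [x]) ++ (x' :: R)).Perm S := by simpa using hp
      have hp2 : ((l₁ ++ [x']) ++ (x :: R)).Perm S := by
        refine List.Perm.trans ?_ hp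
        simp only [List.append_assoc, List.singleton_append]
        exact (List.Perm.swap _ _ _).append_left _
      have hp3 : SopLE d U ((l₁ ++ [x ^ 2]) ++ (x' :: R)) := by
        have h3 := (h'.perm List.perm_middle).pow (n := 2) (by omega)
        simpa using h3.perm List.perm_middle.symm
      have hl3 : ((l₁ ++ [x ^ 2]) ++ (x' :: R)).length = j + 1 := by
        rw [← hl']
        simp
      have e1 : ∀ z, adjs U (l₁ ++ [z]) = adj (adjs U l₁) z := fun z => by rw [adjs_append]; rfl
      simp only [List.length_cons] at hn
      have m1 := ihn _ (by simp; omega) (x' :: R) rfl (by simp) (l₁ ++ [x]) hp1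
      have m2 := ihn _ (by simp; omega) (x :: R) rfl (by simp) (l₁ ++ [x']) hp2
      rw [← adjs_perm U hp, adjs_append U l₁ (x :: x' :: R), e1] at m1 m2
      have hxm : x ∈ 𝔪 := h'.1 x (by simp)
      have hx'm : x' ∈ 𝔪 := h'.1 x' (by simp)
      refine sat_adj_sup_inf_le hx'm hxm (hsd x (by simp)) ?_ ?_ ?_ ⟨m1, m2⟩
      · have hpar : IsPar (d + R.length + 1) (adjs U l₁) (x ^ 2) := by
          have h4 : SopLE d U (l₁ ++ (x ^ 2 :: x' :: R)) := by simpa using hp3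
          have := h4.append_right.isPar (y := x ^ 2) (by simp)
          simpa [add_assoc] using this
        obtain ⟨K, hK⟩ := hX.exists_hKill_adj (x := x ^ 2) (by
          rwa [show d + (x :: x' :: R).length - 2 + 1 = d + R.length + 1 by simp; omega])
        refine DSeq.of_satKill (d := d) (x' :: R) _ K ?_ ?_ ?_
        · rw [← e1]
          exact hp3.append_right
        · rwa [show d + (x :: x' :: R).length - 2 + 1 = d + (x' :: R).length by simp; omega] at hK
        · intro t₁ t₂ ht ht₂
          rw [← e1, ← adjs_append]
          rw [ht, ← List.append_assoc] at hp3 hl3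
          exact hpre _ t₂ hp3 hl3 ht₂
      · rw [← e1]
        exact hpre _ _ (hS.perm hp2.symm) (hp2.length_eq.trans hl) (by simp)
      · rw [← e1]
        exact hpre _ _ hp3 hl3 (by simp)
  have h2 := main S (by rintro rfl; simp at hl) [] (by simp)
  rwa [adjs_nil, sup_eq_right.2 (hU.trans (le_adjs U S))] at h2

theorem Extremal.dSeq {s : ℕ} {U : Submodule A N} (h : Extremal s U) (hU : sat U ≤ U)
    {xs : List A} (hl : xs.length = s + 2) (hs : Sop U xs) : DSeq U xs := by
  obtain ⟨K, hK⟩ := h.exists_hKill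
  refine DSeq.of_satKill (d := 0) xs U K hs (by rwa [zero_add, hl]) ?_
  rintro l₁ l₂ rfl h₂
  have h3 := List.length_pos_iff.2 h₂
  rw [List.length_append] at hl
  exact h.satKill hU l₁.length (0 + l₂.length) (by omega) (by omega) l₁ rfl
    (SopLE.append (d := 0) hs)

theorem Sop.map_pow {U : Submodule A N} (l : List (A × ℕ)) (hl : ∀ p ∈ l, 1 ≤ p.2) :
    ∀ t : List A, Sop U (t ++ l.map Prod.fst) → Sop U (t ++ l.map fun p => p.1 ^ p.2) := by
  induction l with
  | nil => exact fun t h => h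
  | cons p l ih =>
    intro t h
    have h1 : Sop U ((t ++ [p.1 ^ p.2]) ++ l.map Prod.fst) := by
      have h2 := Sop.pow (Sop.perm List.perm_middle h) (hl p (by simp))
      simpa using Sop.perm List.perm_middle.symm h2
    simpa using ih (fun q hq => hl q (by simp [hq])) _ h1

theorem Extremal.std {s : ℕ} {U : Submodule A N} (h : Extremal s U) (hU : sat U ≤ U)
    {xs : List A} (hl : xs.length = s + 2) (hs : Sop U xs) : Std U xs := by
  intro l hp hn
  refine h.dSeq hU (by simpa using hp.length_eq.trans hl) ?_
  exact Sop.map_pow l hn [] (hs.perm hp.symm)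

end EverySop

section HilbertSamuel

open Pointwise

/-- `f` eventually agrees with a polynomial of degree less than `d`, expressed by iterated
differences. -/
def EvPoly : ℕ → (ℕ → ℤ) → Prop
  | 0, f => ∃ N₀, ∀ n ≥ N₀, f n = 0
  | d + 1, f => EvPoly d fun n => f (n + 1) - f n

theorem EvPoly.sub : ∀ {d : ℕ} {f g : ℕ → ℤ}, EvPoly d f → EvPoly d g →
    EvPoly d fun n => f n - g n
  | 0, f, g, ⟨a, ha⟩, ⟨b, hb⟩ => ⟨max a b, fun n hn => by
      beta_reduce
      rw [ha n (le_trans (le_max_left _ _) hn), hb n (le_trans (le_max_right _ _) hn), sub_zero]⟩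
  | d + 1, f, g, hf, hg => by
    have := EvPoly.sub (d := d) hf hg
    refine cast (congrArg (EvPoly d) (funext fun n => ?_)) this
    ring

theorem EvPoly.shift : ∀ {d : ℕ} {f : ℕ → ℤ}, EvPoly d f → EvPoly d fun n => f (n + 1)
  | 0, _, ⟨a, ha⟩ => ⟨a, fun _ hn => ha _ (Nat.le_succ_of_le hn)⟩
  | d + 1, _, hf => EvPoly.shift (d := d) hf

theorem numPoly_pred (r : ℕ) : ∀ c : ℕ → ℤ, ∃ c' : ℕ → ℤ,
    ∀ n, numPoly r c n = numPoly r c' (n + 1) := by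
  induction r with
  | zero => exact fun c => ⟨c, fun n => by simp [numPoly]⟩
  | succ r ih =>
    intro c
    obtain ⟨c', hc'⟩ := ih c
    refine ⟨fun i => if i ≤ r then (c' i - (if i = r then c (r + 1) else 0)) else c (r + 1),
      fun n => ?_⟩
    have h1 : numPoly r (fun i => if i ≤ r then (c' i - (if i = r then c (r + 1) else 0))
        else c (r + 1)) (n + 1) =
          numPoly r c' (n + 1) - c (r + 1) * ((n + 1 + r).choose r : ℤ) := by
      unfold numPoly
      rw [Finset.sum_range_succ, Finset.sum_range_succ _ r]
      have : ∀ i ∈ Finset.range r, (if i ≤ r then (c' i - (if i = r then c (r + 1) else 0))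
        else c (r + 1)) * ((n + 1 + i).choose i : ℤ) = c' i * ((n + 1 + i).choose i : ℤ) := by
        intro i hi
        rw [Finset.mem_range] at hi
        rw [if_pos hi.le, if_neg hi.ne, sub_zero]
      rw [Finset.sum_congr rfl this]
      simp
      ring
    rw [numPoly_succ, numPoly_succ, h1, hc']
    have h2 : (n + 1 + (r + 1)).choose (r + 1) =
        (n + 1 + r).choose r + (n + (r + 1)).choose (r + 1) := by
      rw [show n + 1 + (r + 1) = (n + 1 + r) + 1 by ring, Nat.choose_succ_succ,
        show n + 1 + r = n + (r + 1) by ring]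
    rw [h2, if_neg (by omega)]
    push_cast
    ring

theorem EvPoly.exists_numPoly : ∀ {r : ℕ} {f : ℕ → ℤ}, EvPoly (r + 1) f →
    ∃ (c : ℕ → ℤ) (N₀ : ℕ), ∀ n ≥ N₀, f n = numPoly r c n
  | 0, f, ⟨a, ha⟩ => ⟨fun _ => f a, a, fun n hn => by
      induction n, hn using Nat.le_induction with
      | base => simp [numPoly]
      | succ n hn ih =>
        have := ha n hn
        simp only [numPoly] at ih ⊢
        simp only [zero_add, Finset.range_one, Finset.sum_singleton, Nat.choose_zero_right] at ih ⊢
        linarith⟩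
  | r + 1, f, hf => by
    obtain ⟨c, a, ha⟩ := EvPoly.exists_numPoly (r := r) (f := fun n => f (n + 1) - f n) hf
    obtain ⟨c', hc'⟩ := numPoly_pred r c
    let g : ℕ → ℤ := fun i => i.casesOn 0 c'
    have hg : ∀ n, numPoly (r + 1) g (n + 1) = numPoly (r + 1) g n + numPoly r c n := fun n => by
      rw [numPoly_diff, hc']
    let v : ℤ := f a - numPoly (r + 1) g a
    have hv : ∀ n, numPoly (r + 1) (fun i => i.casesOn v c') n = v + numPoly (r + 1) g n := by
      intro n
      simp only [numPoly, g]
      rw [Finset.sum_range_succ', Finset.sum_range_succ' _ (r + 1)]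
      simp
      ring
    refine ⟨fun i => i.casesOn v c', a, fun n hn => ?_⟩
    rw [hv]
    induction n, hn using Nat.le_induction with
    | base => simp [v]
    | succ n hn ih =>
      have := ha n hn
      rw [hg]
      linarith

variable {A : Type} [CommRing A] [IsLocalRing A] [IsNoetherianRing A]
  {N : Type} [AddCommGroup N] [Module A N] [Module.Finite A N]

theorem length_quotient_colon (V U K : Submodule A N) (x : A)
    (hK : ∀ a, a ∈ K ↔ a ∈ U ∧ x • a ∈ V) :
    Module.length A (N ⧸ V) + Module.length A (N ⧸ U) =
      Module.length A (N ⧸ K) + Module.length A (N ⧸ (V ⊔ x • U)) := by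
  have h1 := length_quotient_sup K K U (inf_eq_right.2 fun a ha => ((hK a).1 ha).1)
  have h2 := length_quotient_sup V V (V ⊔ x • U) (inf_eq_right.2 le_sup_left)
  rw [sup_eq_left.2 (fun a ha => ((hK a).1 ha).1)] at h1
  rw [sup_eq_left.2 le_sup_left] at h2
  have h3 : Module.length A (U.map K.mkQ) = Module.length A ((V ⊔ x • U).map V.mkQ) := by
    let f : N ⧸ K →ₗ[A] N ⧸ V := K.mapQ V (LinearMap.lsmul A N x) fun a ha => ((hK a).1 ha).2
    let g : U.map K.mkQ →ₗ[A] N ⧸ V := f.comp (Submodule.subtype _)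
    have hg : LinearMap.range g = (V ⊔ x • U).map V.mkQ := by
      rw [LinearMap.range_comp, Submodule.range_subtype, Submodule.map_sup, Submodule.mkQ_map_self,
        bot_sup_eq]
      ext z
      simp only [Submodule.mem_map, exists_exists_and_eq_and]
      constructor
      · rintro ⟨a, ha, rfl⟩
        exact ⟨x • a, Submodule.smul_mem_pointwise_smul _ _ _ ha, rfl⟩
      · rintro ⟨b, hb, rfl⟩
        obtain ⟨a, ha, rfl⟩ := hb
        exact ⟨a, ha, rfl⟩
    rw [← hg]
    refine (LinearEquiv.ofInjective g ?_).length_eq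
    rw [injective_iff_map_eq_zero]
    rintro ⟨z, hz⟩ h
    obtain ⟨a, ha, rfl⟩ := hz
    have h4 : x • a ∈ V := (Submodule.Quotient.mk_eq_zero V).1 h
    exact Subtype.ext ((Submodule.Quotient.mk_eq_zero K).2 ((hK a).2 ⟨ha, h4⟩))
  rw [h1, h2, h3]
  ac_rfl

variable {Q : Ideal A}

/-- The filtration by elements of `U` that `x` carries into the next step of `V`. -/
def colonFil (U V : Q.Filtration N) (x : A) : Q.Filtration N where
  N n := U.N n ⊓ sdiv (V.N (n + 1)) x
  mono n := inf_le_inf (U.mono n) (sdiv_mono (V.mono (n + 1)) x)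
  smul_le n := by
    refine Submodule.smul_le.2 fun q hq a ha => ⟨U.smul_le n (Submodule.smul_mem_smul hq ha.1), ?_⟩
    rw [SetLike.mem_coe, mem_sdiv, smul_comm]
    exact V.smul_le (n + 1) (Submodule.smul_mem_smul hq ha.2)

/-- The shifted filtration. -/
def shiftFil (U : Q.Filtration N) : Q.Filtration N where
  N n := U.N (n + 1)
  mono n := U.mono (n + 1)
  smul_le n := U.smul_le (n + 1)

/-- The filtration `V (n + 1) + x U n`. -/
def adjFil (U V : Q.Filtration N) (x : A) : Q.Filtration N where
  N n := V.N (n + 1) ⊔ x • U.N n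
  mono n := sup_le_sup (V.mono (n + 1)) (Submodule.map_mono (U.mono n))
  smul_le n := by
    rw [Submodule.smul_sup]
    refine sup_le_sup (V.smul_le (n + 1)) (Submodule.smul_le.2 fun q hq a ha => ?_)
    obtain ⟨b, hb, rfl⟩ := ha
    exact ⟨q • b, U.smul_le n (Submodule.smul_mem_smul hq hb), smul_comm x q b⟩

/-- The length of a quotient, as an integer. -/
noncomputable def qlen (V : Submodule A N) : ℤ := ((Module.length A (N ⧸ V)).toNat : ℤ)

theorem length_ne_top_of_le {V V' : Submodule A N} (h : V ≤ V')
    (hV : Module.length A (N ⧸ V) ≠ ⊤) : Module.length A (N ⧸ V') ≠ ⊤ :=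
  ne_top_of_le_ne_top hV (Module.length_le_of_surjective _ (Submodule.factor_surjective h))

theorem evPoly_qlen (xs : List A) : ∀ (J : Ideal A) (U V : Q.Filtration N),
    Q = Ideal.ofList xs ⊔ J → U.Stable → V ≤ U → (∀ n, J • U.N n ≤ V.N (n + 1)) →
    (∀ n, Module.length A (N ⧸ V.N n) ≠ ⊤) →
    EvPoly xs.length fun n => qlen (V.N n) - qlen (U.N n) := by
  induction xs with
  | nil =>
    intro J U V hQ hU hVU hJ _
    rw [Ideal.ofList_nil, bot_sup_eq] at hQ
    obtain ⟨n₀, hn₀⟩ := hU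
    refine ⟨n₀ + 1, fun n hn => ?_⟩
    obtain ⟨n, rfl⟩ : ∃ k, n = k + 1 := ⟨n - 1, by omega⟩
    have h1 : U.N (n + 1) ≤ V.N (n + 1) := by
      rw [← hn₀ n (by omega)]
      exact hQ.symm ▸ hJ n
    have h2 : V.N (n + 1) = U.N (n + 1) := le_antisymm (hVU (n + 1)) h1
    beta_reduce
    rw [h2, sub_self]
  | cons x xs ih =>
    intro J U V hQ hU hVU hJ hV
    have hQ' : Q = Ideal.ofList xs ⊔ (J ⊔ Ideal.span {x}) := by
      rw [hQ, Ideal.ofList_cons, sup_comm (Ideal.span {x}), sup_assoc, sup_comm J]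
    have hxQ : x ∈ Q := by
      rw [hQ']
      exact Submodule.mem_sup_right (Submodule.mem_sup_right (Ideal.mem_span_singleton_self x))
    have hVK : V ≤ colonFil U V x := fun n a ha =>
      ⟨hVU n ha, V.smul_le n (Submodule.smul_mem_smul hxQ ha)⟩
    have h1 := ih (J ⊔ Ideal.span {x}) (colonFil U V x) V hQ'
      (hU.of_le fun n => inf_le_left) hVK (fun n => by
        rw [Submodule.sup_smul, Submodule.ideal_span_singleton_smul]
        refine sup_le ((Submodule.smul_mono le_rfl inf_le_left).trans (hJ n)) ?_
        rintro _ ⟨a, ha, rfl⟩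
        exact ha.2) hV
    have h2 := ih (J ⊔ Ideal.span {x}) (shiftFil U) (adjFil U V x) hQ'
      (by
        obtain ⟨n₀, hn₀⟩ := hU
        exact ⟨n₀, fun n hn => hn₀ (n + 1) (by omega)⟩)
      (fun n => by
        refine sup_le (hVU (n + 1)) ?_
        rintro _ ⟨a, ha, rfl⟩
        exact U.smul_le n (Submodule.smul_mem_smul hxQ ha))
      (fun n => by
        rw [Submodule.sup_smul, Submodule.ideal_span_singleton_smul]
        exact sup_le_sup (hJ (n + 1)) le_rfl)
      (fun n => length_ne_top_of_le le_sup_left (hV (n + 1)))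
    refine cast (congrArg (EvPoly xs.length) (funext fun n => ?_)) (h2.sub h1)
    have h3 := length_quotient_colon (V.N (n + 1)) (U.N n) ((colonFil U V x).N n) x
      fun a => Iff.rfl
    change qlen (V.N (n + 1) ⊔ x • U.N n) - qlen (U.N (n + 1)) -
      (qlen (V.N n) - qlen ((colonFil U V x).N n)) = _
    have f1 := hV (n + 1)
    have f2 := length_ne_top_of_le (hVU n) (hV n)
    have f3 := length_ne_top_of_le (hVK n) (hV n)
    have f4 := length_ne_top_of_le (V := V.N (n + 1)) (V' := V.N (n + 1) ⊔ x • U.N n)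
      le_sup_left (hV (n + 1))
    have h4 : qlen (V.N (n + 1)) + qlen (U.N n) =
        qlen ((colonFil U V x).N n) + qlen (V.N (n + 1) ⊔ x • U.N n) := by
      unfold qlen
      rw [← Nat.cast_add, ← Nat.cast_add, ← ENat.toNat_add f1 f2, ← ENat.toNat_add f3 f4, h3]
    linarith

theorem exists_length_eq_numPoly (xs : List A)
    (h : ∀ n, Module.length A (N ⧸ (Ideal.ofList xs ^ n • ⊤ : Submodule A N)) ≠ ⊤) :
    ∃ (c : ℕ → ℤ) (N₀ : ℕ), ∀ n ≥ N₀, ∃ l : ℕ,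
      Module.length A (N ⧸ (Ideal.ofList xs ^ (n + 1) • ⊤ : Submodule A N)) = l ∧
      (l : ℤ) = numPoly xs.length c n := by
  have h1 := evPoly_qlen (Q := Ideal.ofList xs) (N := N) xs ⊥
    ((Ideal.ofList xs).stableFiltration ⊤) (shiftFil ((Ideal.ofList xs).stableFiltration ⊤))
    (by simp) (Ideal.stableFiltration_stable _ _) 
    (fun n => ((Ideal.ofList xs).stableFiltration (⊤ : Submodule A N)).mono n)
    (by simp) (fun n => h (n + 1))
  have h2 : EvPoly (xs.length + 1)
      fun n => qlen (Ideal.ofList xs ^ n • ⊤ : Submodule A N) := h1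
  obtain ⟨c, a, ha⟩ := h2.shift.exists_numPoly
  refine ⟨c, a, fun n hn => ⟨_, (ENat.natCast_toNat (h (n + 1))).symm, ha n hn⟩⟩

end HilbertSamuel

section SopLift

variable {A : Type} [CommRing A] [IsLocalRing A] [IsNoetherianRing A]
  {N : Type} [AddCommGroup N] [Module A N] [Module.Finite A N]

local notation "𝔪" => maximalIdeal A

theorem exists_add_notMem {S : Set (Ideal A)} (hS : S.Finite) (hp : ∀ p ∈ S, p.IsPrime)
    (hanti : ∀ p ∈ S, ∀ q ∈ S, p ≤ q → p = q) {I : Ideal A} {x : A}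
    (hI : ∀ p ∈ S, I ≤ p → x ∉ p) : ∃ a ∈ I, ∀ p ∈ S, x + a ∉ p := by
  classical
  set S₂ := hS.toFinset.filter fun p => x ∉ p with hS₂
  obtain ⟨a, ha, ha'⟩ := exists_mem_notMem_of_finite (I ⊓ S₂.inf id) (S := {p ∈ S | x ∈ p})
    (hS.subset fun p hp => hp.1) (fun q hq => ⟨hp q hq.1, by
    intro h
    rcases ((hp q hq.1).inf_le.1 h) with h | h
    · exact hI q hq.1 h hq.2
    · obtain ⟨p, hpS, hpq⟩ := (hp q hq.1).inf_le'.1 h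
      simp only [hS₂, Finset.mem_filter, Set.Finite.mem_toFinset] at hpS
      exact hpS.2 (hanti p hpS.1 q hq.1 hpq ▸ hq.2)⟩)
  refine ⟨a, ha.1, fun p hpS h => ?_⟩
  by_cases hx : x ∈ p
  · exact ha' p ⟨hpS, hx⟩ ((p.add_mem_iff_right hx).1 h)
  · have : a ∈ p := (Finset.inf_le (f := id) (by simp [hS₂, hpS, hx]) : S₂.inf id ≤ p) ha.2
    exact hx ((p.add_mem_iff_left this).1 h)

theorem adj_congr {U : Submodule A N} {x x' : A} (h : ∀ b : N, (x' - x) • b ∈ U) :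
    adj U x' = adj U x := by
  ext a
  rw [mem_adj, mem_adj]
  refine exists_congr fun b => ?_
  have e : a - x • b = (a - x' • b) + (x' - x) • b := by
    rw [sub_smul]
    abel
  rw [e, U.add_mem_iff_left (h b)]

theorem eq_of_mem_assP_low {d : ℕ} {P : Submodule A N} (hP : low (d + 1) P = ⊤) {p q : Ideal A}
    (hp : p ∈ assP (low d P)) (hq : q ∈ assP (low d P)) (h : p ≤ q) : p = q := by
  by_contra hne
  have h1 := not_coheight_le_of_mem_assP_low hq
  have h2 : Order.coheight (⟨p, hp.1⟩ : PrimeSpectrum A) ≤ ((d + 1 : ℕ) : ℕ∞) := by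
    refine le_low_iff.1 hP.ge _ ?_
    obtain ⟨-, a, rfl⟩ := hp
    exact Submodule.colon_mono (le_low _ _) (Set.subset_univ _)
  refine h1 ?_
  have h3 : (⟨p, hp.1⟩ : PrimeSpectrum A) < ⟨q, hq.1⟩ := lt_of_le_of_ne h fun e =>
    hne (congrArg PrimeSpectrum.asIdeal e)
  have h4 := Order.coheight_add_one_le h3
  have h5 := h4.trans h2
  push_cast at h5
  exact (ENat.add_le_add_iff_right (by simp)).1 h5

theorem exists_sop_lift {I : Ideal A} (hIm : I ≤ 𝔪) (xs : List A) : ∀ (P U : Submodule A N),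
    low xs.length P = ⊤ → Sop U xs → I • (⊤ : Submodule A N) ≤ U →
    (∀ p : Ideal A, p.IsPrime → I ≤ p → P.colon ((⊤ : Submodule A N) : Set N) ≤ p →
      U.colon ((⊤ : Submodule A N) : Set N) ≤ p) →
    ∃ xs' : List A, List.Forall₂ (fun x' x => x' - x ∈ I) xs' xs ∧ Sop P xs' := by
  induction xs with
  | nil => exact fun P U hP _ _ _ => ⟨[], List.Forall₂.nil, by simp, hP⟩
  | cons x xs ih =>
    intro P U hP hU hI hH
    have hI' : ∀ p ∈ assP (low xs.length P), I ≤ p → x ∉ p := by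
      intro p hp hIp hx
      refine not_coheight_le_of_mem_assP_low hp (le_low_iff.1 hU.tail.low_eq_top.ge _
        (colon_le_of_smul_sup hp.1 ((Ideal.span_singleton_le_iff_mem _).2 hx)
          (hH p hp.1 hIp ?_)))
      obtain ⟨-, a, rfl⟩ := hp
      exact Submodule.colon_mono (le_low _ _) (Set.subset_univ _)
    obtain ⟨a, ha, hap⟩ := exists_add_notMem (assP_finite (low xs.length P)) (fun p hp => hp.1)
      (fun p hp q hq h => eq_of_mem_assP_low hP hp hq h) hI'
    have hsd : sdiv (low xs.length P) (x + a) ≤ low xs.length P := by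
      intro b hb
      by_contra hb'
      obtain ⟨p, hp, hbp⟩ := exists_mem_assP hb'
      exact hap p hp (hbp (Submodule.mem_colon_singleton.2 hb))
    have hlow := low_adj_eq_top hP ((sdiv_mono (le_low _ _) _).trans hsd)
    have hadj : adj U (x + a) = adj U x := adj_congr fun b => by
      rw [add_sub_cancel_left]
      exact hI (Submodule.smul_mem_smul ha trivial)
    obtain ⟨xs', hxs', hs⟩ := ih (adj P (x + a)) (adj U x) hlow hU.tail (hI.trans (le_adj _ _)) (by
      intro p hp hIp hPp
      have h1 := hH p hp hIp ((Submodule.colon_mono (le_adj _ _) subset_rfl).trans hPp)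
      rw [← hadj]
      exact colon_le_of_smul_sup hp ((Ideal.span_singleton_le_iff_mem _).2
        (hPp (Submodule.mem_colon.2 fun b _ => smul_mem_adj P _ b))) h1)
    refine ⟨(x + a) :: xs', List.Forall₂.cons (by rwa [add_sub_cancel_left]) hxs', Sop.cons ?_ hs⟩
    exact add_mem (hU.1 x (by simp)) (hIm ha)

theorem cf_congr {I : Ideal A} {xs' xs : List A}
    (h : List.Forall₂ (fun x' x => x' - x ∈ I) xs' xs) : ∀ (U : Submodule A N),
    I • (⊤ : Submodule A N) ≤ U → cf U xs' = cf U xs := by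
  induction h with
  | nil => exact fun _ _ => rfl
  | @cons x' x xs' xs hx _ ih =>
    intro U hU
    have h1 := ih (adj U x) (hU.trans (le_adj U x))
    have h2 : adj U x' = adj U x := adj_congr fun b => hU (Submodule.smul_mem_smul hx trivial)
    funext i
    match i with
    | 0 => rfl
    | 1 => simp only [cf, h1, h2]
    | i + 2 => simp only [cf, h1, h2]

theorem exists_of_mem_forall₂ {α β : Type} {R : α → β → Prop} {l : List α} {l' : List β}
    (h : List.Forall₂ R l l') {y : α} (hy : y ∈ l) : ∃ z ∈ l', R y z := by
  induction h with
  | nil => simp at hy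
  | @cons a b _ _ hab _ ih =>
    rcases List.mem_cons.1 hy with rfl | hy
    · exact ⟨b, by simp, hab⟩
    · obtain ⟨z, hz, hyz⟩ := ih hy
      exact ⟨z, by simp [hz], hyz⟩

theorem DSeq.congr {I : Ideal A} {xs' xs : List A}
    (h : List.Forall₂ (fun x' x => x' - x ∈ I) xs' xs) : ∀ {U : Submodule A N},
    I • (⊤ : Submodule A N) ≤ U → DSeq U xs → DSeq U xs' := by
  induction h with
  | nil => exact fun _ _ => trivial
  | @cons x' x xs' xs hx hxs ih =>
    intro U hU hd
    have key : ∀ {y' y : A}, y' - y ∈ I → ∀ b : N, y' • b ∈ U ↔ y • b ∈ U := by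
      intro y' y hy b
      have e : y' • b = y • b + (y' - y) • b := by
        rw [sub_smul]
        abel
      rw [e, U.add_mem_iff_left (hU (Submodule.smul_mem_smul hy trivial))]
    refine ⟨fun y' hy' a ha => ?_, ?_⟩
    · obtain ⟨y, hy, hyy⟩ := exists_of_mem_forall₂
        (R := fun x' x => x' - x ∈ I) (List.Forall₂.cons hx hxs) hy'
      refine (key hyy a).2 (hd.1 y hy a ?_)
      have h1 := (key hx (y' • a)).1 ha
      rw [smul_comm] at h1
      have h2 := (key hyy (x • a)).1 h1
      rwa [smul_comm] at h2
    · rw [adj_congr fun b => hU (Submodule.smul_mem_smul hx trivial)]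
      exact ih (hU.trans (le_adj _ _)) hd.2

end SopLift

section Core

variable {A : Type} [CommRing A] [IsLocalRing A] [IsNoetherianRing A]
  {N : Type} [AddCommGroup N] [Module A N] [Module.Finite A N]

local notation "𝔪" => maximalIdeal A

theorem length_quotient_ne_top_iff {F : Submodule A N} :
    Module.length A (N ⧸ F) ≠ ⊤ ↔ sat F = ⊤ := by
  constructor
  · intro h
    obtain ⟨C, hC⟩ := ENat.ne_top_iff_exists.1 h
    refine top_le_iff.1 (le_sat_of_pow (k := C) fun c hc a _ => ?_)
    have := exists_pow_smul_of_length_le C hC.ge c hc (F.mkQ a)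
    rwa [← map_smul, Submodule.mkQ_apply, Submodule.Quotient.mk_eq_zero] at this
  · intro h
    obtain ⟨k, hk⟩ := exists_pow_le_colon (W := ⊤) h.ge
    rw [Module.length_ne_top_iff]
    refine isFiniteLength_of_pow_smul (k := k) fun c hc w => ?_
    obtain ⟨a, rfl⟩ := F.mkQ_surjective w
    rw [← map_smul, Submodule.mkQ_apply, Submodule.Quotient.mk_eq_zero]
    exact hk c hc a trivial

theorem sat_pow_smul_eq_top {I : Ideal A} (h : sat (I • ⊤ : Submodule A N) = ⊤) (n : ℕ) :
    sat (I ^ n • ⊤ : Submodule A N) = ⊤ := by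
  induction n with
  | zero =>
    rw [pow_zero, Ideal.one_eq_top, Submodule.top_smul]
    exact top_le_iff.1 (le_low 0 _)
  | succ n ih =>
    obtain ⟨k, hk⟩ := exists_pow_le_colon (W := ⊤) h.ge
    obtain ⟨l, hl⟩ := exists_pow_le_colon (W := ⊤) ih.ge
    refine top_le_iff.1 (le_sat_of_pow (k := l + k) fun c hc a _ => ?_)
    have h1 : (𝔪 ^ k • ⊤ : Submodule A N) ≤ I • ⊤ :=
      Submodule.smul_le.2 fun c hc a _ => hk c hc a trivial
    have h2 : (𝔪 ^ l • ⊤ : Submodule A N) ≤ I ^ n • ⊤ :=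
      Submodule.smul_le.2 fun c hc a _ => hl c hc a trivial
    have h3 : (𝔪 ^ (l + k) • ⊤ : Submodule A N) ≤ I ^ (n + 1) • ⊤ := by
      rw [pow_add, mul_smul, pow_succ', mul_smul]
      calc 𝔪 ^ l • 𝔪 ^ k • (⊤ : Submodule A N) ≤ 𝔪 ^ l • I • ⊤ := Submodule.smul_mono le_rfl h1
        _ = I • 𝔪 ^ l • ⊤ := by rw [← mul_smul, ← mul_smul, mul_comm]
        _ ≤ I • I ^ n • ⊤ := Submodule.smul_mono le_rfl h2
    exact h3 (Submodule.smul_mem_smul hc trivial)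

theorem Sop.sat_eq_top {xs : List A} (h : Sop (⊥ : Submodule A N) xs) :
    sat (Ideal.ofList xs • ⊤ : Submodule A N) = ⊤ := by
  have := h.2
  rwa [adjs_eq, bot_sup_eq] at this

theorem Sop.exists_hP {xs : List A} (h : Sop (⊥ : Submodule A N) xs) :
    ∃ c, HP (⊥ : Submodule A N) (Ideal.ofList xs) xs.length c := by
  obtain ⟨c, N₀, hc⟩ := exists_length_eq_numPoly (N := N) xs fun n =>
    length_quotient_ne_top_iff.2 (sat_pow_smul_eq_top h.sat_eq_top n)
  refine ⟨c, N₀, fun n hn => ?_⟩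
  rw [fil, bot_sup_eq]
  exact hc n hn

theorem Sop.coeff_eq_E {s : ℕ} {U : Submodule A N} {xs : List A} {c : ℕ → ℤ}
    (hs : Sop (⊥ : Submodule A N) xs) (hl : xs.length = s + 2) (hd : DSeq U xs)
    (hU : U ≤ low s ⊥) (hc : HP (⊥ : Submodule A N) (Ideal.ofList xs) (s + 2) c) :
    c (s + 1) = E U xs := by
  have h1 := hd.hP (hs.mono bot_le)
  rw [hl] at h1
  rw [HP.coeff_eq hs.ofList_le (by rw [bot_sup_eq]; exact hs.sat_eq_top) bot_le hU hc h1
    (s + 1) (by omega) (by omega), E, hl]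
  rfl

theorem Sg_low_eq_of_coeff_eq {s : ℕ} (h2 : low (s + 2) (⊥ : Submodule A N) = ⊤) {C : ℤ}
    (hC : ∀ xs : List A, xs.length = s + 2 → Sop (⊥ : Submodule A N) xs →
      ∀ c, HP (⊥ : Submodule A N) (Ideal.ofList xs) (s + 2) c → c (s + 1) = C)
    {U : Submodule A N} (hU2 : low (s + 2) U = ⊤) (hU : U ≤ low s ⊥) {K : ℕ}
    (hK : HKill U (s + 2) (𝔪 ^ K)) : Sg s U = C := by
  obtain ⟨zs, hzl, hzm, hzs⟩ := exists_deep (s + 2) (2 ^ (s + 2) * K) [⊥, U] (by simp [h2, hU2])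
  have hz1 := hzs ⊥ (by simp)
  have hz2 := hzs U (by simp)
  have hk := kills_of_deep zs U K (hzl ▸ hK) hz2.2
    fun y hy => Ideal.pow_le_pow_right (by rw [hzl]; exact Nat.le_succ _) (hzm y hy)
  obtain ⟨c, hc⟩ := hz1.2.exists_hP
  rw [hzl] at hc
  rw [← hk.E_eq s hzl, ← hz1.2.coeff_eq_E hzl hz2.1 hU hc, hC zs hzl hz1.2 c hc]

theorem E_eq_of_coeff_eq {s : ℕ} (h2 : low (s + 2) (⊥ : Submodule A N) = ⊤) {C : ℤ}
    (hC : ∀ xs : List A, xs.length = s + 2 → Sop (⊥ : Submodule A N) xs →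
      ∀ c, HP (⊥ : Submodule A N) (Ideal.ofList xs) (s + 2) c → c (s + 1) = C)
    {U : Submodule A N} (hU1 : U ≠ ⊤) (hU : U ≤ low s ⊥) {ys : List A} (hyl : ys.length = s + 2)
    (hyd : DSeq U ys) (hys : Sop U ys) : E U ys = C := by
  have hIU : U.colon ((⊤ : Submodule A N) : Set N) • (⊤ : Submodule A N) ≤ U :=
    Submodule.smul_le.2 fun c hc a _ => Submodule.mem_colon.1 hc a trivial
  have hIm : U.colon ((⊤ : Submodule A N) : Set N) ≤ 𝔪 := by
    refine IsLocalRing.le_maximalIdeal fun h => hU1 (top_le_iff.1 fun a _ => ?_)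
    have := Submodule.mem_colon.1 (h ▸ Submodule.mem_top :
      (1 : A) ∈ U.colon ((⊤ : Submodule A N) : Set N)) a trivial
    rwa [one_smul] at this
  obtain ⟨ws, hws, hw⟩ := exists_sop_lift hIm ys (⊥ : Submodule A N) U (hyl ▸ h2) hys
    hIU fun p _ hp _ => hp
  obtain ⟨d, hd⟩ := hw.exists_hP
  have hwl : ws.length = s + 2 := by rw [hws.length_eq, hyl]
  rw [hwl] at hd
  have e2 := hw.coeff_eq_E hwl (hyd.congr hws hIU) hU hd
  rw [hC ws hwl hw d hd, E, cf_congr hws _ hIU, hwl, ← hyl] at e2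
  exact e2.symm

theorem std_of_coeff_eq [IsAdicComplete 𝔪 A] {s : ℕ} (h2 : low (s + 2) (⊥ : Submodule A N) = ⊤)
    (h1 : low (s + 1) (⊥ : Submodule A N) ≠ ⊤) {C : ℤ}
    (hC : ∀ xs : List A, xs.length = s + 2 → Sop (⊥ : Submodule A N) xs →
      ∀ c, HP (⊥ : Submodule A N) (Ideal.ofList xs) (s + 2) c → c (s + 1) = C) :
    low (s + 1) (⊥ : Submodule A N) ≤ low s ⊥ ∧ ∀ xs : List A, xs.length = s + 2 →
      Sop (low (s + 1) (⊥ : Submodule A N)) xs → Std (low (s + 1) (⊥ : Submodule A N)) xs := by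
  have hbd : ∀ xs : List A, xs.length = s + 2 → DSeq (⊥ : Submodule A N) xs →
      Sop (⊥ : Submodule A N) xs → (∀ y ∈ xs, y ∈ 𝔪 ^ 0) → E (⊥ : Submodule A N) xs ≤ C.toNat :=
    fun xs hl hd hs _ => by
      obtain ⟨c, hc⟩ := hs.exists_hP
      rw [hl] at hc
      rw [← hs.coeff_eq_E hl hd bot_le hc, hC xs hl hs c hc]
      exact Int.self_le_toNat C
  have hUK := hKill_of_bounded s (⊥ : Submodule A N) h2 0 C.toNat hbd
  have hU := hUK.1
  have hK := hUK.2
  clear hUK hbd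
  refine ⟨hU, ?_⟩
  have hU2 : low (s + 2) (low (s + 1) (⊥ : Submodule A N)) = ⊤ := by
    rw [low_low_of_le (by omega), h2]
  have hU0 : sat (low (s + 1) (⊥ : Submodule A N)) ≤ low (s + 1) ⊥ :=
    (low_mono_dim (Nat.zero_le _) _).trans (low_low _ _).le
  generalize low (s + 1) (⊥ : Submodule A N) = U at *
  intro xs hl hs
  refine Extremal.std (s := s) ⟨hU2, ⟨_, hK⟩, fun ys hyl hyd hys => ?_⟩
    hU0 hl hs
  rw [Sg_low_eq_of_coeff_eq h2 hC hU2 hU hK, E_eq_of_coeff_eq h2 hC h1 hU hyl hyd hys]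

theorem coeff_eq_of_std {s : ℕ} (hU : low (s + 1) (⊥ : Submodule A N) ≤ low s ⊥)
    (hS : ∀ xs : List A, xs.length = s + 2 → Sop (low (s + 1) (⊥ : Submodule A N)) xs →
      ∃ ys : List A, ys.length = s + 2 ∧ Ideal.ofList ys = Ideal.ofList xs ∧
        Std (low (s + 1) (⊥ : Submodule A N)) ys)
    {xs : List A} (hl : xs.length = s + 2) (hs : Sop (⊥ : Submodule A N) xs) {c : ℕ → ℤ}
    (hc : HP (⊥ : Submodule A N) (Ideal.ofList xs) (s + 2) c) :
    c (s + 1) = Sg s (low (s + 1) (⊥ : Submodule A N)) := by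
  obtain ⟨ys, hyl, hyx, hy⟩ := hS xs hl (hs.mono bot_le)
  have hys : Sop (⊥ : Submodule A N) ys := by
    refine ⟨fun y hyy => hs.ofList_le (hyx ▸ Ideal.subset_span hyy), ?_⟩
    have := hs.2
    rwa [adjs_eq, ← hyx, ← adjs_eq] at this
  have hk := hy.kills (hys.mono bot_le)
  rw [← hyx] at hc
  rw [hys.coeff_eq_E hyl hk.dSeq hU hc, hk.E_eq s hyl]

end Core

section CompleteNoetherian

variable {R S : Type} [CommRing R] [CommRing S] [Algebra R S]

/-- The filtration of `R` by leading forms of elements of an ideal `J` of a completion `S`. -/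
def leadingFiltration (I : Ideal R) (J : Ideal S) : I.Filtration R where
  N n := I ^ n ⊓ (J ⊔ I.map (algebraMap R S) ^ (n + 1)).comap (algebraMap R S)
  mono n := inf_le_inf (Ideal.pow_le_pow_right n.le_succ)
    (Ideal.comap_mono (sup_le_sup_left (Ideal.pow_le_pow_right (n + 1).le_succ) _))
  smul_le n := Submodule.smul_le.2 fun c hc a ha => by
    refine ⟨?_, ?_⟩
    · rw [smul_eq_mul, pow_succ']
      exact Ideal.mul_mem_mul hc ha.1
    · rw [SetLike.mem_coe, Ideal.mem_comap]
      have h : algebraMap R S a ∈ J ⊔ I.map (algebraMap R S) ^ (n + 1) := ha.2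
      obtain ⟨j, hj, z, hz, hjz⟩ := Submodule.mem_sup.1 h
      rw [smul_eq_mul, map_mul, ← hjz, mul_add]
      refine add_mem (Ideal.mem_sup_left (J.mul_mem_left _ hj)) (Ideal.mem_sup_right ?_)
      rw [pow_succ']
      exact Ideal.mul_mem_mul (Ideal.mem_map_of_mem _ hc) hz

theorem exists_mul_sum_of_step {K J : Ideal S} (hS : IsAdicComplete K S) {t n₀ : ℕ} (g : Fin t → S)
    (step : ∀ (k : ℕ) (f : S), f ∈ J ⊓ K ^ (n₀ + k) → ∃ c : Fin t → S, (∀ i, c i ∈ K ^ k) ∧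
      f - ∑ i, c i * g i ∈ J ⊓ K ^ (n₀ + (k + 1))) {f : S} (hf : f ∈ J ⊓ K ^ n₀) :
    f ∈ Ideal.span (Set.range g) := by
  choose c hc hc' using step
  let F : (k : ℕ) → {f : S // f ∈ J ⊓ K ^ (n₀ + k)} := fun k =>
    Nat.rec ⟨f, hf⟩ (fun k z => ⟨z.1 - ∑ i, c k z.1 z.2 i * g i, hc' k z.1 z.2⟩) k
  let p : ℕ → Fin t → S := fun k i => ∑ j ∈ Finset.range k, c j (F j).1 (F j).2 i
  have hp : ∀ k, f - ∑ i, p k i * g i = (F k).1 := by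
    intro k
    induction k with
    | zero => simp [p, F]
    | succ k ih =>
      have h1 : (F (k + 1)).1 = (F k).1 - ∑ i, c k (F k).1 (F k).2 i * g i := rfl
      have h2 : ∑ i, p (k + 1) i * g i =
          ∑ i, p k i * g i + ∑ i, c k (F k).1 (F k).2 i * g i := by
        simp only [p, Finset.sum_range_succ, add_mul, Finset.sum_add_distrib]
      rw [h1, h2]
      linear_combination ih
  have hcau : ∀ i {m n : ℕ}, m ≤ n → p m i ≡ p n i [SMOD (K ^ m • ⊤ : Submodule S S)] := by
    intro i m n hmn
    rw [SModEq.comm, SModEq.sub_mem, Finset.sum_range_sub_sum_range hmn, smul_eq_mul, Ideal.mul_top]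
    refine sum_mem fun j hj => Ideal.pow_le_pow_right ?_ (hc j (F j).1 (F j).2 i)
    exact (Finset.mem_filter.1 hj).2
  choose L hL using fun i => hS.toIsPrecomplete.prec' (fun k => p k i) (hcau i)
  have h0 : f - ∑ i, L i * g i = 0 := by
    refine hS.toIsHausdorff.haus' _ fun k => ?_
    rw [SModEq.zero, smul_eq_mul, Ideal.mul_top]
    have h1 : f - ∑ i, L i * g i = (F k).1 + ∑ i, (p k i - L i) * g i := by
      simp only [sub_mul, Finset.sum_sub_distrib]
      linear_combination hp k
    rw [h1]
    refine add_mem (Ideal.pow_le_pow_right (by omega) (F k).2.2)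
      (sum_mem fun i _ => Ideal.mul_mem_right _ _ ?_)
    have := hL i k
    rwa [SModEq.sub_mem, smul_eq_mul, Ideal.mul_top] at this
  rw [sub_eq_zero.1 h0]
  exact sum_mem fun i _ => Ideal.mul_mem_left _ _ (Ideal.subset_span ⟨i, rfl⟩)

theorem isNoetherianRing_of_isAdicComplete [IsNoetherianRing R] {I : Ideal R}
    (hS : IsAdicComplete (I.map (algebraMap R S)) S)
    (h1 : ∀ n a, algebraMap R S a ∈ I.map (algebraMap R S) ^ n → a ∈ I ^ n)
    (h3 : ∀ n s, ∃ a, s - algebraMap R S a ∈ I.map (algebraMap R S) ^ n) :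
    IsNoetherianRing S := by
  set K := I.map (algebraMap R S) with hK
  refine isNoetherianRing_iff_ideal_fg S |>.2 fun J => ?_
  have hst : (leadingFiltration I J).Stable :=
    (I.stableFiltration_stable ⊤).of_le fun n => by
      change _ ≤ I ^ n • (⊤ : Submodule R R)
      rw [smul_eq_mul, Ideal.mul_top]
      exact inf_le_left
  obtain ⟨n₀, hn₀⟩ := hst.exists_pow_smul_eq
  obtain ⟨t, a, ha⟩ := Submodule.fg_iff_exists_fin_generating_family.1
    (IsNoetherian.noetherian ((leadingFiltration I J).N n₀))
  have haJ : ∀ i, ∃ g ∈ J, algebraMap R S (a i) - g ∈ K ^ (n₀ + 1) := by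
    intro i
    have h : a i ∈ (leadingFiltration I J).N n₀ := ha ▸ Submodule.subset_span ⟨i, rfl⟩
    obtain ⟨j, hj, z, hz, hjz⟩ := Submodule.mem_sup.1 (Ideal.mem_comap.1 h.2)
    exact ⟨j, hj, by rwa [← hjz, add_sub_cancel_left]⟩
  choose g hgJ hg using haJ
  have hle : J ⊓ K ^ n₀ ≤ Ideal.span (Set.range g) := by
    refine fun f hf => exists_mul_sum_of_step hS g ?_ hf
    intro k f hf
    obtain ⟨b, hb⟩ := h3 (n₀ + k + 1) f
    have hbK : algebraMap R S b ∈ K ^ (n₀ + k) := by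
      have := sub_mem hf.2 (Ideal.pow_le_pow_right (n₀ + k).le_succ hb)
      rwa [sub_sub_cancel] at this
    have hbN : b ∈ (leadingFiltration I J).N (n₀ + k) := by
      refine ⟨h1 _ _ hbK, Ideal.mem_comap.2 ?_⟩
      have := sub_mem (Ideal.mem_sup_left (T := K ^ (n₀ + k + 1)) hf.1) (Ideal.mem_sup_right hb)
      rwa [sub_sub_cancel] at this
    rw [hn₀, ← ha, Submodule.mem_ideal_smul_span_iff_exists_sum] at hbN
    obtain ⟨c, hc, hcb⟩ := hbN
    have hcK : ∀ i, algebraMap R S (c i) ∈ K ^ k := fun i => by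
      rw [hK, ← Ideal.map_pow]
      exact Ideal.mem_map_of_mem _ (hc i)
    refine ⟨fun i => algebraMap R S (c i), hcK,
      sub_mem hf.1 (sum_mem fun i _ => J.mul_mem_left _ (hgJ i)), ?_⟩
    have e : f - ∑ i, algebraMap R S (c i) * g i =
        (f - algebraMap R S b) + ∑ i, algebraMap R S (c i) * (algebraMap R S (a i) - g i) := by
      rw [← hcb, Finsupp.sum_fintype _ _ (by simp), map_sum]
      simp only [smul_eq_mul, map_mul, mul_sub, Finset.sum_sub_distrib]
      ring
    rw [e]
    refine add_mem hb (sum_mem fun i _ => ?_)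
    rw [show n₀ + (k + 1) = k + (n₀ + 1) by omega, pow_add]
    exact Ideal.mul_mem_mul (hcK i) (hg i)
  have hN : IsNoetherianRing (S ⧸ K ^ n₀) := by
    refine isNoetherianRing_of_surjective R _
      ((Ideal.Quotient.mk (K ^ n₀)).comp (algebraMap R S)) ?_
    intro y
    obtain ⟨y, rfl⟩ := Ideal.Quotient.mk_surjective y
    obtain ⟨b, hb⟩ := h3 n₀ y
    exact ⟨b, (Ideal.Quotient.eq.2 hb).symm⟩
  obtain ⟨v, b, hb⟩ := Submodule.fg_iff_exists_fin_generating_family.1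
    (IsNoetherian.noetherian (J.map (Ideal.Quotient.mk (K ^ n₀))))
  have hbJ : ∀ i, ∃ w ∈ J, Ideal.Quotient.mk (K ^ n₀) w = b i := fun i =>
    (Ideal.mem_map_iff_of_surjective _ Ideal.Quotient.mk_surjective).1
      (hb ▸ Submodule.subset_span ⟨i, rfl⟩)
  choose w hwJ hw using hbJ
  have hJ : J = Ideal.span (Set.range g) ⊔ Ideal.span (Set.range w) := by
    refine le_antisymm (fun f hf => ?_) (sup_le (Ideal.span_le.2 ?_) (Ideal.span_le.2 ?_))
    · have h : Ideal.Quotient.mk (K ^ n₀) f ∈ Submodule.span (S ⧸ K ^ n₀) (Set.range b) :=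
        hb ▸ Ideal.mem_map_of_mem _ hf
      have e : Submodule.span (S ⧸ K ^ n₀) (Set.range b) =
          (Ideal.span (Set.range w)).map (Ideal.Quotient.mk (K ^ n₀)) := by
        rw [Ideal.map_span, ← Set.range_comp]
        congr 2
        exact funext fun i => (hw i).symm
      rw [e, Ideal.mem_map_iff_of_surjective _ Ideal.Quotient.mk_surjective] at h
      obtain ⟨y, hy, hyf⟩ := h
      have hyJ : y ∈ J := (Ideal.span_le.2 (by rintro _ ⟨i, rfl⟩; exact hwJ i) : _ ≤ J) hy
      rw [← sub_add_cancel f y]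
      exact add_mem (Ideal.mem_sup_left (hle ⟨sub_mem hf hyJ, Ideal.Quotient.eq.1 hyf.symm⟩))
        (Ideal.mem_sup_right hy)
    · rintro _ ⟨i, rfl⟩
      exact hgJ i
    · rintro _ ⟨i, rfl⟩
      exact hwJ i
  rw [hJ]
  exact Submodule.FG.sup (Submodule.fg_span (Set.finite_range _))
    (Submodule.fg_span (Set.finite_range _))

end CompleteNoetherian

section MapSmul

variable {R S : Type} [CommRing R] [CommRing S] [Algebra R S] {M N : Type} [AddCommGroup M]
  [Module R M] [AddCommGroup N] [Module R N] [Module S N] [IsScalarTower R S N]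

theorem mem_map_smul_top_iff {I : Ideal R} {b : N} :
    b ∈ (I.map (algebraMap R S) • ⊤ : Submodule S N) ↔ b ∈ (I • ⊤ : Submodule R N) := by
  have h := Ideal.smul_restrictScalars I (⊤ : Submodule S N)
  rw [Submodule.restrictScalars_top] at h
  rw [← h, Submodule.restrictScalars_mem]

theorem map_mem_smul_top (ι : M →ₗ[R] N) {I : Ideal R} {a : M}
    (ha : a ∈ (I • ⊤ : Submodule R M)) : ι a ∈ (I.map (algebraMap R S) • ⊤ : Submodule S N) := by
  rw [mem_map_smul_top_iff]
  have h : ι a ∈ (I • ⊤ : Submodule R M).map ι := ⟨a, ha, rfl⟩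
  rw [Submodule.map_smul''] at h
  exact Submodule.smul_mono le_rfl le_top h

end MapSmul

section Comparison

variable {R S : Type} [CommRing R] [IsLocalRing R] [IsNoetherianRing R] [CommRing S]
  [IsLocalRing S] [IsNoetherianRing S] [Algebra R S] {M N : Type} [AddCommGroup M] [Module R M]
  [Module.Finite R M] [AddCommGroup N] [Module R N] [Module S N] [IsScalarTower R S N]
  [Module.Finite S N]

/-- The properties of the canonical map from a finite module to its completion that determine
the lengths of quotients by parameter ideals. -/
structure CompletionMap (S : Type) [CommRing S] [IsLocalRing S] [Algebra R S] [Module S N]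
    (ι : M →ₗ[R] N) : Prop where
  maximalIdeal_eq : maximalIdeal S = (maximalIdeal R).map (algebraMap R S)
  mem_of_mem : ∀ n a, ι a ∈ (maximalIdeal S ^ n • ⊤ : Submodule S N) →
    a ∈ (maximalIdeal R ^ n • ⊤ : Submodule R M)
  dense : ∀ n b, ∃ a, b - ι a ∈ (maximalIdeal S ^ n • ⊤ : Submodule S N)
  dense_ring : ∀ n s, ∃ a, s - algebraMap R S a ∈ maximalIdeal S ^ n

namespace CompletionMap

variable {ι : M →ₗ[R] N} (h : CompletionMap S ι)
include h

theorem exists_sub_mem {I : Ideal R} {b : N}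
    (hb : b ∈ (I.map (algebraMap R S) • ⊤ : Submodule S N)) (j : ℕ) :
    ∃ a ∈ (I • ⊤ : Submodule R M), b - ι a ∈ (maximalIdeal S ^ j • ⊤ : Submodule S N) := by
  rw [mem_map_smul_top_iff] at hb
  induction hb using Submodule.smul_induction_on' with
  | smul q hq b _ =>
    obtain ⟨a, ha⟩ := h.dense j b
    refine ⟨q • a, Submodule.smul_mem_smul hq trivial, ?_⟩
    rw [map_smul, ← smul_sub, ← algebraMap_smul S q]
    exact Submodule.smul_mem _ _ ha
  | add x _ y _ hx hy =>
    obtain ⟨a, ha, ha'⟩ := hx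
    obtain ⟨b, hb, hb'⟩ := hy
    refine ⟨a + b, add_mem ha hb, ?_⟩
    rw [map_add, add_sub_add_comm]
    exact add_mem ha' hb'

theorem mem_smul_top_iff {I : Ideal R} {a : M} :
    ι a ∈ (I.map (algebraMap R S) • ⊤ : Submodule S N) ↔ a ∈ (I • ⊤ : Submodule R M) := by
  refine ⟨fun ha => ?_, map_mem_smul_top ι⟩
  refine eq_of_forall_mem_sup_pow fun n => ?_
  obtain ⟨b, hb, hab⟩ := h.exists_sub_mem ha n
  rw [← map_sub] at hab
  rw [← sub_add_cancel a b, add_comm]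
  exact add_mem (Submodule.mem_sup_left hb) (Submodule.mem_sup_right (h.mem_of_mem n _ hab))

theorem sat_map_iff {I : Ideal R} :
    sat (I.map (algebraMap R S) • ⊤ : Submodule S N) = ⊤ ↔ sat (I • ⊤ : Submodule R M) = ⊤ := by
  constructor
  · intro hs
    obtain ⟨k, hk⟩ := exists_pow_le_colon (W := ⊤) hs.ge
    refine top_le_iff.1 (le_sat_of_pow (k := k) fun c hc a _ => h.mem_smul_top_iff.1 ?_)
    rw [map_smul, ← algebraMap_smul S c]
    refine hk _ ?_ _ trivial
    rw [h.maximalIdeal_eq, ← Ideal.map_pow]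
    exact Ideal.mem_map_of_mem _ hc
  · intro hs
    obtain ⟨k, hk⟩ := exists_pow_le_colon (W := ⊤) hs.ge
    have h1 : (maximalIdeal R ^ k • ⊤ : Submodule R M) ≤ I • ⊤ :=
      Submodule.smul_le.2 fun c hc a _ => hk c hc a trivial
    have h2 : (maximalIdeal S ^ k • ⊤ : Submodule S N) ≤ I.map (algebraMap R S) • ⊤ := by
      intro b hb
      refine eq_of_forall_mem_sup_pow fun n => ?_
      rw [h.maximalIdeal_eq, ← Ideal.map_pow] at hb
      obtain ⟨a, ha, hab⟩ := h.exists_sub_mem hb n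
      rw [← add_sub_cancel (ι a) b]
      exact add_mem (Submodule.mem_sup_left (map_mem_smul_top ι (h1 ha)))
        (Submodule.mem_sup_right hab)
    exact top_le_iff.1 (le_sat_of_pow (k := k) fun c hc a _ =>
      h2 (Submodule.smul_mem_smul hc trivial))

theorem length_eq {I : Ideal R} (hI : sat (I • ⊤ : Submodule R M) = ⊤) :
    Module.length S (N ⧸ (I.map (algebraMap R S) • ⊤ : Submodule S N)) =
      Module.length R (M ⧸ (I • ⊤ : Submodule R M)) := by
  obtain ⟨k, hk⟩ := exists_pow_le_colon (W := ⊤) (h.sat_map_iff.2 hI).ge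
  set V : Submodule S N := I.map (algebraMap R S) • ⊤ with hV
  have hk' : (maximalIdeal S ^ k • ⊤ : Submodule S N) ≤ V :=
    Submodule.smul_le.2 fun c hc a _ => hk c hc a trivial
  let f : M →ₗ[R] N ⧸ V := (V.mkQ.restrictScalars R) ∘ₗ ι
  have hf : Function.Surjective f := by
    intro b
    obtain ⟨b, rfl⟩ := V.mkQ_surjective b
    obtain ⟨a, ha⟩ := h.dense k b
    exact ⟨a, ((Submodule.Quotient.eq V).2 (hk' ha)).symm⟩
  have hker : LinearMap.ker f = I • ⊤ := by
    ext a
    rw [LinearMap.mem_ker, ← h.mem_smul_top_iff (S := S)]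
    exact Submodule.Quotient.mk_eq_zero V
  let o : Submodule S (N ⧸ V) ≃o Submodule R (N ⧸ V) :=
    { toFun := fun P => P.restrictScalars R
      invFun := fun P =>
        { P with
          smul_mem' := by
            intro c x hx
            obtain ⟨a, ha⟩ := h.dense_ring k c
            have e : c • x = a • x := by
              obtain ⟨y, rfl⟩ := V.mkQ_surjective x
              rw [← algebraMap_smul S a, ← sub_eq_zero, ← sub_smul, ← map_smul]
              exact (Submodule.Quotient.mk_eq_zero V).2 (hk _ ha _ trivial)
            rw [e]
            exact P.smul_mem a hx }
      left_inv := fun P => rfl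
      right_inv := fun P => rfl
      map_rel_iff' := Iff.rfl }
  have h1 : Module.length S (N ⧸ V) = Module.length R (N ⧸ V) := by
    have := Order.krullDim_eq_of_orderIso o
    rw [← Module.coe_length, ← Module.coe_length] at this
    exact_mod_cast this
  rw [h1, ← hker]
  exact (f.quotKerEquivOfSurjective hf).length_eq.symm

theorem sop_iff {xs : List R} :
    Sop (⊥ : Submodule S N) (xs.map (algebraMap R S)) ↔ Sop (⊥ : Submodule R M) xs := by
  have e : ∀ x, algebraMap R S x ∈ maximalIdeal S ↔ x ∈ maximalIdeal R := by
    intro x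
    refine ⟨fun hx => ?_, fun hx => h.maximalIdeal_eq ▸ Ideal.mem_map_of_mem _ hx⟩
    rw [mem_maximalIdeal, mem_nonunits_iff] at hx ⊢
    exact fun hu => hx (hu.map _)
  unfold Sop
  rw [adjs_eq, adjs_eq, bot_sup_eq, bot_sup_eq, ← Ideal.map_ofList, h.sat_map_iff]
  simp only [List.mem_map, forall_exists_index, and_imp, forall_apply_eq_imp_iff₂, e]

theorem hP_iff {I : Ideal R} (hI : sat (I • ⊤ : Submodule R M) = ⊤) {r : ℕ} {c : ℕ → ℤ} :
    HP (⊥ : Submodule S N) (I.map (algebraMap R S)) r c ↔ HP (⊥ : Submodule R M) I r c := by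
  have e : ∀ n, Module.length S (N ⧸ fil (⊥ : Submodule S N) (I.map (algebraMap R S)) n) =
      Module.length R (M ⧸ fil (⊥ : Submodule R M) I n) := by
    intro n
    unfold fil
    rw [bot_sup_eq, bot_sup_eq, ← Ideal.map_pow]
    exact h.length_eq (sat_pow_smul_eq_top hI n)
  simp only [HP, e]

theorem exists_list (k : ℕ) (ys : List S) : ∃ xs : List R, xs.length = ys.length ∧
    Ideal.ofList (xs.map (algebraMap R S)) ≤ Ideal.ofList ys ⊔ maximalIdeal S ^ k ∧
    Ideal.ofList ys ≤ Ideal.ofList (xs.map (algebraMap R S)) ⊔ maximalIdeal S ^ k := by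
  induction ys with
  | nil => exact ⟨[], rfl, le_sup_left, le_sup_left⟩
  | cons y ys ih =>
    obtain ⟨xs, hl, h1, h2⟩ := ih
    obtain ⟨x, hx⟩ := h.dense_ring k y
    refine ⟨x :: xs, by simp [hl], ?_, ?_⟩
    · rw [List.map_cons, Ideal.ofList_cons, Ideal.ofList_cons, sup_assoc]
      refine sup_le ((Ideal.span_singleton_le_iff_mem _).2 ?_) (h1.trans le_sup_right)
      rw [← sub_sub_cancel y (algebraMap R S x)]
      exact sub_mem (Ideal.mem_sup_left (Ideal.mem_span_singleton_self y))
        (Ideal.mem_sup_right (Ideal.mem_sup_right hx))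
    · rw [List.map_cons, Ideal.ofList_cons, Ideal.ofList_cons, sup_assoc]
      refine sup_le ((Ideal.span_singleton_le_iff_mem _).2 ?_) (h2.trans le_sup_right)
      rw [← sub_add_cancel y (algebraMap R S x)]
      exact add_mem (Ideal.mem_sup_right (Ideal.mem_sup_right hx))
        (Ideal.mem_sup_left (Ideal.mem_span_singleton_self _))

theorem exists_sop {ys : List S} (hy : Sop (⊥ : Submodule S N) ys) : ∃ xs : List R,
    xs.length = ys.length ∧ Sop (⊥ : Submodule R M) xs ∧ ∀ r c,
      HP (⊥ : Submodule R M) (Ideal.ofList xs) r c ↔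
        HP (⊥ : Submodule S N) (Ideal.ofList ys) r c := by
  obtain ⟨k, hk⟩ := exists_pow_le_colon (W := ⊤) hy.sat_eq_top.ge
  obtain ⟨xs, hl, h1, h2⟩ := h.exists_list (k + 1) ys
  have hk' : (maximalIdeal S ^ k • ⊤ : Submodule S N) ≤ Ideal.ofList ys • ⊤ :=
    Submodule.smul_le.2 fun c hc a _ => hk c hc a trivial
  set X := xs.map (algebraMap R S) with hX
  have e : (Ideal.ofList X • ⊤ : Submodule S N) = Ideal.ofList ys • ⊤ := by
    refine le_antisymm ?_ ?_
    · refine (Submodule.smul_mono h1 le_rfl).trans ?_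
      rw [Submodule.sup_smul]
      exact sup_le le_rfl
        ((Submodule.smul_mono (Ideal.pow_le_pow_right k.le_succ) le_rfl).trans hk')
    · refine Submodule.le_of_le_smul_of_le_jacobson_bot (IsNoetherian.noetherian _)
        (maximalIdeal_le_jacobson ⊥) ?_
      refine (Submodule.smul_mono h2 le_rfl).trans ?_
      rw [Submodule.sup_smul, pow_succ', mul_smul]
      exact sup_le_sup_left (Submodule.smul_mono le_rfl hk') _
  have e' : ∀ n, (Ideal.ofList X ^ n • ⊤ : Submodule S N) = Ideal.ofList ys ^ n • ⊤ := by
    intro n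
    induction n with
    | zero => rw [pow_zero, pow_zero]
    | succ n ih =>
      rw [pow_succ', mul_smul, ih, ← mul_smul, mul_comm, mul_smul, e, ← mul_smul, ← pow_succ]
  have hXm : ∀ x ∈ X, x ∈ maximalIdeal S := by
    intro x hx
    have h3 : Ideal.ofList ys ⊔ maximalIdeal S ^ (k + 1) ≤ maximalIdeal S :=
      sup_le hy.ofList_le (Ideal.pow_le_self k.succ_ne_zero)
    exact h3 (h1 (Ideal.subset_span hx))
  have hXs : Sop (⊥ : Submodule S N) X := by
    refine ⟨hXm, ?_⟩
    rw [adjs_eq, bot_sup_eq, e]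
    exact hy.sat_eq_top
  have hxs : Sop (⊥ : Submodule R M) xs := h.sop_iff.1 hXs
  refine ⟨xs, hl, hxs, fun r c => ?_⟩
  rw [← h.hP_iff hxs.sat_eq_top, Ideal.map_ofList, ← hX]
  have e'' : ∀ n, fil (⊥ : Submodule S N) (Ideal.ofList X) n = fil ⊥ (Ideal.ofList ys) n :=
    fun n => congrArg (⊥ ⊔ ·) (e' n)
  have e₃ : ∀ n, Module.length S (N ⧸ fil (⊥ : Submodule S N) (Ideal.ofList X) n) =
      Module.length S (N ⧸ fil (⊥ : Submodule S N) (Ideal.ofList ys) n) := fun n => by rw [e'']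
  simp only [HP, e₃]

theorem low_eq_top_iff {d : ℕ} : low d (⊥ : Submodule S N) = ⊤ ↔ low d (⊥ : Submodule R M) = ⊤ := by
  constructor
  · intro hd
    obtain ⟨ys, hl, -, hs⟩ := exists_deep d 0 [(⊥ : Submodule S N)] (by simpa using hd)
    obtain ⟨xs, hl', hs', -⟩ := h.exists_sop (hs ⊥ (by simp)).2
    rw [← hl, ← hl']
    exact hs'.low_eq_top
  · intro hd
    obtain ⟨xs, hl, -, hs⟩ := exists_deep d 0 [(⊥ : Submodule R M)] (by simpa using hd)
    have := (h.sop_iff.2 (hs ⊥ (by simp)).2).low_eq_top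
    rwa [List.length_map, hl] at this

end CompletionMap

end Comparison

section AdicCompletionComparison

variable (R : Type) [CommRing R] [IsLocalRing R] [IsNoetherianRing R]
  (M : Type) [AddCommGroup M] [Module R M] [Module.Finite R M]

theorem adicCompletion_module_finite :
    Module.Finite (AdicCompletion (maximalIdeal R) R) (AdicCompletion (maximalIdeal R) M) := by
  obtain ⟨s, hs⟩ := Module.Finite.fg_top (R := R) (M := M)
  refine ⟨Submodule.fg_def.2 ⟨(AdicCompletion.of (maximalIdeal R) M) '' s,
    s.finite_toSet.image _, top_le_iff.1 fun b hb => ?_⟩⟩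
  clear hb
  obtain ⟨z, rfl⟩ := AdicCompletion.ofTensorProduct_surjective_of_finite (maximalIdeal R) M b
  induction z using TensorProduct.induction_on with
  | zero => rw [map_zero]; exact zero_mem _
  | add x y hx hy => rw [map_add]; exact add_mem hx hy
  | tmul c a =>
    rw [AdicCompletion.ofTensorProduct_tmul]
    refine Submodule.smul_mem _ _ ?_
    have ha : a ∈ Submodule.span R (s : Set M) := hs ▸ trivial
    induction ha using Submodule.span_induction with
    | mem x hx =>
      exact Submodule.subset_span ⟨x, hx, rfl⟩
    | zero => rw [map_zero]; exact zero_mem _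
    | add x y _ _ hx hy => rw [map_add]; exact add_mem hx hy
    | smul c x _ hx =>
      rw [map_smul, ← algebraMap_smul (AdicCompletion (maximalIdeal R) R) c]
      exact Submodule.smul_mem _ _ hx

theorem mem_of_of_mem_pow_smul (n : ℕ) (a : M)
    (ha : AdicCompletion.of (maximalIdeal R) M a ∈
      (maximalIdeal R ^ n • ⊤ : Submodule R (AdicCompletion (maximalIdeal R) M))) :
    a ∈ (maximalIdeal R ^ n • ⊤ : Submodule R M) := by
  rw [AdicCompletion.pow_smul_top_eq_ker_eval (IsNoetherian.noetherian _), LinearMap.mem_ker,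
    AdicCompletion.eval_of] at ha
  exact (Submodule.Quotient.mk_eq_zero _).1 ha

theorem exists_sub_of_mem_pow_smul (n : ℕ) (b : AdicCompletion (maximalIdeal R) M) :
    ∃ a, b - AdicCompletion.of (maximalIdeal R) M a ∈
      (maximalIdeal R ^ n • ⊤ : Submodule R (AdicCompletion (maximalIdeal R) M)) := by
  obtain ⟨a, ha⟩ := Submodule.mkQ_surjective _ (AdicCompletion.eval (maximalIdeal R) M n b)
  refine ⟨a, ?_⟩
  rw [AdicCompletion.pow_smul_top_eq_ker_eval (IsNoetherian.noetherian _), LinearMap.mem_ker,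
    map_sub, AdicCompletion.eval_of, ← ha, sub_self]

theorem mem_map_pow_iff (n : ℕ) (s : AdicCompletion (maximalIdeal R) R) :
    s ∈ (maximalIdeal R).map (algebraMap R (AdicCompletion (maximalIdeal R) R)) ^ n ↔
      s ∈ (maximalIdeal R ^ n • ⊤ : Submodule R (AdicCompletion (maximalIdeal R) R)) := by
  rw [← mem_map_smul_top_iff (S := AdicCompletion (maximalIdeal R) R), Ideal.map_pow,
    smul_eq_mul, Ideal.mul_top]

theorem adicCompletion_isNoetherianRing : IsNoetherianRing (AdicCompletion (maximalIdeal R) R) := by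
  refine isNoetherianRing_of_isAdicComplete (I := maximalIdeal R) ?_ ?_ ?_
  · rw [← AdicCompletion.maximalIdeal_eq_map]
    infer_instance
  · intro n a ha
    have := mem_of_of_mem_pow_smul R R n a ((mem_map_pow_iff R n _).1 ha)
    rwa [smul_eq_mul, Ideal.mul_top] at this
  · intro n s
    obtain ⟨a, ha⟩ := exists_sub_of_mem_pow_smul R R n s
    exact ⟨a, (mem_map_pow_iff R n _).2 ha⟩

theorem completionMap_of :
    CompletionMap (AdicCompletion (maximalIdeal R) R) (AdicCompletion.of (maximalIdeal R) M) where
  maximalIdeal_eq := AdicCompletion.maximalIdeal_eq_map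
  mem_of_mem n a ha := by
    rw [AdicCompletion.maximalIdeal_eq_map, ← Ideal.map_pow, mem_map_smul_top_iff] at ha
    exact mem_of_of_mem_pow_smul R M n a ha
  dense n b := by
    rw [AdicCompletion.maximalIdeal_eq_map, ← Ideal.map_pow]
    simp_rw [mem_map_smul_top_iff]
    exact exists_sub_of_mem_pow_smul R M n b
  dense_ring n s := by
    obtain ⟨a, ha⟩ := exists_sub_of_mem_pow_smul R R n s
    rw [AdicCompletion.maximalIdeal_eq_map]
    exact ⟨a, (mem_map_pow_iff R n _).2 ha⟩

end AdicCompletionComparison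

section Translation

variable {A : Type} [CommRing A] [IsLocalRing A] [IsNoetherianRing A] {N : Type} [AddCommGroup N]
  [Module A N] [Module.Finite A N]

theorem mLength_eq_length (X : Type) [AddCommGroup X] [Module A X] :
    mLength A X = (Module.length A X : WithBot ℕ∞) :=
  (Module.coe_length A X).symm

theorem withBot_enat_lt_iff {x : WithBot ℕ∞} {n : ℕ} :
    x < (((n + 1 : ℕ) : ℕ∞) : WithBot ℕ∞) ↔ x ≤ ((n : ℕ∞) : WithBot ℕ∞) := by
  induction x using WithBot.recBotCoe with
  | bot => simp
  | coe x =>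
    rw [WithBot.coe_lt_coe, WithBot.coe_le_coe, Nat.cast_add, Nat.cast_one]
    exact ENat.lt_add_one_iff (ENat.natCast_ne_top n)

theorem mDim_submodule_le_iff {W : Submodule A N} {d : ℕ} :
    mDim A W ≤ ((d : ℕ∞) : WithBot ℕ∞) ↔ W ≤ low d ⊥ := by
  rw [le_low_iff, iDimLE_iff_ringKrullDim, Submodule.bot_colon]
  have e : Submodule.annihilator (⊤ : Submodule A W) = W.annihilator := by
    rw [Submodule.annihilator_top]
  rw [mDim, e]
  rfl

theorem mDim_le_iff {d : ℕ} :
    mDim A N ≤ ((d : ℕ∞) : WithBot ℕ∞) ↔ low d (⊥ : Submodule A N) = ⊤ := by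
  rw [← top_le_iff, le_low_iff, iDimLE_iff_ringKrullDim, Submodule.bot_colon]
  rfl

theorem unmixedComp_eq_low {s : ℕ} (h2 : low (s + 2) (⊥ : Submodule A N) = ⊤)
    (h1 : low (s + 1) (⊥ : Submodule A N) ≠ ⊤) : unmixedComp A N = low (s + 1) ⊥ := by
  have hle := mDim_le_iff.2 h2
  have hlt : ∀ W : Submodule A N, mDim A W < mDim A N ↔ W ≤ low (s + 1) ⊥ := by
    intro W
    have hd : mDim A N = (((s + 2 : ℕ) : ℕ∞) : WithBot ℕ∞) := by
      refine le_antisymm hle ?_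
      by_contra hc
      exact h1 (mDim_le_iff.1 (withBot_enat_lt_iff.1 (not_le.1 hc)))
    rw [← mDim_submodule_le_iff, hd, withBot_enat_lt_iff]
  unfold unmixedComp
  simp only [hlt]
  exact csSup_Iic

theorem ofList_ofFn {r : ℕ} (x : Fin r → A) :
    Ideal.ofList (List.ofFn x) = Ideal.span (Set.range x) := by
  refine congrArg Ideal.span (Set.ext fun a => ?_)
  exact List.mem_ofFn

theorem sat_smul_quotient_iff {U : Submodule A N} {I : Ideal A} :
    sat (I • ⊤ : Submodule A (N ⧸ U)) = ⊤ ↔ sat (U ⊔ I • ⊤) = ⊤ := by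
  have e : (I • ⊤ : Submodule A (N ⧸ U)).comap U.mkQ = U ⊔ I • ⊤ := by
    rw [← Submodule.comap_map_mkQ, Submodule.map_smul'', Submodule.map_top, Submodule.range_mkQ]
  rw [← top_le_iff, ← top_le_iff]
  constructor
  · intro h
    obtain ⟨k, hk⟩ := exists_pow_le_colon h
    refine le_sat_of_pow (k := k) fun c hc a _ => ?_
    rw [← e]
    exact hk c hc (U.mkQ a) trivial
  · intro h
    obtain ⟨k, hk⟩ := exists_pow_le_colon h
    refine le_sat_of_pow (k := k) fun c hc a _ => ?_
    obtain ⟨a, rfl⟩ := U.mkQ_surjective a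
    have := hk c hc a trivial
    rwa [← e] at this

theorem isFiniteLength_quotient_iff {F : Submodule A N} :
    IsFiniteLength A (N ⧸ F) ↔ sat F = ⊤ := by
  rw [← length_quotient_ne_top_iff, Module.length_ne_top_iff]

theorem sop_ofFn_iff {U : Submodule A N} {r : ℕ} {x : Fin r → A} :
    Sop U (List.ofFn x) ↔ Ideal.span (Set.range x) ≤ maximalIdeal A ∧
      sat (U ⊔ Ideal.span (Set.range x) • ⊤) = ⊤ := by
  rw [Sop, adjs_eq, ofList_ofFn, Ideal.span_le]
  simp [List.mem_ofFn, Set.range_subset_iff]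

theorem isParamIdeal_quotient_iff {U : Submodule A N} {Q : Ideal A} {r : ℕ} :
    IsParamIdeal A Q (N ⧸ U) r ↔
      ∃ x : Fin r → A, Q = Ideal.span (Set.range x) ∧ Sop U (List.ofFn x) := by
  constructor
  · rintro ⟨hQ, ⟨x, rfl⟩, h⟩
    exact ⟨x, rfl, sop_ofFn_iff.2 ⟨hQ, sat_smul_quotient_iff.1 (isFiniteLength_quotient_iff.1 h)⟩⟩
  · rintro ⟨x, rfl, h⟩
    have h := sop_ofFn_iff.1 h
    exact ⟨h.1, ⟨x, rfl⟩, isFiniteLength_quotient_iff.2 (sat_smul_quotient_iff.2 h.2)⟩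

theorem isParamIdeal_iff {Q : Ideal A} {r : ℕ} :
    IsParamIdeal A Q N r ↔ ∃ x : Fin r → A, Q = Ideal.span (Set.range x) ∧
      Sop (⊥ : Submodule A N) (List.ofFn x) := by
  constructor
  · rintro ⟨hQ, ⟨x, rfl⟩, h⟩
    refine ⟨x, rfl, sop_ofFn_iff.2 ⟨hQ, ?_⟩⟩
    rw [bot_sup_eq]
    exact isFiniteLength_quotient_iff.1 h
  · rintro ⟨x, rfl, h⟩
    have h := sop_ofFn_iff.1 h
    rw [bot_sup_eq] at h
    exact ⟨h.1, ⟨x, rfl⟩, isFiniteLength_quotient_iff.2 h.2⟩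

theorem hasHilbCoeffs_iff {Q : Ideal A} {r : ℕ} {e c : ℕ → ℤ}
    (h : ∀ i ≤ r, c i = (-1) ^ (r - i) * e (r - i)) :
    HasHilbCoeffs A Q N r e ↔ HP (⊥ : Submodule A N) Q r c := by
  have e1 : ∀ n, mLength A (N ⧸ (Q ^ (n + 1) • ⊤ : Submodule A N)) =
      (Module.length A (N ⧸ fil (⊥ : Submodule A N) Q (n + 1)) : WithBot ℕ∞) := by
    intro n
    rw [mLength_eq_length, fil, bot_sup_eq]
  have e2 : ∀ n, ∑ i ∈ Finset.range (r + 1),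
      (-1 : ℤ) ^ i * e i * ((n + r - i).choose (r - i) : ℤ) = numPoly r c n := by
    intro n
    unfold numPoly
    rw [← Finset.sum_range_reflect]
    refine Finset.sum_congr rfl fun i hi => ?_
    have hi : i ≤ r := Nat.lt_succ_iff.1 (Finset.mem_range.1 hi)
    have h1 : r + 1 - 1 - i = r - i := by omega
    have h2 : n + r - (r - i) = n + i := by omega
    have h3 : r - (r - i) = i := by omega
    rw [h1, h2, h3, h i hi]
  unfold HasHilbCoeffs IsHilbPolyAt HP
  simp only [e1, e2, WithBot.coe_inj]

end Translation

section DSequences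

variable {A : Type} [CommRing A] [IsLocalRing A] [IsNoetherianRing A] {N : Type} [AddCommGroup N]
  [Module A N] [Module.Finite A N]

theorem dSeq_iff_getElem {P : Submodule A N} {xs : List A} : DSeq P xs ↔
    ∀ i j (h : i ≤ j) (hj : j < xs.length) (a : N),
      xs[i] • xs[j] • a ∈ adjs P (xs.take i) → xs[j] • a ∈ adjs P (xs.take i) := by
  induction xs generalizing P with
  | nil => simp [DSeq]
  | cons x xs ih =>
    rw [DSeq, ih]
    constructor
    · rintro ⟨h1, h2⟩ i j h hj a ha
      cases i with
      | zero => exact h1 _ (List.getElem_mem hj) a ha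
      | succ i =>
        obtain ⟨j, rfl⟩ : ∃ k, j = k + 1 := ⟨j - 1, by omega⟩
        exact h2 i j (by omega) (by simpa using hj) a ha
    · intro h
      refine ⟨fun y hy a ha => ?_, fun i j hij hj a ha => ?_⟩
      · obtain ⟨j, hj, rfl⟩ := List.mem_iff_getElem.1 hy
        exact h 0 j (Nat.zero_le j) hj a ha
      · exact h (i + 1) (j + 1) (by omega) (by simpa using hj) a ha

theorem mk_mem_span_smul_iff {U : Submodule A N} {r : ℕ} {x : Fin r → A} {i : Fin r} {a : N} :
    U.mkQ a ∈ (Ideal.span (x '' {k | k < i}) • ⊤ : Submodule A (N ⧸ U)) ↔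
      a ∈ adjs U ((List.ofFn x).take i) := by
  have e : (Ideal.span (x '' {k | k < i}) • ⊤ : Submodule A (N ⧸ U)).comap U.mkQ =
      adjs U ((List.ofFn x).take i) := by
    rw [← Submodule.range_mkQ U, ← Submodule.map_top, ← Submodule.map_smul'',
      Submodule.comap_map_mkQ, adjs_eq]
    congr 2
    refine congrArg Ideal.span (Set.ext fun b => ?_)
    simp only [Set.mem_image, Set.mem_ofPred_eq, List.mem_take_iff_getElem, List.getElem_ofFn,
      List.length_ofFn]
    constructor
    · rintro ⟨k, hk, rfl⟩
      exact ⟨k, by omega, rfl⟩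
    · rintro ⟨k, hk, rfl⟩
      exact ⟨⟨k, by omega⟩, by rw [Fin.lt_def]; dsimp only; omega, rfl⟩
  rw [← e, Submodule.mem_comap]

theorem isDSeq_quotient_iff {U : Submodule A N} {r : ℕ} {x : Fin r → A} :
    IsDSeq A x (N ⧸ U) ↔ DSeq U (List.ofFn x) := by
  rw [dSeq_iff_getElem]
  have key : ∀ (i : Fin r) (y : A) (a : N), y • U.mkQ a ∈
      (Ideal.span (x '' {k | k < i}) • ⊤ : Submodule A (N ⧸ U)) ↔
        y • a ∈ adjs U ((List.ofFn x).take i) := by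
    intro i y a
    rw [← map_smul, mk_mem_span_smul_iff]
  constructor
  · intro h i j hij hj a ha
    rw [List.length_ofFn] at hj
    have h1 := SetLike.ext_iff.1 (h ⟨i, by omega⟩ ⟨j, hj⟩ hij) (U.mkQ a)
    simp only [Submodule.mem_comap, LinearMap.lsmul_apply, key] at h1
    simp only [List.getElem_ofFn] at ha ⊢
    exact h1.1 (by rwa [mul_smul])
  · intro h i j hij
    ext a
    obtain ⟨a, rfl⟩ := U.mkQ_surjective a
    simp only [Submodule.mem_comap, LinearMap.lsmul_apply, key]
    constructor
    · intro ha
      have := h i j hij (by simp) a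
      simp only [List.getElem_ofFn, Fin.eta] at this
      exact this (by rwa [← mul_smul])
    · intro ha
      rw [mul_smul]
      exact Submodule.smul_mem _ _ ha

theorem exists_perm_of_ofFn_perm {α : Type} {r : ℕ} {f g : Fin r → α}
    (h : (List.ofFn f).Perm (List.ofFn g)) : ∃ σ : Equiv.Perm (Fin r), f = g ∘ σ := by
  classical
  let σ : Fin r → Fin r := fun k =>
    Fin.cast List.length_ofFn (h.subperm.idxInj (Fin.cast List.length_ofFn.symm k))
  have hσ : Function.Injective σ := fun i j hij => by
    have := h.subperm.idxInj_injective (Fin.cast_injective _ hij)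
    exact Fin.cast_injective _ this
  refine ⟨Equiv.ofBijective σ (Finite.injective_iff_bijective.1 hσ), funext fun k => ?_⟩
  have := h.subperm.getElem_idxInj_eq_getElem (i := Fin.cast List.length_ofFn.symm k)
  simp only [List.getElem_ofFn] at this
  exact this.symm

theorem isStandardSeq_quotient_iff {U : Submodule A N} {r : ℕ} {x : Fin r → A} :
    IsStandardSeq A x (N ⧸ U) ↔ Std U (List.ofFn x) := by
  unfold IsStandardSeq
  simp only [isDSeq_quotient_iff]
  constructor
  · intro h l hl hp
    have hr : r = l.length := by rw [← List.length_ofFn (f := x), ← hl.length_eq, List.length_map]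
    subst hr
    have hl' : (List.ofFn fun k => (l.get k).1).Perm (List.ofFn x) := by
      have := List.map_ofFn (f := l.get) (g := Prod.fst)
      rw [List.ofFn_get] at this
      rwa [this] at hl
    obtain ⟨σ, hσ⟩ := exists_perm_of_ofFn_perm hl'
    have := h (fun k => (l.get (σ.symm k)).2) (fun k => hp _ (l.get_mem _)) σ
    have e : l.map (fun p => p.1 ^ p.2) = List.ofFn fun k =>
        x (σ k) ^ (l.get (σ.symm (σ k))).2 := by
      nth_rewrite 1 [← List.ofFn_get l]
      rw [List.map_ofFn]
      refine congrArg List.ofFn (funext fun k => ?_)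
      rw [Function.comp_apply, σ.symm_apply_apply,
        show x (σ k) = (l.get k).1 from (congrFun hσ k).symm]
    rwa [e]
  · intro h n hn σ
    have := h (List.ofFn fun k => (x (σ k), n (σ k)))
    rw [List.map_ofFn, List.map_ofFn] at this
    refine this (Equiv.Perm.ofFn_comp_perm σ x) fun p hp => ?_
    obtain ⟨k, rfl⟩ := List.mem_ofFn.1 hp
    exact hn _

end DSequences

section FirstCoefficient

variable {R S : Type} [CommRing R] [IsLocalRing R] [IsNoetherianRing R] [CommRing S]
  [IsLocalRing S] [IsNoetherianRing S] [Algebra R S] {M N : Type} [AddCommGroup M] [Module R M]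
  [Module.Finite R M] [AddCommGroup N] [Module R N] [Module S N] [IsScalarTower R S N]
  [Module.Finite S N]

theorem exists_ofFn_eq {α : Type} {r : ℕ} {xs : List α} (h : xs.length = r) :
    ∃ x : Fin r → α, List.ofFn x = xs := by
  subst h
  exact ⟨xs.get, List.ofFn_get xs⟩

theorem CompletionMap.mem_Lambda_iff {ι : M →ₗ[R] N} (h : CompletionMap S ι) {s : ℕ} {a : ℤ} :
    a ∈ Lambda R M (s + 2) ↔ ∃ (ys : List S) (c : ℕ → ℤ), ys.length = s + 2 ∧
      Sop (⊥ : Submodule S N) ys ∧ HP (⊥ : Submodule S N) (Ideal.ofList ys) (s + 2) c ∧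
      a = -c (s + 1) := by
  constructor
  · rintro ⟨Q, e, hQ, he, rfl⟩
    obtain ⟨x, rfl, hx⟩ := isParamIdeal_iff.1 hQ
    refine ⟨(List.ofFn x).map (algebraMap R S), fun i => (-1) ^ (s + 2 - i) * e (s + 2 - i),
      by simp, h.sop_iff.2 hx, ?_, ?_⟩
    · rw [← Ideal.map_ofList, h.hP_iff hx.sat_eq_top, ofList_ofFn]
      exact (hasHilbCoeffs_iff fun i _ => rfl).1 he
    · have : s + 2 - (s + 1) = 1 := by omega
      dsimp only
      rw [this]
      ring
  · rintro ⟨ys, c, hl, hs, hc, rfl⟩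
    obtain ⟨xs, hl', hs', hc'⟩ := h.exists_sop hs
    obtain ⟨x, rfl⟩ := exists_ofFn_eq (hl'.trans hl)
    refine ⟨Ideal.span (Set.range x), fun i => (-1) ^ i * c (s + 2 - i),
      isParamIdeal_iff.2 ⟨x, rfl, hs'⟩, (hasHilbCoeffs_iff (c := c) fun i hi => ?_).2 ?_, ?_⟩
    · rw [← mul_assoc, ← pow_add, ← two_mul, pow_mul, neg_one_sq, one_pow, one_mul,
        Nat.sub_sub_self hi]
    · rw [← ofList_ofFn]
      exact (hc' _ _).2 hc
    · have : s + 2 - 1 = s + 1 := by omega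
      dsimp only
      rw [this]
      ring

theorem isBuchsbaum_quotient_iff {U : Submodule S N} {r : ℕ} : IsBuchsbaum S (N ⧸ U) r ↔
    ∀ xs : List S, xs.length = r → Sop U xs →
      ∃ ys : List S, ys.length = r ∧ Ideal.ofList ys = Ideal.ofList xs ∧ Std U ys := by
  constructor
  · intro h xs hl hs
    obtain ⟨x, rfl⟩ := exists_ofFn_eq hl
    obtain ⟨-, y, hy, hstd⟩ := h _ (isParamIdeal_quotient_iff.2 ⟨x, rfl, hs⟩)
    refine ⟨List.ofFn y, List.length_ofFn, ?_, isStandardSeq_quotient_iff.1 hstd⟩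
    rw [ofList_ofFn, ofList_ofFn, hy]
  · intro h Q hQ
    refine ⟨hQ, ?_⟩
    obtain ⟨x, rfl, hs⟩ := isParamIdeal_quotient_iff.1 hQ
    obtain ⟨ys, hl, hy, hstd⟩ := h _ List.length_ofFn hs
    obtain ⟨y, rfl⟩ := exists_ofFn_eq hl
    rw [ofList_ofFn, ofList_ofFn] at hy
    exact ⟨y, hy.symm, isStandardSeq_quotient_iff.2 hstd⟩

theorem CompletionMap.exists_Lambda_eq_singleton_iff [IsAdicComplete (maximalIdeal S) S]
    {ι : M →ₗ[R] N} (h : CompletionMap S ι) {s : ℕ}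
    (hr : mDim R M = (((s + 2 : ℕ) : ℕ∞) : WithBot ℕ∞)) :
    ((∃ c : ℤ, Lambda R M (s + 2) = {c}) ↔
      mDim S (unmixedComp S N) ≤ ((s : ℕ∞) : WithBot ℕ∞) ∧
        IsBuchsbaum S (N ⧸ unmixedComp S N) (s + 2)) ∧
    ((∃ c : ℤ, Lambda R M (s + 2) = {c}) → Lambda R M (s + 2) = {-Sg s (unmixedComp S N)}) := by
  have h2 : low (s + 2) (⊥ : Submodule S N) = ⊤ := h.low_eq_top_iff.2 (mDim_le_iff.1 hr.le)
  have h1 : low (s + 1) (⊥ : Submodule S N) ≠ ⊤ := by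
    intro hc
    have hc := mDim_le_iff.2 (h.low_eq_top_iff.1 hc)
    rw [← withBot_enat_lt_iff, hr] at hc
    exact lt_irrefl _ hc
  rw [unmixedComp_eq_low h2 h1, mDim_submodule_le_iff, isBuchsbaum_quotient_iff]
  obtain ⟨ys, hl, -, hs⟩ := exists_deep (s + 2) 0 [(⊥ : Submodule S N)] (by simpa using h2)
  have hs := (hs ⊥ (by simp)).2
  obtain ⟨c₀, hc₀⟩ := hs.exists_hP
  rw [hl] at hc₀
  have hne : -c₀ (s + 1) ∈ Lambda R M (s + 2) := h.mem_Lambda_iff.2 ⟨ys, c₀, hl, hs, hc₀, rfl⟩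
  have hfwd : (∃ c : ℤ, Lambda R M (s + 2) = {c}) → low (s + 1) (⊥ : Submodule S N) ≤ low s ⊥ ∧
      ∀ xs : List S, xs.length = s + 2 → Sop (low (s + 1) (⊥ : Submodule S N)) xs →
        ∃ ys : List S, ys.length = s + 2 ∧ Ideal.ofList ys = Ideal.ofList xs ∧
          Std (low (s + 1) (⊥ : Submodule S N)) ys := by
    rintro ⟨C, hC⟩
    obtain ⟨hU, hstd⟩ := std_of_coeff_eq h2 h1 (C := -C) fun xs hl hs c hc => by
      have : -c (s + 1) ∈ Lambda R M (s + 2) := h.mem_Lambda_iff.2 ⟨xs, c, hl, hs, hc, rfl⟩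
      rw [hC, Set.mem_singleton_iff] at this
      rw [← this, neg_neg]
    exact ⟨hU, fun xs hl hs => ⟨xs, hl, rfl, hstd xs hl hs⟩⟩
  have hbwd : (low (s + 1) (⊥ : Submodule S N) ≤ low s ⊥ ∧
      ∀ xs : List S, xs.length = s + 2 → Sop (low (s + 1) (⊥ : Submodule S N)) xs →
        ∃ ys : List S, ys.length = s + 2 ∧ Ideal.ofList ys = Ideal.ofList xs ∧
          Std (low (s + 1) (⊥ : Submodule S N)) ys) →
      Lambda R M (s + 2) = {-Sg s (low (s + 1) (⊥ : Submodule S N))} := by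
    rintro ⟨hU, hS⟩
    refine Set.eq_singleton_iff_nonempty_unique_mem.2 ⟨⟨_, hne⟩, fun a ha => ?_⟩
    obtain ⟨xs, c, hl, hs, hc, rfl⟩ := h.mem_Lambda_iff.1 ha
    rw [coeff_eq_of_std hU hS hl hs hc]
  exact ⟨⟨hfwd, fun hb => ⟨_, hbwd hb⟩⟩, fun hL => hbwd (hfwd hL)⟩

theorem Sg_eq_of_mLength_eq {U : Submodule S N} {s : ℕ} {f : ℕ → ℕ}
    (hf : ∀ i, 1 ≤ i → i ≤ s + 1 → mLength S (LC S i (N ⧸ U)) = ((f i : ℕ∞) : WithBot ℕ∞)) :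
    Sg s U = ∑ i ∈ Finset.Icc 1 (s + 1), (s.choose (i - 1) : ℤ) * (f i : ℤ) := by
  have hI : Finset.Icc 1 (s + 1) = Finset.Ico 1 (s + 1 + 1) := by
    ext i
    simp only [Finset.mem_Icc, Finset.mem_Ico]
    omega
  rw [hI, Finset.sum_Ico_eq_sum_range, Sg]
  refine Finset.sum_congr (by simp) fun i hi => ?_
  have hi : i ≤ s := Nat.lt_succ_iff.1 (Finset.mem_range.1 hi)
  have e : hlen (i + 1) U = (f (i + 1) : ℕ∞) := by
    have := hf (i + 1) (by omega) (by omega)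
    rw [mLength_eq_length, WithBot.coe_inj] at this
    exact this
  rw [hn, e, ENat.toNat_natCast, add_comm 1 i, Nat.add_sub_cancel]

end FirstCoefficient

theorem statement16 (R : Type) [CommRing R] [IsLocalRing R] [IsNoetherianRing R]
    (M : Type) [AddCommGroup M] [Module R M] [Module.Finite R M]
    (r : ℕ) (hr : mDim R M = (r : ℕ∞)) (hr2 : 2 ≤ r)
    [IsLocalRing (AdicCompletion (maximalIdeal R) R)] :
    ((∃ c : ℤ, Lambda R M r = {c}) ↔
      (mDim (AdicCompletion (maximalIdeal R) R)
          ↥(unmixedComp (AdicCompletion (maximalIdeal R) R)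
            (AdicCompletion (maximalIdeal R) M)) ≤ ((r - 2 : ℕ) : ℕ∞) ∧
        IsBuchsbaum (AdicCompletion (maximalIdeal R) R)
          (AdicCompletion (maximalIdeal R) M ⧸
            unmixedComp (AdicCompletion (maximalIdeal R) R)
              (AdicCompletion (maximalIdeal R) M)) r)) ∧
    ((∃ c : ℤ, Lambda R M r = {c}) →
      ∀ (Q : Ideal R) (e : ℕ → ℤ), IsParamIdeal R Q M r →
        HasHilbCoeffs R Q M r e →
      ∀ h : ℕ → ℕ,
        (∀ i, 1 ≤ i → i ≤ r - 1 →
          mLength (AdicCompletion (maximalIdeal R) R)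
            ↥(LC (AdicCompletion (maximalIdeal R) R) i
              (AdicCompletion (maximalIdeal R) M ⧸
                unmixedComp (AdicCompletion (maximalIdeal R) R)
                  (AdicCompletion (maximalIdeal R) M))) = ((h i : ℕ) : ℕ∞)) →
        e 1 = -(∑ i ∈ Finset.Icc 1 (r - 1),
          (((r - 2).choose (i - 1) : ℤ) * (h i : ℤ)))) := by
  have hNoeth := adicCompletion_isNoetherianRing R
  have hFin := adicCompletion_module_finite R M
  obtain ⟨s, rfl⟩ : ∃ s, r = s + 2 := ⟨r - 2, by omega⟩
  obtain ⟨hiff, hval⟩ := (completionMap_of R M).exists_Lambda_eq_singleton_iff hr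
  refine ⟨hiff, fun hL Q e hQ he h hh => ?_⟩
  have he1 : e 1 ∈ Lambda R M (s + 2) := ⟨Q, e, hQ, he, rfl⟩
  rw [hval hL, Set.mem_singleton_iff] at he1
  rw [he1, Sg_eq_of_mLength_eq hh]
  rfl
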